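/- Let {X_i : i ∈ 𝒥} be an m-dependent random field indexed by a finite set 𝒥 ⊆ ℤ^d, with E X_i = 0 and E|X_i|^p < ∞ for some 2 < p ≤ 3, and assume E W² = 1 where W = Σ_{i∈𝒥} X_i. Then there is an absolute constant C such that for every z ∈ ℝ, |F(z) − Φ(z)| ≤ C (1 + |z|)^{−p} · 19^{pd} (m + 1)^{(p−1)d} Σ_{i∈𝒥} E|X_i|^p. -/

import Mathlib

open MeasureTheory ProbabilityTheory Real

noncomputable def stdGaussianCDF : ℝ → ℝ :=
  fun z => ∫ x in Set.Iic z, (Real.sqrt (2 * Real.pi))⁻¹ * Real.exp (-x ^ 2 / 2)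

set_option linter.unusedSectionVars false
set_option linter.unusedVariables false
set_option linter.style.longLine false

namespace BE

noncomputable def gd (x : ℝ) : ℝ := (Real.sqrt (2 * Real.pi))⁻¹ * Real.exp (-x ^ 2 / 2)

lemma cdf_eq (z : ℝ) : stdGaussianCDF z = ∫ x in Set.Iic z, gd x := rfl

lemma gd_pos (x : ℝ) : 0 < gd x := by unfold gd; positivity

lemma sqrt_two_pi_bounds : 1 ≤ Real.sqrt (2 * Real.pi) ∧ Real.sqrt (2 * Real.pi) ≤ 3 := by
  constructor
  · rw [Real.one_le_sqrt]; nlinarith [Real.pi_gt_three]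
  · rw [Real.sqrt_le_left (by norm_num)]; nlinarith [Real.pi_lt_four]

lemma sqrt_two_pi_bound2 : 2 ≤ Real.sqrt (2 * Real.pi) := by
  exact Real.le_sqrt_of_sq_le (by nlinarith [Real.pi_gt_three])

lemma gd_cont : Continuous gd := by unfold gd; fun_prop

lemma integral_exp_half : ∫ x : ℝ, Real.exp (-x ^ 2 / 2) = Real.sqrt (2 * Real.pi) := by
  have := integral_gaussian (1/2)
  rw [show Real.pi / (1/2) = 2 * Real.pi by ring] at this
  rw [← this]; congr 1; ext x; congr 1; ring

lemma integrable_exp_half : Integrable (fun x : ℝ => Real.exp (-x ^ 2 / 2)) := by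
  have := integrable_exp_neg_mul_sq (b := 1/2) (by norm_num)
  refine this.congr (Filter.Eventually.of_forall fun x => ?_)
  simp only; congr 1; ring

lemma gd_int : Integrable gd := integrable_exp_half.const_mul _

lemma gd_total : ∫ x, gd x = 1 := by
  unfold gd
  rw [integral_const_mul, integral_exp_half]
  have := sqrt_two_pi_bounds.1
  field_simp

lemma gd_le (x : ℝ) : gd x ≤ (1/2) * Real.exp (-x^2/2) := by
  unfold gd
  have := sqrt_two_pi_bound2
  gcongr
  rw [inv_le_comm₀ (by linarith) (by norm_num)]; linarith

lemma gd_inv (x : ℝ) : (gd x)⁻¹ ≤ 3 * Real.exp (x^2/2) := by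
  unfold gd
  rw [mul_inv, inv_inv, ← Real.exp_neg]
  have := sqrt_two_pi_bounds.2
  rw [show -(-x^2/2) = x^2/2 by ring]
  gcongr

lemma gd_deriv (x : ℝ) : HasDerivAt gd (-x * gd x) x := by
  unfold gd
  have h1 : HasDerivAt (fun x : ℝ => -x^2/2) (-x) x := by
    have := ((hasDerivAt_pow 2 x).neg.div_const 2)
    exact this.congr_deriv (by norm_num; ring)
  exact (h1.exp.const_mul (Real.sqrt (2 * Real.pi))⁻¹).congr_deriv (by ring)

/-- upper tail -/
noncomputable def Q (u : ℝ) : ℝ := ∫ x in Set.Ioi u, gd x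

lemma Q_nonneg (u : ℝ) : 0 ≤ Q u := setIntegral_nonneg measurableSet_Ioi fun x _ => (gd_pos x).le

lemma Q_add (u : ℝ) : stdGaussianCDF u + Q u = 1 := by
  rw [cdf_eq, Q, ← gd_total, ← Set.compl_Iic]
  exact integral_add_compl measurableSet_Iic gd_int

lemma Q_le_one (u : ℝ) : Q u ≤ 1 := by
  have : 0 ≤ stdGaussianCDF u := by
    rw [cdf_eq]; exact setIntegral_nonneg measurableSet_Iic fun x _ => (gd_pos x).le
  linarith [Q_add u]

lemma cdf_neg (u : ℝ) : stdGaussianCDF (-u) = Q u := by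
  rw [cdf_eq, Q, ← integral_comp_neg_Ioi]
  congr 1; ext x; simp [gd]

lemma mills1 (u : ℝ) (hu : 0 ≤ u) : u * Q u ≤ gd u := by
  have hd : ∀ x ∈ Set.Ici u, HasDerivAt (fun x => - gd x) (x * gd x) x := fun x _ => by
    exact (gd_deriv x).neg.congr_deriv (by ring)
  have hlim : Filter.Tendsto (fun x => - gd x) Filter.atTop (nhds 0) := by
    rw [show (0:ℝ) = -((Real.sqrt (2 * Real.pi))⁻¹ * 0) by simp]
    unfold gd
    refine ((Real.tendsto_exp_atBot.comp ?_).const_mul _).neg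
    have : (fun x : ℝ => -x^2/2) = fun x => -(x^2/2) := by ext; ring
    rw [this]
    exact Filter.tendsto_neg_atTop_atBot.comp
      ((Filter.tendsto_pow_atTop (by norm_num)).atTop_div_const (by norm_num))
  have hIntg := integrableOn_Ioi_deriv_of_nonneg' hd (fun x hx => mul_nonneg (hu.trans hx.le) (gd_pos x).le) hlim
  have := integral_Ioi_of_hasDerivAt_of_nonneg' hd (fun x hx => mul_nonneg (hu.trans hx.le) (gd_pos x).le) hlim
  rw [Q, ← integral_const_mul]
  calc _ ≤ ∫ x in Set.Ioi u, x * gd x := by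
        refine setIntegral_mono_on (gd_int.integrableOn.const_mul _) hIntg measurableSet_Ioi fun x hx => ?_
        exact mul_le_mul_of_nonneg_right (le_of_lt hx) (gd_pos x).le
    _ = gd u := by rw [this]; ring

lemma mills2 (u : ℝ) (hu : 0 ≤ u) : Q u ≤ 3 * gd u := by
  have hI : Integrable (fun x : ℝ => gd u * Real.exp (-(x-u) ^ 2 / 2)) :=
    (integrable_exp_half.comp_sub_right u).const_mul _
  calc Q u ≤ ∫ x in Set.Ioi u, gd u * Real.exp (-(x-u) ^ 2 / 2) := by
        refine setIntegral_mono_on gd_int.integrableOn hI.integrableOn measurableSet_Ioi fun x hx => ?_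
        unfold gd
        rw [mul_assoc, ← Real.exp_add]
        gcongr
        have : u < x := hx
        nlinarith
    _ ≤ ∫ x, gd u * Real.exp (-(x-u) ^ 2 / 2) := by
        refine setIntegral_le_integral hI (Filter.Eventually.of_forall fun x => ?_)
        have := gd_pos u; positivity
    _ = gd u * Real.sqrt (2 * Real.pi) := by
        rw [integral_const_mul, integral_sub_right_eq_self (fun x : ℝ => Real.exp (-x^2/2)), integral_exp_half]
    _ ≤ 3 * gd u := by nlinarith [gd_pos u, sqrt_two_pi_bounds.2]

lemma Q_le (z : ℝ) (hz : -1 ≤ z) : Q z ≤ 2 * Real.exp (-z^2/2) := by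
  by_cases h : 0 ≤ z
  · have := mills2 z h; have := gd_le z; have := Real.exp_pos (-z^2/2); linarith
  · have : (1/2:ℝ) ≤ Real.exp (-z^2/2) := by
      have := Real.add_one_le_exp (-z^2/2); nlinarith
    linarith [Q_le_one z]

lemma cdf_mono {a b : ℝ} (h : a ≤ b) : stdGaussianCDF a ≤ stdGaussianCDF b := by
  rw [cdf_eq, cdf_eq]
  exact setIntegral_mono_set gd_int.integrableOn (Filter.Eventually.of_forall fun x => (gd_pos x).le)
    (Set.Iic_subset_Iic.2 h).eventuallyLE

lemma cdf_bounds (z : ℝ) : 0 ≤ stdGaussianCDF z ∧ stdGaussianCDF z ≤ 1 := by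
  have := Q_add z; have := Q_nonneg z; have := Q_le_one z
  constructor <;> linarith

lemma cdf_incr (z δ : ℝ) (hδ : 0 ≤ δ) :
    stdGaussianCDF (z + δ) - stdGaussianCDF z ≤ δ * Real.exp (-z/4) := by
  rw [cdf_eq, cdf_eq, intervalIntegral.integral_Iic_sub_Iic gd_int.integrableOn gd_int.integrableOn]
  have : ∀ x ∈ Set.Icc z (z+δ), gd x ≤ Real.exp (-z/4) := fun x hx => by
    refine (gd_le x).trans ?_
    have h1 : Real.exp (-x^2/2) ≤ Real.exp (-z/4) * Real.exp (1/32) := by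
      rw [← Real.exp_add]; apply Real.exp_le_exp.2; nlinarith [hx.1, sq_nonneg (x-1/4)]
    have h2 : Real.exp (1/32:ℝ) ≤ 2 := by
      have := Real.exp_one_lt_d9
      have h3 : Real.exp (1/32:ℝ) ≤ 1/(1-1/32) := Real.exp_bound_div_one_sub_of_interval (by norm_num) (by norm_num)
      norm_num at h3 ⊢; linarith
    nlinarith [Real.exp_pos (-z/4)]
  calc _ ≤ ∫ x in z..(z+δ), Real.exp (-z/4) := by
        refine intervalIntegral.integral_mono_on (by linarith) (gd_cont.intervalIntegrable _ _) (by simp) this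
    _ = _ := by simp

end BE

namespace BE

noncomputable def hh (z α w : ℝ) : ℝ := max 0 (min 1 ((z + α - w) / α))

lemma hh_cont (z α : ℝ) : Continuous (hh z α) := by unfold hh; fun_prop
lemma hh_nonneg (z α w : ℝ) : 0 ≤ hh z α w := le_max_left _ _
lemma hh_le_one (z α w : ℝ) : hh z α w ≤ 1 := max_le zero_le_one (min_le_left _ _)
lemma hh_one {z α w : ℝ} (hα : 0 < α) (h : w ≤ z) : hh z α w = 1 := by
  unfold hh
  have : 1 ≤ (z + α - w) / α := by rw [le_div_iff₀ hα]; linarith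
  rw [min_eq_left this]; norm_num
lemma hh_zero {z α w : ℝ} (hα : 0 < α) (h : z + α ≤ w) : hh z α w = 0 := by
  unfold hh
  have : (z + α - w) / α ≤ 0 := div_nonpos_of_nonpos_of_nonneg (by linarith) hα.le
  exact max_eq_left ((min_le_right _ _).trans this)

noncomputable def Nh (z α : ℝ) : ℝ := ∫ x, hh z α x * gd x

lemma hh_gd_int (z α : ℝ) : Integrable (fun x => hh z α x * gd x) := by
  refine gd_int.bdd_mul (c := 1) (hh_cont z α).aestronglyMeasurable
    (Filter.Eventually.of_forall fun x => ?_)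
  rw [Real.norm_eq_abs, abs_of_nonneg (hh_nonneg _ _ _)]; exact hh_le_one _ _ _

lemma Nh_lower {z α : ℝ} (hα : 0 < α) : stdGaussianCDF z ≤ Nh z α := by
  rw [cdf_eq, Nh, ← integral_indicator measurableSet_Iic]
  refine integral_mono (gd_int.indicator measurableSet_Iic) (hh_gd_int z α) fun x => ?_
  by_cases hx : x ≤ z
  · simp [Set.indicator, hx, hh_one hα hx]
  · simp only [Set.indicator, Set.mem_Iic, hx, if_false]
    exact mul_nonneg (hh_nonneg _ _ _) (gd_pos x).le

lemma Nh_upper {z α : ℝ} (hα : 0 < α) : Nh z α ≤ stdGaussianCDF (z + α) := by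
  rw [cdf_eq, Nh, ← integral_indicator measurableSet_Iic]
  refine integral_mono (hh_gd_int z α) (gd_int.indicator measurableSet_Iic) fun x => ?_
  by_cases hx : x ≤ z + α
  · simp only [Set.indicator, Set.mem_Iic, hx, if_true]
    exact mul_le_of_le_one_left (gd_pos x).le (hh_le_one _ _ _)
  · simp [Set.indicator, hx, hh_zero hα (not_le.1 hx).le]

lemma Nh_bounds {z α : ℝ} (hα : 0 < α) : 0 ≤ Nh z α ∧ Nh z α ≤ 1 :=
  ⟨(cdf_bounds z).1.trans (Nh_lower hα), (Nh_upper hα).trans (cdf_bounds _).2⟩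

noncomputable def ig (z α x : ℝ) : ℝ := (hh z α x - Nh z α) * gd x
noncomputable def sf (z α w : ℝ) : ℝ := (gd w)⁻¹ * ∫ x in Set.Iic w, ig z α x
noncomputable def sf' (z α w : ℝ) : ℝ := w * sf z α w + (hh z α w - Nh z α)

lemma ig_int (z α : ℝ) : Integrable (ig z α) := by
  have := (hh_gd_int z α).sub (gd_int.const_mul (Nh z α))
  refine this.congr (Filter.Eventually.of_forall fun x => ?_)
  simp [ig]; ring

lemma ig_cont (z α : ℝ) : Continuous (ig z α) := by
  unfold ig; exact ((hh_cont z α).sub continuous_const).mul gd_cont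

lemma ig_total (z α : ℝ) : ∫ x, ig z α x = 0 := by
  have : ∀ x, ig z α x = hh z α x * gd x - Nh z α * gd x := fun x => by simp [ig]; ring
  simp_rw [this]
  rw [integral_sub (hh_gd_int z α) (gd_int.const_mul _), integral_const_mul, gd_total, Nh]; ring

lemma sf_deriv (z α w : ℝ) : HasDerivAt (sf z α) (sf' z α w) w := by
  have h1 : HasDerivAt (fun w => ∫ x in Set.Iic w, ig z α x) (ig z α w) w := by
    have : (fun w => ∫ x in Set.Iic w, ig z α x) =
        fun w => (∫ x in Set.Iic 0, ig z α x) + ∫ x in (0:ℝ)..w, ig z α x := by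
      ext w
      rw [← intervalIntegral.integral_Iic_sub_Iic (ig_int z α).integrableOn (ig_int z α).integrableOn]
      ring
    rw [this]
    exact (intervalIntegral.integral_hasDerivAt_right ((ig_cont z α).intervalIntegrable _ _)
      ((ig_cont z α).stronglyMeasurableAtFilter _ _) (ig_cont z α).continuousAt).const_add _
  have h2 := ((gd_deriv w).inv (gd_pos w).ne').mul h1
  refine h2.congr_deriv ?_
  have := (gd_pos w).ne'
  simp only [sf', sf, ig, Pi.inv_apply]
  field_simp

lemma sf_cont (z α : ℝ) : Continuous (sf z α) :=
  continuous_iff_continuousAt.2 fun w => (sf_deriv z α w).continuousAt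

lemma sf'_cont (z α : ℝ) : Continuous (sf' z α) := by
  unfold sf'
  exact (continuous_id.mul (sf_cont z α)).add ((hh_cont z α).sub continuous_const)

lemma sf_left {z α w : ℝ} (hα : 0 < α) (h : w ≤ z) :
    sf z α w = (1 - Nh z α) * ((gd w)⁻¹ * Q (-w)) := by
  have : ∫ x in Set.Iic w, ig z α x = (1 - Nh z α) * ∫ x in Set.Iic w, gd x := by
    rw [← integral_const_mul]
    refine setIntegral_congr_fun measurableSet_Iic fun x hx => ?_
    simp [ig, hh_one hα (le_trans hx h)]
  rw [sf, this, ← cdf_eq, ← cdf_neg, neg_neg]; ring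

lemma sf_right {z α : ℝ} (w : ℝ) (hα : 0 < α) : |sf z α w| ≤ (gd w)⁻¹ * Q w := by
  have h0 := integral_add_compl (measurableSet_Iic (a := w)) (ig_int z α)
  rw [ig_total, Set.compl_Iic] at h0
  have h1 : ∫ x in Set.Iic w, ig z α x = - ∫ x in Set.Ioi w, ig z α x := by linarith
  have hi := inv_pos.2 (gd_pos w)
  rw [sf, h1, abs_mul, abs_of_pos hi, abs_neg]
  refine mul_le_mul_of_nonneg_left ?_ hi.le
  refine (abs_integral_le_integral_abs).trans ?_
  refine setIntegral_mono_on (ig_int z α).abs.integrableOn gd_int.integrableOn measurableSet_Ioi fun x _ => ?_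
  rw [ig, abs_mul, abs_of_pos (gd_pos x)]
  refine mul_le_of_le_one_left (gd_pos x).le ?_
  have := Nh_bounds (z := z) hα; have := hh_nonneg z α x; have := hh_le_one z α x
  rw [abs_le]; constructor <;> linarith

lemma millsA (u : ℝ) (hu : 0 ≤ u) : (gd u)⁻¹ * Q u ≤ 3 ∧ u * ((gd u)⁻¹ * Q u) ≤ 1 := by
  have := gd_pos u
  constructor
  · rw [inv_mul_le_iff₀ this]; linarith [mills2 u hu]
  · rw [mul_left_comm, inv_mul_le_iff₀ this]; linarith [mills1 u hu]

lemma millsB (u : ℝ) : (gd u)⁻¹ * Q u ≤ 3 * Real.exp (u^2/2) :=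
  (mul_le_of_le_one_right (inv_pos.2 (gd_pos u)).le (Q_le_one u)).trans (gd_inv u)

lemma gd_even (u : ℝ) : gd (-u) = gd u := by simp [gd]

/-- the derivative of w ↦ w * sf w -/
noncomputable def sg' (z α w : ℝ) : ℝ := sf z α w + w * sf' z α w

/-- all bounds -/
lemma stein_bound {z α w : ℝ} (hz : -1 ≤ z) (hα : 0 < α) :
    |sf z α w| * (1 + w^2) + (1 + |w|) * |hh z α w - Nh z α| ≤
      1000 * (Real.exp (-z/4) * Real.exp (|w|/2)) := by
  have hN := Nh_bounds (z := z) hα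
  have hq : 1 - Nh z α ≤ 2 * Real.exp (-z^2/2) := by
    have := Nh_lower (z := z) hα; have := Q_add z; have := Q_le z hz; linarith
  have e1 : ∀ u : ℝ, 0 ≤ u → 1 + u ≤ 4 * Real.exp (u/4) := fun u hu => by
    have := Real.add_one_le_exp (u/4); linarith
  have e2 : ∀ u : ℝ, 0 ≤ u → 1 + u^2 ≤ 32 * Real.exp (u/4) := fun u hu => by
    have := Real.quadratic_le_exp_of_nonneg (show 0 ≤ u/4 by linarith); nlinarith
  have e3 : Real.exp (-z^2/2) ≤ 2 * Real.exp (-z/4) := by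
    have : Real.exp (-z^2/2) ≤ Real.exp (1/32) * Real.exp (-z/4) := by
      rw [← Real.exp_add]; apply Real.exp_le_exp.2; nlinarith [sq_nonneg (z-1/4)]
    have h3 : Real.exp (1/32:ℝ) ≤ 1/(1-1/32) := Real.exp_bound_div_one_sub_of_interval (by norm_num) (by norm_num)
    norm_num at h3; nlinarith [Real.exp_pos (-z/4)]
  have e4 : Real.exp (|w|/2) = Real.exp (|w|/4) * Real.exp (|w|/4) := by
    rw [← Real.exp_add]; congr 1; ring
  have e5 : 1 ≤ Real.exp (|w|/4) := Real.one_le_exp (by positivity)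
  have ez := Real.exp_pos (-z/4)
  have hf0 := abs_nonneg (sf z α w)
  have hw0 := abs_nonneg w
  rcases le_total w z with hwz | hwz
  · have hh1 := hh_one hα hwz
    rw [hh1, abs_of_nonneg (by linarith : 0 ≤ 1 - Nh z α)]
    have hsf := sf_left hα hwz
    have hM0 : 0 ≤ (gd w)⁻¹ * Q (-w) := mul_nonneg (inv_pos.2 (gd_pos w)).le (Q_nonneg _)
    have hsf' : |sf z α w| = (1 - Nh z α) * ((gd w)⁻¹ * Q (-w)) := by
      rw [hsf, abs_of_nonneg (mul_nonneg (by linarith) hM0)]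
    set q := 1 - Nh z α
    have hq0 : 0 ≤ q := by simp only [q]; linarith
    have hq4 : q ≤ 4 * Real.exp (-z/4) := by linarith
    rcases le_total w 0 with hw | hw
    · have hm := millsA (-w) (by linarith)
      rw [gd_even] at hm
      rw [abs_of_nonpos hw] at *
      rw [hsf']
      set M := (gd w)⁻¹ * Q (-w)
      have h1 : M * (1 + w^2) ≤ 3 + (-w) := by nlinarith
      have h2 : q * M * (1 + w^2) + (1 + -w) * q ≤ q * (4 * (1 + -w)) := by nlinarith
      have h3 := e1 (-w) (by linarith)
      have h4 : q * (4 * (1 + -w)) ≤ (4 * Real.exp (-z/4)) * (16 * Real.exp (-w/4)) := by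
        apply mul_le_mul hq4 _ (by linarith) (by positivity); linarith
      rw [e4]
      nlinarith [mul_pos ez (Real.exp_pos (-w/4)), mul_nonneg (mul_pos ez (Real.exp_pos (-w/4))).le (sub_nonneg.2 e5)]
    · rw [abs_of_nonneg hw] at *
      have hm := millsB (-w)
      rw [gd_even, neg_sq] at hm
      rw [hsf']
      set M := (gd w)⁻¹ * Q (-w)
      have h1 : q * M ≤ 12 * (Real.exp (-z/4) * Real.exp (w/4)) := by
        calc q * M ≤ (2 * Real.exp (-z^2/2)) * (3 * Real.exp (w^2/2)) :=
              mul_le_mul hq hm hM0 (by positivity)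
          _ = 6 * Real.exp ((w^2-z^2)/2) := by
              rw [show (w^2-z^2)/2 = -z^2/2 + w^2/2 by ring, Real.exp_add]; ring
          _ ≤ 6 * (Real.exp (1/32) * (Real.exp (-z/4) * Real.exp (w/4))) := by
              rw [← Real.exp_add, ← Real.exp_add]
              gcongr
              nlinarith [sq_nonneg (z-w-1/4), mul_nonneg (sub_nonneg.2 hwz) hw]
          _ ≤ _ := by
              have h3 : Real.exp (1/32:ℝ) ≤ 1/(1-1/32) := Real.exp_bound_div_one_sub_of_interval (by norm_num) (by norm_num)
              norm_num at h3; nlinarith [mul_pos ez (Real.exp_pos (w/4))]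
      have h2 := e2 w hw
      have h3 : q * M * (1 + w^2) ≤ 12 * (Real.exp (-z/4) * Real.exp (w/4)) * (32 * Real.exp (w/4)) :=
        mul_le_mul h1 h2 (by positivity) (by positivity)
      have h4 : (1 + w) * q ≤ (4 * Real.exp (w/4)) * (4 * Real.exp (-z/4)) :=
        mul_le_mul (e1 w hw) hq4 hq0 (by positivity)
      rw [e4]
      nlinarith [mul_pos ez (Real.exp_pos (w/4)), mul_nonneg (mul_pos ez (Real.exp_pos (w/4))).le (sub_nonneg.2 e5)]
  · have hb : |hh z α w - Nh z α| ≤ 1 := by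
      have := hh_nonneg z α w; have := hh_le_one z α w
      rw [abs_le]; constructor <;> linarith
    have hsf := sf_right (z := z) w hα
    rcases le_total w 0 with hw | hw
    · have hm := millsB w
      have h1 : Real.exp (w^2/2) ≤ 2 := by
        have : Real.exp (w^2/2) ≤ Real.exp (1/2) := Real.exp_le_exp.2 (by nlinarith)
        have h3 : Real.exp (1/2:ℝ) ≤ 1/(1-1/2) := Real.exp_bound_div_one_sub_of_interval (by norm_num) (by norm_num)
        norm_num at h3; linarith
      have h2 : |sf z α w| ≤ 6 := by linarith
      have h3 : 1 ≤ Real.exp (-z/4) := Real.one_le_exp (by linarith)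
      have h4 : |w| ≤ 1 := by rw [abs_of_nonpos hw]; linarith
      have h5 : w^2 ≤ 1 := by rw [← sq_abs]; nlinarith
      have h6 : 1 ≤ Real.exp (-z/4) * Real.exp (|w|/2) := by rw [e4]; nlinarith
      nlinarith [abs_nonneg (hh z α w - Nh z α)]
    · have hm := millsA w hw
      rw [abs_of_nonneg hw] at *
      have h1 : |sf z α w| * (1 + w^2) ≤ 3 + w := by
        have : w * |sf z α w| ≤ 1 := (mul_le_mul_of_nonneg_left hsf hw).trans hm.2
        nlinarith
      have h2 := e1 w hw
      have h3 : 1 ≤ Real.exp (-z/4) * Real.exp (w/4) := by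
        rw [← Real.exp_add]; exact Real.one_le_exp (by linarith)
      rw [e4]
      nlinarith [Real.exp_pos (w/4)]

lemma sf'_bound {z α : ℝ} (w : ℝ) (hz : -1 ≤ z) (hα : 0 < α) :
    |sf' z α w| ≤ 1000 * (Real.exp (-z/4) * Real.exp (|w|/2)) := by
  refine le_trans ?_ (stein_bound (w := w) hz hα)
  rw [sf']
  refine (abs_add_le _ _).trans ?_
  rw [abs_mul]
  have h1 : |w| ≤ 1 + w^2 := by rw [← sq_abs]; nlinarith [sq_nonneg (|w| - 1)]
  nlinarith [abs_nonneg (sf z α w), mul_nonneg (abs_nonneg w) (abs_nonneg (hh z α w - Nh z α)),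
    mul_le_mul_of_nonneg_left h1 (abs_nonneg (sf z α w))]

lemma sg'_bound {z α : ℝ} (w : ℝ) (hz : -1 ≤ z) (hα : 0 < α) :
    |sg' z α w| ≤ 1000 * (Real.exp (-z/4) * Real.exp (|w|/2)) := by
  refine le_trans ?_ (stein_bound (w := w) hz hα)
  rw [sg', sf', show sf z α w + w * (w * sf z α w + (hh z α w - Nh z α))
    = sf z α w * (1 + w^2) + w * (hh z α w - Nh z α) by ring]
  refine (abs_add_le _ _).trans ?_
  rw [abs_mul, abs_mul, abs_of_nonneg (by positivity : 0 ≤ 1 + w^2)]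
  nlinarith [abs_nonneg (hh z α w - Nh z α)]

lemma sg_deriv (z α w : ℝ) : HasDerivAt (fun w => w * sf z α w) (sg' z α w) w := by
  refine ((hasDerivAt_id w).mul (sf_deriv z α w)).congr_deriv ?_
  simp [sg']

lemma sg_lip {z α : ℝ} (hz : -1 ≤ z) (hα : 0 < α) (w t : ℝ) (ht : |t| ≤ 1) :
    |w * sf z α w - (w - t) * sf z α (w - t)| ≤ 2000 * (Real.exp (-z/4) * Real.exp (|w|/2)) * |t| := by
  have := (convex_Icc (w - |t|) (w + |t|)).norm_image_sub_le_of_norm_hasDerivWithin_le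
    (f := fun w => w * sf z α w) (f' := sg' z α) (C := 2000 * (Real.exp (-z/4) * Real.exp (|w|/2)))
    (x := w - t) (y := w)
    (fun x _ => (sg_deriv z α x).hasDerivWithinAt) (fun x hx => ?_) ?_ ?_
  · simpa [Real.norm_eq_abs] using this
  · rw [Real.norm_eq_abs]
    refine (sg'_bound x hz hα).trans ?_
    have h1 : |x| ≤ |w| + 1 := by
      have : |x - w| ≤ |t| := by rw [abs_le]; constructor <;> linarith [hx.1, hx.2]
      calc |x| = |w + (x - w)| := by ring_nf
        _ ≤ |w| + |x - w| := abs_add_le _ _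
        _ ≤ _ := by linarith
    have h2 : Real.exp (|x|/2) ≤ 2 * Real.exp (|w|/2) := by
      have h3 : Real.exp (1/2:ℝ) ≤ 1/(1-1/2) := Real.exp_bound_div_one_sub_of_interval (by norm_num) (by norm_num)
      norm_num at h3
      calc Real.exp (|x|/2) ≤ Real.exp (1/2 + |w|/2) := Real.exp_le_exp.2 (by linarith)
        _ = Real.exp (1/2) * Real.exp (|w|/2) := Real.exp_add _ _
        _ ≤ _ := by norm_num; gcongr
    nlinarith [Real.exp_pos (-z/4)]
  · constructor <;> linarith [le_abs_self t, neg_abs_le t]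
  · constructor <;> linarith [abs_nonneg t]

lemma hh_lip {z α : ℝ} (hα : 0 < α) (a b : ℝ) : |hh z α a - hh z α b| ≤ |a - b| / α := by
  unfold hh
  have h1 := abs_max_sub_max_le_max 0 (min 1 ((z + α - a) / α)) 0 (min 1 ((z + α - b) / α))
  have h2 := abs_min_sub_min_le_max 1 ((z + α - a) / α) 1 ((z + α - b) / α)
  simp only [sub_self, abs_zero] at h1 h2
  refine h1.trans (max_le (by positivity) (h2.trans (max_le (by positivity) (le_of_eq ?_))))
  rw [← sub_div, abs_div, abs_of_pos hα, show z + α - a - (z + α - b) = -(a - b) by ring, abs_neg]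

/-- jump bound -/
noncomputable def jmp (z α w v : ℝ) : ℝ := if z - v ≤ w ∧ w ≤ z + α + v then min 1 (v / α) else 0

lemma hh_jump {z α : ℝ} (hα : 0 < α) (w t v : ℝ) (ht : |t| ≤ v) :
    |hh z α w - hh z α (w - t)| ≤ jmp z α w v := by
  have h1 := abs_le.1 ht
  unfold jmp
  split_ifs with h
  · refine le_min ?_ ?_
    · have := hh_nonneg z α w; have := hh_le_one z α w
      have := hh_nonneg z α (w-t); have := hh_le_one z α (w-t)
      rw [abs_le]; constructor <;> linarith
    · refine (hh_lip hα _ _).trans ?_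
      rw [sub_sub_cancel]; gcongr
  · rw [not_and_or, not_le, not_le] at h
    rcases h with h | h
    · rw [hh_one hα (by linarith), hh_one hα (by linarith)]; simp
    · rw [hh_zero hα (by linarith), hh_zero hα (by linarith)]; simp

lemma sf'_lip {z α : ℝ} (hz : -1 ≤ z) (hα : 0 < α) (w t v : ℝ) (ht : |t| ≤ v) (hv : v ≤ 1) :
    |sf' z α w - sf' z α (w - t)| ≤
      2000 * (Real.exp (-z/4) * Real.exp (|w|/2)) * v + jmp z α w v := by
  have h1 := sg_lip hz hα w t (ht.trans hv)
  have h2 := hh_jump (z := z) hα w t v ht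
  have h3 : sf' z α w - sf' z α (w - t) = (w * sf z α w - (w - t) * sf z α (w - t))
    + (hh z α w - hh z α (w - t)) := by unfold sf'; ring
  rw [h3]
  refine (abs_add_le _ _).trans (add_le_add (h1.trans ?_) h2)
  gcongr

lemma sf_taylor {z α : ℝ} (hz : -1 ≤ z) (hα : 0 < α) (w y v : ℝ) (hy : |y| ≤ v) (hv : v ≤ 1) :
    |sf z α w - sf z α (w - y) - y * sf' z α w| ≤
      |y| * (2000 * (Real.exp (-z/4) * Real.exp (|w|/2)) * v + jmp z α w v) := by
  have := (convex_Icc (w - |y|) (w + |y|)).norm_image_sub_le_of_norm_hasDerivWithin_le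
    (f := fun s => sf z α s - s * sf' z α w) (f' := fun s => sf' z α s - 1 * sf' z α w)
    (C := 2000 * (Real.exp (-z/4) * Real.exp (|w|/2)) * v + jmp z α w v)
    (x := w - y) (y := w)
    (fun x _ => ((sf_deriv z α x).sub ((hasDerivAt_id x).mul_const _)).hasDerivWithinAt) (fun x hx => ?_) ?_ ?_
  · rw [Real.norm_eq_abs, Real.norm_eq_abs, sub_sub_cancel] at this
    rw [mul_comm |y|]
    refine le_trans (le_of_eq ?_) this
    congr 1; ring
  · rw [Real.norm_eq_abs, one_mul, abs_sub_comm]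
    have := sf'_lip hz hα w (w - x) v ?_ hv
    · simpa using this
    · rw [abs_le]; constructor <;> linarith [hx.1, hx.2]
  · constructor <;> linarith [le_abs_self y, neg_abs_le y]
  · constructor <;> linarith [abs_nonneg y]

end BE

namespace BE

/-- bounded measurable -/
def BM {Ω : Type*} (m : MeasurableSpace Ω) (U : Ω → ℝ) : Prop :=
  Measurable[m] U ∧ ∃ c, ∀ ω, |U ω| ≤ c

namespace BM
variable {Ω : Type*} {m m' mΩ : MeasurableSpace Ω} {U V : Ω → ℝ}

lemma mono (h : BM m U) (hm : m ≤ m') : BM m' U := ⟨h.1.mono hm le_rfl, h.2⟩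
lemma const (c : ℝ) : BM m (fun _ => c) := ⟨measurable_const, |c|, fun _ => le_rfl⟩
lemma add (hU : BM m U) (hV : BM m V) : BM m (fun ω => U ω + V ω) := by
  obtain ⟨c, hc⟩ := hU.2; obtain ⟨d, hd⟩ := hV.2
  exact ⟨hU.1.add hV.1, c + d, fun ω => (abs_add_le _ _).trans (add_le_add (hc ω) (hd ω))⟩
lemma neg (hU : BM m U) : BM m (fun ω => - U ω) := by
  obtain ⟨c, hc⟩ := hU.2
  exact ⟨hU.1.neg, c, fun ω => by rw [abs_neg]; exact hc ω⟩
lemma sub (hU : BM m U) (hV : BM m V) : BM m (fun ω => U ω - V ω) := by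
  simpa [sub_eq_add_neg] using hU.add hV.neg
lemma mul (hU : BM m U) (hV : BM m V) : BM m (fun ω => U ω * V ω) := by
  obtain ⟨c, hc⟩ := hU.2; obtain ⟨d, hd⟩ := hV.2
  refine ⟨hU.1.mul hV.1, c * d, fun ω => ?_⟩
  rw [abs_mul]
  exact mul_le_mul (hc ω) (hd ω) (abs_nonneg _) ((abs_nonneg _).trans (hc ω))
lemma cmul (a : ℝ) (hU : BM m U) : BM m (fun ω => a * U ω) := (BM.const a).mul hU
lemma comp {g : ℝ → ℝ} (hg : Continuous g) (hU : BM m U) : BM m (fun ω => g (U ω)) := by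
  obtain ⟨c, hc⟩ := hU.2
  obtain ⟨d, hd⟩ := (isCompact_Icc (a := -c) (b := c)).exists_bound_of_continuousOn hg.continuousOn
  exact ⟨hg.measurable.comp hU.1, d, fun ω => by
    simpa using hd (U ω) (abs_le.1 (hc ω))⟩
lemma abs (hU : BM m U) : BM m (fun ω => |U ω|) := hU.comp continuous_abs
lemma pow (n : ℕ) (hU : BM m U) : BM m (fun ω => U ω ^ n) := hU.comp (continuous_pow n)
lemma exp (hU : BM m U) : BM m (fun ω => Real.exp (U ω)) := hU.comp Real.continuous_exp
lemma sum {ι : Type*} (s : Finset ι) {U : ι → Ω → ℝ} (h : ∀ i ∈ s, BM m (U i)) :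
    BM m (fun ω => ∑ i ∈ s, U i ω) := by
  classical
  induction s using Finset.induction_on with
  | empty => simpa using BM.const (m := m) 0
  | insert a s ha ih =>
    simp only [Finset.sum_insert ha]
    exact (h a (by simp)).add (ih fun i hi => h i (by simp [hi]))
lemma ite {p : Ω → Prop} [DecidablePred p] (hp : MeasurableSet[m] {ω | p ω}) :
    BM m (fun ω => if p ω then (1:ℝ) else 0) :=
  ⟨Measurable.ite hp measurable_const measurable_const, 1, fun ω => by
    simp only; split_ifs <;> simp⟩
lemma iteLe (hU : BM m U) (hV : BM m V) : BM m (fun ω => if U ω ≤ V ω then (1:ℝ) else 0) :=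
  BM.ite (measurableSet_le hU.1 hV.1)
lemma ite_mul {p : Ω → Prop} [DecidablePred p] (hp : MeasurableSet[m] {ω | p ω}) (hU : BM m U) :
    BM m (fun ω => if p ω then U ω else 0) := by
  have := (BM.ite hp).mul hU
  simpa [_root_.ite_mul] using this
lemma integrable [mΩ : MeasurableSpace Ω] {μ : Measure Ω} [IsFiniteMeasure μ]
    (h : BM m U) (hm : m ≤ mΩ) : Integrable U μ := by
  obtain ⟨c, hc⟩ := h.2
  exact Integrable.of_bound (h.1.mono hm le_rfl).aestronglyMeasurable c
    (Filter.Eventually.of_forall fun ω => by simpa using hc ω)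
end BM

structure Fld {Ω ι : Type*} [mΩ : MeasurableSpace Ω] (μ : Measure Ω)
    (F : Set ι → MeasurableSpace Ω) (D : ι → ι → ℕ) : Prop where
  le : ∀ S, F S ≤ mΩ
  mono : ∀ S T, S ⊆ T → F S ≤ F T
  self : ∀ i, D i i = 0
  symm : ∀ i j, D i j = D j i
  tri : ∀ i j k, D i k ≤ D i j + D j k
  indep : ∀ S T, (∀ a ∈ S, ∀ b ∈ T, 1 < D a b) → Indep (F S) (F T) μ

lemma indep_mul {Ω : Type*} [mΩ : MeasurableSpace Ω] {μ : Measure Ω} [IsProbabilityMeasure μ]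
    {m m' : MeasurableSpace Ω} (h : Indep m m' μ) (hm : m ≤ mΩ) (hm' : m' ≤ mΩ) {U V : Ω → ℝ}
    (hU : Measurable[m] U) (hV : Measurable[m'] V) :
    ∫ ω, U ω * V ω ∂μ = (∫ ω, U ω ∂μ) * ∫ ω, V ω ∂μ := by
  have hi : IndepFun U V μ := by
    rw [IndepFun_iff_Indep]
    exact indep_of_indep_of_le_right (indep_of_indep_of_le_left h hU.comap_le) hV.comap_le
  exact hi.integral_fun_mul_eq_mul_integral (hU.mono hm le_rfl).aestronglyMeasurable (hV.mono hm' le_rfl).aestronglyMeasurable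

section
variable {Ω ι : Type*} [mΩ : MeasurableSpace Ω] {μ : Measure Ω} [IsProbabilityMeasure μ] [Fintype ι]
  {F : Set ι → MeasurableSpace Ω} {D : ι → ι → ℕ} {X : ι → Ω → ℝ}

/-- ball -/
def NB (D : ι → ι → ℕ) (r : ℕ) (i : ι) : Set ι := {j | D i j ≤ r}
def FB (D : ι → ι → ℕ) (r : ℕ) (i : ι) : Set ι := {j | r < D i j}
/-- ball sum -/
def Vs (X : ι → Ω → ℝ) (D : ι → ι → ℕ) (r : ℕ) (i : ι) (ω : Ω) : ℝ := ∑ j with D i j ≤ r, X j ω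
/-- far sum -/
def Wf (X : ι → Ω → ℝ) (D : ι → ι → ℕ) (r : ℕ) (i : ι) (ω : Ω) : ℝ := ∑ j with r < D i j, X j ω
def WW (X : ι → Ω → ℝ) (ω : Ω) : ℝ := ∑ j, X j ω
def Sb (X : ι → Ω → ℝ) (D : ι → ι → ℕ) (i : ι) (ω : Ω) : ℝ := ∑ j with D i j ≤ 9, |X j ω|

lemma W_split (X : ι → Ω → ℝ) (D : ι → ι → ℕ) (r : ℕ) (i : ι) (ω : Ω) :
    WW X ω = Vs X D r i ω + Wf X D r i ω := by
  unfold WW Vs Wf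
  rw [← Finset.sum_filter_add_sum_filter_not Finset.univ (fun j => D i j ≤ r)]
  simp only [not_le]

structure BF (μ : Measure Ω) (F : Set ι → MeasurableSpace Ω) (D : ι → ι → ℕ) (X : ι → Ω → ℝ)
    (β : ℝ) : Prop extends Fld μ F D where
  meas : ∀ i, Measurable[F {i}] (X i)
  mean : ∀ i, ∫ ω, X i ω ∂μ = 0
  bdd : ∀ i ω, Sb X D i ω ≤ 1
  third : ∑ i, ∫ ω, Sb X D i ω ^ 3 ∂μ ≤ β
  small : β ≤ 1
  var : ∫ ω, WW X ω ^ 2 ∂μ ≤ 2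

variable {β : ℝ}

namespace BF

lemma Sb_nonneg (X : ι → Ω → ℝ) (D : ι → ι → ℕ) (i : ι) (ω : Ω) : 0 ≤ Sb X D i ω :=
  Finset.sum_nonneg fun _ _ => abs_nonneg _

lemma abs_sum_le_Sb (X : ι → Ω → ℝ) (D : ι → ι → ℕ) (i : ι) (ω : Ω) (s : Finset ι)
    (hs : ∀ j ∈ s, D i j ≤ 9) : ∑ j ∈ s, |X j ω| ≤ Sb X D i ω := by
  unfold Sb
  exact Finset.sum_le_sum_of_subset_of_nonneg (fun j hj => by simp [hs j hj]) fun _ _ _ => abs_nonneg _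

lemma Vs_le_Sb (X : ι → Ω → ℝ) (D : ι → ι → ℕ) (r : ℕ) (hr : r ≤ 9) (i : ι) (ω : Ω) :
    |Vs X D r i ω| ≤ Sb X D i ω :=
  (Finset.abs_sum_le_sum_abs _ _).trans
    (abs_sum_le_Sb X D i ω _ fun j hj => ((Finset.mem_filter.1 hj).2.trans hr))


lemma Vs_le (h : BF μ F D X β) (r : ℕ) (hr : r ≤ 9) (i : ι) (ω : Ω) : |Vs X D r i ω| ≤ 1 :=
  (Vs_le_Sb X D r hr i ω).trans (h.bdd i ω)

lemma X_le_Sb (h : BF μ F D X β) (i j : ι) (hij : D i j ≤ 9) (ω : Ω) : |X j ω| ≤ Sb X D i ω := by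
  simpa using abs_sum_le_Sb X D i ω {j} (by simpa using hij)

lemma bm (h : BF μ F D X β) {S : Set ι} {i : ι} (hi : i ∈ S) : BM (F S) (X i) :=
  BM.mono ⟨h.meas i, 1, fun ω => (h.X_le_Sb i i (by simp [h.self]) ω).trans (h.bdd i ω)⟩
    (h.mono _ _ (by simpa using hi))

lemma bmSum (h : BF μ F D X β) {S : Set ι} (s : Finset ι) (hs : ∀ j ∈ s, j ∈ S) :
    BM (F S) (fun ω => ∑ j ∈ s, X j ω) := BM.sum s fun j hj => h.bm (hs j hj)

lemma bmVs (h : BF μ F D X β) (r : ℕ) (i : ι) : BM (F (NB D r i)) (Vs X D r i) :=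
  h.bmSum _ fun j hj => (Finset.mem_filter.1 hj).2

lemma bmWf (h : BF μ F D X β) (r : ℕ) (i : ι) : BM (F (FB D r i)) (Wf X D r i) :=
  h.bmSum _ fun j hj => (Finset.mem_filter.1 hj).2

lemma bmW (h : BF μ F D X β) : BM (F Set.univ) (WW X) := h.bmSum _ fun j _ => Set.mem_univ j

lemma toTop (h : BF μ F D X β) {S : Set ι} {U : Ω → ℝ} (hU : BM (F S) U) : BM (F Set.univ) U :=
  hU.mono (h.mono _ _ (Set.subset_univ S))

lemma int (h : BF μ F D X β) {S : Set ι} {U : Ω → ℝ} (hU : BM (F S) U) : Integrable U μ := hU.integrable (h.le S)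

lemma bmSb (h : BF μ F D X β) (i : ι) : BM (F Set.univ) (Sb X D i) := BM.sum _ fun j _ => (h.bm (Set.mem_univ j)).abs

lemma imul (h : BF μ F D X β) {S T : Set ι} (hST : ∀ a ∈ S, ∀ b ∈ T, 1 < D a b) {U V : Ω → ℝ}
    (hU : BM (F S) U) (hV : BM (F T) V) :
    ∫ ω, U ω * V ω ∂μ = (∫ ω, U ω ∂μ) * ∫ ω, V ω ∂μ :=
  indep_mul (h.indep S T hST) (h.le S) (h.le T) hU.1 hV.1

lemma sepNF (h : BF μ F D X β) (r : ℕ) (i : ι) : ∀ a ∈ NB D r i, ∀ b ∈ FB D (r+1) i, 1 < D a b := by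
  intro a ha b hb
  have := h.tri i a b
  simp only [NB, FB, Set.mem_ofPred_eq] at ha hb
  omega

/-- the negative field -/
lemma neg (h : BF μ F D X β) : BF μ F D (fun i ω => - X i ω) β where
  toFld := h.toFld
  meas i := (h.meas i).neg
  mean i := by rw [integral_neg, h.mean i, neg_zero]
  bdd i ω := by simpa [Sb] using h.bdd i ω
  third := by simpa [Sb] using h.third
  small := h.small
  var := by simpa [WW] using h.var

lemma ES_jensen (h : BF μ F D X β) (i : ι) : (∫ ω, Sb X D i ω ^ 2 ∂μ) * (∫ ω, Sb X D i ω ∂μ) ≤ ∫ ω, Sb X D i ω ^ 3 ∂μ := by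
  set c := ∫ ω, Sb X D i ω ∂μ with hc
  have hb := h.bmSb i
  -- (S - c)^2 (S + c) ≥ 0 gives S^3 - c S^2 - c^2 S + c^3 ≥ 0
  have h0 : 0 ≤ ∫ ω, (Sb X D i ω ^ 3 - c * Sb X D i ω ^ 2 - (c^2 * Sb X D i ω - c^3)) ∂μ := by
    refine integral_nonneg fun ω => ?_
    have hc0 : 0 ≤ c := integral_nonneg fun ω => Sb_nonneg X D i ω
    have := Sb_nonneg X D i ω
    have h1 : 0 ≤ (Sb X D i ω - c)^2 * (Sb X D i ω + c) := by positivity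
    simp only [Pi.zero_apply]; nlinarith
  rw [integral_sub (h.int ((hb.pow 3).sub ((hb.pow 2).cmul c))) (h.int ((hb.cmul _).sub (BM.const _))),
    integral_sub (h.int (hb.pow 3)) (h.int ((hb.pow 2).cmul c)),
    integral_sub (h.int (hb.cmul _)) (h.int (BM.const (m := F Set.univ) _)), integral_const_mul, integral_const_mul, ← hc] at h0
  simp at h0
  linarith

lemma ES3_nonneg (h : BF μ F D X β) (i : ι) : 0 ≤ ∫ ω, Sb X D i ω ^ 3 ∂μ :=
  integral_nonneg fun ω => pow_nonneg (Sb_nonneg X D i ω) 3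

lemma ES3_le (h : BF μ F D X β) (i : ι) : ∫ ω, Sb X D i ω ^ 3 ∂μ ≤ β :=
  (Finset.single_le_sum (f := fun i => ∫ ω, Sb X D i ω ^ 3 ∂μ) (fun j _ => h.ES3_nonneg j) (Finset.mem_univ i)).trans h.third

lemma beta_nonneg (h : BF μ F D X β) : 0 ≤ β := (Finset.sum_nonneg fun j _ => h.ES3_nonneg j).trans h.third

/-- E|ζ| V ≤ 2 E S^3 type domination : local variable U with |U| ≤ S^2, centred -/
lemma zeta_dom (h : BF μ F D X β) (i : ι) {U V : Ω → ℝ} (hU : BM (F Set.univ) U) (hV : BM (F Set.univ) V)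
    (hU2 : ∀ ω, |U ω| ≤ Sb X D i ω ^ 2) (hV1 : ∀ ω, |V ω| ≤ Sb X D i ω) :
    ∫ ω, |U ω - ∫ ω', U ω' ∂μ| * |V ω| ∂μ ≤ 2 * ∫ ω, Sb X D i ω ^ 3 ∂μ := by
  have hb := h.bmSb i
  set c := ∫ ω', U ω' ∂μ
  have hc : |c| ≤ ∫ ω, Sb X D i ω ^ 2 ∂μ :=
    (abs_integral_le_integral_abs).trans (integral_mono (h.int hU.abs) (h.int (hb.pow 2)) hU2)
  have hS0 : 0 ≤ ∫ ω, Sb X D i ω ∂μ := integral_nonneg fun ω => Sb_nonneg X D i ω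
  calc ∫ ω, |U ω - c| * |V ω| ∂μ ≤ ∫ ω, (Sb X D i ω ^ 3 + |c| * Sb X D i ω) ∂μ := by
        refine integral_mono (h.int ((hU.sub (BM.const c)).abs.mul hV.abs))
          (h.int ((hb.pow 3).add (hb.cmul _))) fun ω => ?_
        have h1 : |U ω - c| ≤ Sb X D i ω ^ 2 + |c| := (abs_sub _ _).trans (by linarith [hU2 ω])
        calc |U ω - c| * |V ω| ≤ (Sb X D i ω ^ 2 + |c|) * Sb X D i ω :=
              mul_le_mul h1 (hV1 ω) (abs_nonneg _) (by positivity)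
          _ = _ := by ring
    _ = (∫ ω, Sb X D i ω ^ 3 ∂μ) + |c| * ∫ ω, Sb X D i ω ∂μ := by
        rw [integral_add (h.int (hb.pow 3)) (h.int (hb.cmul _)), integral_const_mul]
    _ ≤ _ := by
        have := h.ES_jensen i
        have := mul_le_mul_of_nonneg_right hc hS0
        linarith

end BF
end
end BE

namespace BE
lemma exp_u1 {u : ℝ} (hu : |u| ≤ 1) : |1 - Real.exp (-u) - u| ≤ u ^ 2 := by
  have := Real.abs_exp_sub_one_sub_id_le (x := -u) (by simpa using hu)
  rw [abs_le] at this ⊢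
  constructor <;> nlinarith [this.1, this.2]

lemma exp_u2 {u : ℝ} (hu : |u| ≤ 1) : |1 - Real.exp (-u)| ≤ 2 * |u| := by
  have := Real.abs_exp_sub_one_le (x := -u) (by simpa using hu)
  rw [abs_sub_comm]; simpa using this

section
variable {Ω ι : Type*} [mΩ : MeasurableSpace Ω] {μ : Measure Ω} [IsProbabilityMeasure μ] [Fintype ι]
  {F : Set ι → MeasurableSpace Ω} {D : ι → ι → ℕ} {X : ι → Ω → ℝ} {β : ℝ}
namespace BF

lemma nb_mono (D : ι → ι → ℕ) {r s : ℕ} (hrs : r ≤ s) (i : ι) : NB D r i ⊆ NB D s i :=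
  fun j hj => le_trans (show D i j ≤ r from hj) hrs

lemma self_mem (h : BF μ F D X β) (r : ℕ) (i : ι) : i ∈ NB D r i := by
  simp [NB, h.self]

lemma bmNB (h : BF μ F D X β) {r s : ℕ} (hrs : r ≤ s) (i : ι) {U : Ω → ℝ} (hU : BM (F (NB D r i)) U) :
    BM (F (NB D s i)) U := hU.mono (h.mono _ _ (nb_mono D hrs i))

lemma sepIF (h : BF μ F D X β) (i : ι) : ∀ a ∈ ({i} : Set ι), ∀ b ∈ FB D 1 i, 1 < D a b := by
  intro a ha b hb
  simp only [Set.mem_singleton_iff] at ha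
  subst ha; exact hb

lemma bmXi (h : BF μ F D X β) (i : ι) : BM (F {i}) (X i) := h.bm (by simp)

/-- `E X_i g(W - Y_i) = 0` -/
lemma X_indep (h : BF μ F D X β) (i : ι) {V : Ω → ℝ} (hV : BM (F (FB D 1 i)) V) :
    ∫ ω, X i ω * V ω ∂μ = 0 := by
  rw [h.imul (h.sepIF i) (h.bmXi i) hV, h.mean i, zero_mul]

lemma sum_XY (h : BF μ F D X β) : ∑ i, ∫ ω, X i ω * Vs X D 1 i ω ∂μ = ∫ ω, WW X ω ^ 2 ∂μ := by
  have e : ∀ i, ∫ ω, X i ω * Vs X D 1 i ω ∂μ = ∫ ω, X i ω * WW X ω ∂μ := by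
    intro i
    have h1 := h.X_indep i (h.bmWf 1 i)
    have h2 : ∫ ω, X i ω * WW X ω ∂μ = ∫ ω, (X i ω * Vs X D 1 i ω + X i ω * Wf X D 1 i ω) ∂μ := by
      congr 1; ext ω; rw [W_split X D 1 i ω]; ring
    rw [h2, integral_add, h1, add_zero]
    · exact h.int ((h.bm (Set.mem_univ i)).mul (h.toTop (h.bmVs 1 i)))
    · exact h.int ((h.bm (Set.mem_univ i)).mul (h.toTop (h.bmWf 1 i)))
  simp_rw [e]
  rw [← integral_finsetSum _ (fun i _ => h.int ((h.bm (Set.mem_univ i)).mul h.bmW))]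
  congr 1; ext ω
  rw [← Finset.sum_mul, sq]; rfl

lemma bmEW (h : BF μ F D X β) (l : ℝ) : BM (F Set.univ) (fun ω => Real.exp (l * WW X ω)) :=
  (h.bmW.cmul l).exp

lemma local_exp (h : BF μ F D X β) (i : ι) {l : ℝ} (hl : |l| ≤ 1) {ξ : Ω → ℝ} (hξ : BM (F (NB D 2 i)) ξ)
    (h0 : ∀ ω, 0 ≤ ξ ω) :
    ∫ ω, ξ ω * Real.exp (l * WW X ω) ∂μ ≤
      Real.exp 2 * (∫ ω, ξ ω ∂μ) * ∫ ω, Real.exp (l * WW X ω) ∂μ := by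
  have hw : BM (F (FB D 3 i)) (fun ω => Real.exp (l * Wf X D 3 i ω)) := ((h.bmWf 3 i).cmul l).exp
  have hv : ∀ ω, |l * Vs X D 3 i ω| ≤ 1 := fun ω => by
    rw [abs_mul]; exact mul_le_one₀ hl (abs_nonneg _) (h.Vs_le 3 (by norm_num) i ω)
  have hξE : 0 ≤ ∫ ω, ξ ω ∂μ := integral_nonneg h0
  calc ∫ ω, ξ ω * Real.exp (l * WW X ω) ∂μ ≤ ∫ ω, Real.exp 1 * (ξ ω * Real.exp (l * Wf X D 3 i ω)) ∂μ := by
        refine integral_mono (h.int ((h.toTop hξ).mul (h.bmEW l)))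
          (h.int (((h.toTop hξ).mul (h.toTop hw)).cmul _)) fun ω => ?_
        have : Real.exp (l * WW X ω) ≤ Real.exp 1 * Real.exp (l * Wf X D 3 i ω) := by
          rw [← Real.exp_add, W_split X D 3 i ω]
          apply Real.exp_le_exp.2
          linarith [(abs_le.1 (hv ω)).2]
        have := mul_le_mul_of_nonneg_left this (h0 ω)
        simp only; linarith
    _ = Real.exp 1 * ((∫ ω, ξ ω ∂μ) * ∫ ω, Real.exp (l * Wf X D 3 i ω) ∂μ) := by
        rw [integral_const_mul, h.imul (h.sepNF 2 i) hξ hw]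
    _ ≤ Real.exp 1 * ((∫ ω, ξ ω ∂μ) * (Real.exp 1 * ∫ ω, Real.exp (l * WW X ω) ∂μ)) := by
        rw [← integral_const_mul (Real.exp 1)]
        refine mul_le_mul_of_nonneg_left (mul_le_mul_of_nonneg_left ?_ hξE) (Real.exp_pos _).le
        refine integral_mono (h.int hw) (h.int ((h.bmEW l).cmul _)) fun ω => ?_
        simp only
        rw [← Real.exp_add, W_split X D 3 i ω]
        apply Real.exp_le_exp.2
        linarith [(abs_le.1 (hv ω)).1]
    _ = _ := by
        rw [show (2:ℝ) = 1 + 1 by norm_num, Real.exp_add]; ring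

lemma term_exp (h : BF μ F D X β) (i : ι) {l : ℝ} (hl0 : 0 ≤ l) (hl : l ≤ 1) :
    ∫ ω, X i ω * Real.exp (l * WW X ω) ∂μ ≤
      (l * (∫ ω, X i ω * Vs X D 1 i ω ∂μ) + 5 * Real.exp 2 * ∫ ω, Sb X D i ω ^ 3 ∂μ)
        * ∫ ω, Real.exp (l * WW X ω) ∂μ := by
  have hla : |l| ≤ 1 := by rw [abs_of_nonneg hl0]; exact hl
  set M := ∫ ω, Real.exp (l * WW X ω) ∂μ with hM
  have hM0 : 0 ≤ M := integral_nonneg fun ω => (Real.exp_pos _).le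
  have bX : BM (F Set.univ) (X i) := h.bm (Set.mem_univ i)
  have bY := h.toTop (h.bmVs 1 i)
  have bV := h.toTop (h.bmVs 2 i)
  have bE := h.bmEW l
  have bS := h.bmSb i
  set Y := Vs X D 1 i with hY
  set V := Vs X D 2 i with hV
  set c := ∫ ω, X i ω * Y ω ∂μ with hc
  have bX1 : BM (F (NB D 1 i)) (X i) := h.bm (h.self_mem 1 i)
  have bXY : BM (F (NB D 1 i)) (fun ω => X i ω * Y ω) := bX1.mul (h.bmVs 1 i)
  have hYS : ∀ ω, |Y ω| ≤ Sb X D i ω := Vs_le_Sb X D 1 (by norm_num) i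
  have hVS : ∀ ω, |V ω| ≤ Sb X D i ω := Vs_le_Sb X D 2 (by norm_num) i
  have hXS : ∀ ω, |X i ω| ≤ Sb X D i ω := h.X_le_Sb i i (by simp [h.self])
  have hu : ∀ {y s : ℝ}, |y| ≤ s → s ≤ 1 → |l * y| ≤ 1 := fun {y s} h1 h2 => by
    rw [abs_mul]; exact mul_le_one₀ hla (abs_nonneg _) (h1.trans h2)
  have hb1 : ∀ ω, |l * Y ω| ≤ 1 := fun ω => hu (hYS ω) (h.bdd i ω)
  have hb2 : ∀ ω, |l * V ω| ≤ 1 := fun ω => hu (hVS ω) (h.bdd i ω)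
  -- first step
  have hz1 : ∫ ω, X i ω * Real.exp (l * Wf X D 1 i ω) ∂μ = 0 := h.X_indep i ((h.bmWf 1 i).cmul l).exp
  have s1 : ∫ ω, X i ω * Real.exp (l * WW X ω) ∂μ ≤
      ∫ ω, (l * (X i ω * Y ω * Real.exp (l * WW X ω)) + |X i ω| * Y ω ^ 2 * Real.exp (l * WW X ω)
        + X i ω * Real.exp (l * Wf X D 1 i ω)) ∂μ := by
    refine integral_mono (h.int (bX.mul bE)) (h.int (((((bX.mul bY).mul bE).cmul l).add
      ((bX.abs.mul (bY.pow 2)).mul bE)).add (bX.mul (h.toTop ((h.bmWf 1 i).cmul l).exp)))) fun ω => ?_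
    simp only
    have e1 : Real.exp (l * Wf X D 1 i ω) = Real.exp (l * WW X ω) * Real.exp (- (l * Y ω)) := by
      rw [← Real.exp_add]; congr 1; rw [W_split X D 1 i ω]; ring
    rw [e1]
    have h1 := exp_u1 (hb1 ω)
    have h2 : X i ω * (1 - Real.exp (-(l * Y ω)) - l * Y ω) ≤ |X i ω| * Y ω ^ 2 := by
      refine (le_abs_self _).trans ?_
      rw [abs_mul]
      refine mul_le_mul_of_nonneg_left (h1.trans ?_) (abs_nonneg _)
      rw [mul_pow]
      exact mul_le_of_le_one_left (sq_nonneg _) (pow_le_one₀ hl0 hl)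
    have h3 := mul_le_mul_of_nonneg_right h2 (Real.exp_pos (l * WW X ω)).le
    linarith
  have bA := ((bX.mul bY).mul bE)
  have bB := ((bX.abs.mul (bY.pow 2)).mul bE)
  have bC := (bX.mul (h.toTop ((h.bmWf 1 i).cmul l).exp))
  rw [integral_add (h.int ((bA.cmul l).add bB)) (h.int bC), integral_add (h.int (bA.cmul l)) (h.int bB),
    integral_const_mul, hz1, add_zero] at s1
  -- second
  have s2 : ∫ ω, |X i ω| * Y ω ^ 2 * Real.exp (l * WW X ω) ∂μ ≤
      Real.exp 2 * (∫ ω, Sb X D i ω ^ 3 ∂μ) * M := by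
    refine (h.local_exp i hla (h.bmNB (by norm_num) i (bX1.abs.mul ((h.bmVs 1 i).pow 2)))
      fun ω => by positivity).trans ?_
    refine mul_le_mul_of_nonneg_right (mul_le_mul_of_nonneg_left ?_ (Real.exp_pos _).le) hM0
    refine integral_mono (h.int (bX.abs.mul (bY.pow 2))) (h.int (bS.pow 3)) fun ω => ?_
    simp only
    calc |X i ω| * Y ω ^ 2 = |X i ω| * |Y ω| ^ 2 := by rw [sq_abs]
      _ ≤ Sb X D i ω * Sb X D i ω ^ 2 := mul_le_mul (hXS ω) (pow_le_pow_left₀ (abs_nonneg _) (hYS ω) 2) (by positivity) (Sb_nonneg X D i ω)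
      _ = _ := by ring
  -- third
  have bz : BM (F (NB D 1 i)) (fun ω => X i ω * Y ω - c) := bXY.sub (BM.const c)
  have hz2 : ∫ ω, (X i ω * Y ω - c) * Real.exp (l * Wf X D 2 i ω) ∂μ = 0 := by
    rw [h.imul (h.sepNF 1 i) bz ((h.bmWf 2 i).cmul l).exp, integral_sub (h.int bXY) (h.int (BM.const (m := F Set.univ) c))]
    simp [hc]
  have s3 : ∫ ω, X i ω * Y ω * Real.exp (l * WW X ω) ∂μ ≤
      ∫ ω, (c * Real.exp (l * WW X ω) + 2 * (|X i ω * Y ω - c| * |V ω| * Real.exp (l * WW X ω))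
        + (X i ω * Y ω - c) * Real.exp (l * Wf X D 2 i ω)) ∂μ := by
    refine integral_mono (h.int bA) (h.int (((bE.cmul c).add
      ((((h.toTop bz).abs.mul bV.abs).mul bE).cmul 2)).add ((h.toTop bz).mul (h.toTop ((h.bmWf 2 i).cmul l).exp)))) fun ω => ?_
    simp only
    have e1 : Real.exp (l * Wf X D 2 i ω) = Real.exp (l * WW X ω) * Real.exp (- (l * V ω)) := by
      rw [← Real.exp_add]; congr 1; rw [W_split X D 2 i ω]; ring
    rw [e1]
    have h1 := exp_u2 (hb2 ω)
    have h2 : (X i ω * Y ω - c) * (1 - Real.exp (-(l * V ω))) ≤ 2 * (|X i ω * Y ω - c| * |V ω|) := by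
      refine (le_abs_self _).trans ?_
      rw [abs_mul]
      have : 2 * |l * V ω| ≤ 2 * |V ω| := by
        rw [abs_mul]
        have := mul_le_of_le_one_left (abs_nonneg (V ω)) hla
        linarith
      have := mul_le_mul_of_nonneg_left (h1.trans this) (abs_nonneg (X i ω * Y ω - c))
      linarith
    have h3 := mul_le_mul_of_nonneg_right h2 (Real.exp_pos (l * WW X ω)).le
    linarith
  have bD := ((h.toTop bz).abs.mul bV.abs).mul bE
  rw [integral_add (h.int ((bE.cmul c).add (bD.cmul 2))) (h.int ((h.toTop bz).mul (h.toTop ((h.bmWf 2 i).cmul l).exp))),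
    integral_add (h.int (bE.cmul c)) (h.int (bD.cmul 2)), integral_const_mul, integral_const_mul, hz2, add_zero] at s3
  have s4 : ∫ ω, |X i ω * Y ω - c| * |V ω| * Real.exp (l * WW X ω) ∂μ ≤
      Real.exp 2 * (2 * ∫ ω, Sb X D i ω ^ 3 ∂μ) * M := by
    refine (h.local_exp i hla ((h.bmNB (by norm_num) i bz).abs.mul (h.bmVs 2 i).abs)
      fun ω => by positivity).trans ?_
    refine mul_le_mul_of_nonneg_right (mul_le_mul_of_nonneg_left ?_ (Real.exp_pos _).le) hM0
    refine h.zeta_dom i (bX.mul bY) bV (fun ω => ?_) hVS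
    rw [abs_mul, sq]
    exact mul_le_mul (hXS ω) (hYS ω) (abs_nonneg _) (Sb_nonneg X D i ω)
  have hS3 := h.ES3_nonneg i
  set T := ∫ ω, Sb X D i ω ^ 3 ∂μ
  have s5 : l * ∫ ω, X i ω * Y ω * Real.exp (l * WW X ω) ∂μ ≤ l * (c * M) + 4 * Real.exp 2 * T * M := by
    calc _ ≤ l * (c * M + 2 * (Real.exp 2 * (2 * T) * M)) := mul_le_mul_of_nonneg_left (by linarith) hl0
      _ = l * (c * M) + l * (4 * Real.exp 2 * T * M) := by ring
      _ ≤ _ := by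
        have := mul_le_of_le_one_left (a := l) (b := 4 * Real.exp 2 * T * M) (by positivity) hl
        linarith
  calc _ ≤ _ := s1
    _ ≤ l * (c * M) + 4 * Real.exp 2 * T * M + Real.exp 2 * T * M := by linarith
    _ = _ := by ring

lemma mgf_deriv (h : BF μ F D X β) (l : ℝ) :
    HasDerivAt (fun l => ∫ ω, Real.exp (l * WW X ω) ∂μ) (∫ ω, WW X ω * Real.exp (l * WW X ω) ∂μ) l := by
  have hs : integrableExpSet (WW X) μ = Set.univ := by
    ext t; simp only [Set.mem_univ, iff_true]
    exact h.int (h.bmEW t)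
  exact hasDerivAt_mgf (X := WW X) (μ := μ) (t := l) (by rw [hs]; simp)

lemma exp_moment1 (h : BF μ F D X β) : ∫ ω, Real.exp (WW X ω) ∂μ ≤ Real.exp (2 + 5 * Real.exp 2) := by
  set A := 2 + 5 * Real.exp 2 with hA
  set f := fun l : ℝ => ∫ ω, Real.exp (l * WW X ω) ∂μ with hf
  have hf0 : ∀ l, 0 ≤ f l := fun l => integral_nonneg fun ω => (Real.exp_pos _).le
  have hd : ∀ l, HasDerivAt (fun l => f l * Real.exp (- A * l))
      ((∫ ω, WW X ω * Real.exp (l * WW X ω) ∂μ) * Real.exp (-A * l) + f l * (Real.exp (-A * l) * (-A * 1))) l := fun l =>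
    (h.mgf_deriv l).mul (((hasDerivAt_id l).const_mul (-A)).exp)
  have hanti : AntitoneOn (fun l => f l * Real.exp (- A * l)) (Set.Icc 0 1) := by
    refine antitoneOn_of_deriv_nonpos (convex_Icc 0 1) (fun l _ => (hd l).continuousAt.continuousWithinAt)
      (fun l _ => (hd l).differentiableAt.differentiableWithinAt) fun l hl => ?_
    rw [interior_Icc] at hl
    rw [(hd l).deriv]
    have key : ∫ ω, WW X ω * Real.exp (l * WW X ω) ∂μ ≤ A * f l := by
      have e : ∫ ω, WW X ω * Real.exp (l * WW X ω) ∂μ = ∑ i, ∫ ω, X i ω * Real.exp (l * WW X ω) ∂μ := by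
        rw [← integral_finsetSum _ (fun i _ => h.int ((h.bm (Set.mem_univ i)).mul (h.bmEW l)))]
        congr 1; ext ω; rw [← Finset.sum_mul]; rfl
      rw [e]
      refine (Finset.sum_le_sum fun i _ => h.term_exp i hl.1.le hl.2.le).trans ?_
      rw [← Finset.sum_mul, Finset.sum_add_distrib, ← Finset.mul_sum, ← Finset.mul_sum, h.sum_XY]
      refine mul_le_mul_of_nonneg_right ?_ (hf0 l)
      have h1 : l * ∫ ω, WW X ω ^ 2 ∂μ ≤ 1 * 2 :=
        mul_le_mul hl.2.le h.var (integral_nonneg fun ω => sq_nonneg _) (by norm_num)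
      have h2 : 5 * Real.exp 2 * ∑ i, ∫ ω, Sb X D i ω ^ 3 ∂μ ≤ 5 * Real.exp 2 * 1 :=
        mul_le_mul_of_nonneg_left (h.third.trans h.small) (by positivity)
      linarith
    have hp := Real.exp_pos (-A * l)
    nlinarith [mul_le_mul_of_nonneg_right key hp.le]
  have := hanti (by simp : (0:ℝ) ∈ Set.Icc (0:ℝ) 1) (by simp : (1:ℝ) ∈ Set.Icc (0:ℝ) 1) (by norm_num)
  simp only [hf, one_mul, zero_mul, Real.exp_zero, mul_zero, mul_one, integral_const, probReal_univ, smul_eq_mul] at this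
  rw [Real.exp_neg, ← div_eq_mul_inv, div_le_one (Real.exp_pos _)] at this
  exact this

/-- absolute constant -/
noncomputable def CE : ℝ := 2 * Real.exp 2 * Real.exp (2 + 5 * Real.exp 2)

lemma CE_ge : 2 ≤ CE := by
  unfold CE
  have h1 : 1 ≤ Real.exp 2 := Real.one_le_exp (by norm_num)
  have h2 : 1 ≤ Real.exp (2 + 5 * Real.exp 2) := Real.one_le_exp (by positivity)
  nlinarith

lemma bmEA (h : BF μ F D X β) : BM (F Set.univ) (fun ω => Real.exp |WW X ω|) := h.bmW.abs.exp

/-- local exponential moment -/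
lemma locE (h : BF μ F D X β) (i : ι) {ξ : Ω → ℝ} (hξ : BM (F (NB D 2 i)) ξ)
    (h0 : ∀ ω, 0 ≤ ξ ω) :
    ∫ ω, ξ ω * Real.exp |WW X ω| ∂μ ≤ CE * ∫ ω, ξ ω ∂μ := by
  have h1 := h.local_exp i (l := 1) (by simp) hξ h0
  have h2 := h.local_exp i (l := -1) (by simp) hξ h0
  have m1 := h.exp_moment1
  have m2 := h.neg.exp_moment1
  have e2 : ∀ ω, WW (fun i ω => - X i ω) ω = - WW X ω := fun ω => by simp [WW]
  simp only [e2] at m2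
  simp only [one_mul, neg_mul] at h1 h2
  have b1 : BM (F Set.univ) (fun ω => Real.exp (WW X ω)) := h.bmW.exp
  have b2 : BM (F Set.univ) (fun ω => Real.exp (- WW X ω)) := h.bmW.neg.exp
  have hξE : 0 ≤ ∫ ω, ξ ω ∂μ := integral_nonneg h0
  have h3 : ∫ ω, ξ ω * Real.exp |WW X ω| ∂μ ≤ ∫ ω, (ξ ω * Real.exp (WW X ω) + ξ ω * Real.exp (-WW X ω)) ∂μ := by
    refine integral_mono (h.int ((h.toTop hξ).mul h.bmEA))
      (h.int (((h.toTop hξ).mul b1).add ((h.toTop hξ).mul b2))) fun ω => ?_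
    simp only
    rw [← mul_add]
    refine mul_le_mul_of_nonneg_left ?_ (h0 ω)
    rcases abs_cases (WW X ω) with hh | hh <;> rw [hh.1]
    · linarith [Real.exp_pos (-WW X ω)]
    · linarith [Real.exp_pos (WW X ω)]
  rw [integral_add (h.int ((h.toTop hξ).mul b1)) (h.int ((h.toTop hξ).mul b2))] at h3
  have g1 := mul_le_mul_of_nonneg_left m1 (mul_nonneg (Real.exp_pos 2).le hξE)
  have g2 := mul_le_mul_of_nonneg_left m2 (mul_nonneg (Real.exp_pos 2).le hξE)
  unfold CE
  linarith

/-- domination version -/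
lemma locE' (h : BF μ F D X β) (i : ι) {ξ g : Ω → ℝ} (hξ : BM (F (NB D 2 i)) ξ)
    (h0 : ∀ ω, 0 ≤ ξ ω) (hg : BM (F Set.univ) g) (c : ℝ) (hc : ∀ ω, g ω ≤ c * Real.exp |WW X ω|) (hc0 : 0 ≤ c) :
    ∫ ω, ξ ω * g ω ∂μ ≤ c * CE * ∫ ω, ξ ω ∂μ := by
  have h1 : ∫ ω, ξ ω * g ω ∂μ ≤ ∫ ω, c * (ξ ω * Real.exp |WW X ω|) ∂μ := by
    refine integral_mono (h.int ((h.toTop hξ).mul hg)) (h.int (((h.toTop hξ).mul h.bmEA).cmul c)) fun ω => ?_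
    have := mul_le_mul_of_nonneg_left (hc ω) (h0 ω)
    simp only; linarith
  rw [integral_const_mul] at h1
  have := mul_le_mul_of_nonneg_left (h.locE i hξ h0) hc0
  linarith

end BF
end
end BE

namespace BE

lemma iter_lem {P : ℝ → Prop} {H0 c : ℝ} (hc : 0 ≤ c) (hH : 0 ≤ H0) (h0 : P H0)
    (step : ∀ H, 0 ≤ H → P H → P (c + H / 2))
    (hcl : ∀ H, (∀ ε, 0 < ε → ∃ δ, δ ≤ ε ∧ P (H + δ)) → P H) : P (2 * c) := by
  have h1 : ∀ n : ℕ, ∃ δ, δ ≤ H0 / 2 ^ n ∧ - (2 * c) ≤ δ ∧ P (2 * c + δ) := by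
    intro n
    induction n with
    | zero => exact ⟨H0 - 2 * c, by simp; linarith, by linarith, by simpa using h0⟩
    | succ n ih =>
      obtain ⟨δ, h1, h2, h3⟩ := ih
      refine ⟨δ / 2, ?_, by linarith, ?_⟩
      · rw [pow_succ, ← div_div]; linarith
      · have := step _ (by linarith) h3
        convert this using 1; ring
  refine hcl _ fun ε hε => ?_
  obtain ⟨n, hn⟩ := exists_pow_lt_of_lt_one (show 0 < ε / (H0 + 1) by positivity) (show (1/2:ℝ) < 1 by norm_num)
  obtain ⟨δ, h1, -, h3⟩ := h1 n
  refine ⟨δ, h1.trans ?_, h3⟩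
  rw [lt_div_iff₀ (by positivity)] at hn
  have : H0 / 2 ^ n = (1/2)^n * H0 := by rw [div_pow, one_pow]; ring
  rw [this]
  have : 0 < (1/2:ℝ)^n := by positivity
  nlinarith

/-- trapezoid -/
noncomputable def tz (α u : ℝ) : ℝ := max 0 (min 1 (min ((u + α) / α) ((2 * α - u) / α)))

lemma tz_cont (α : ℝ) : Continuous (tz α) := by unfold tz; fun_prop
lemma tz_nonneg (α u : ℝ) : 0 ≤ tz α u := le_max_left _ _
lemma tz_le (α u : ℝ) : tz α u ≤ 1 := by
  unfold tz; exact max_le zero_le_one (min_le_left _ _)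
lemma tz_zero_left {α u : ℝ} (hα : 0 < α) (hu : u ≤ -α) : tz α u = 0 := by
  unfold tz; apply max_eq_left
  refine (min_le_right _ _).trans ((min_le_left _ _).trans ?_)
  exact div_nonpos_of_nonpos_of_nonneg (by linarith) hα.le
lemma tz_zero_right {α u : ℝ} (hα : 0 < α) (hu : 2 * α ≤ u) : tz α u = 0 := by
  unfold tz; apply max_eq_left
  refine (min_le_right _ _).trans ((min_le_right _ _).trans ?_)
  exact div_nonpos_of_nonpos_of_nonneg (by linarith) hα.le
lemma tz_one {α u : ℝ} (hα : 0 < α) (h0 : 0 ≤ u) (h1 : u ≤ α) : 1 ≤ tz α u := by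
  unfold tz; apply le_max_of_le_right
  refine le_min le_rfl (le_min ?_ ?_) <;> rw [le_div_iff₀ hα] <;> linarith
lemma tz_lip {α : ℝ} (hα : 0 < α) (u t : ℝ) : |tz α u - tz α (u - t)| ≤ |t| / α := by
  unfold tz
  refine (abs_max_sub_max_le_max _ _ _ _).trans (max_le (by simp; positivity) ?_)
  refine (abs_min_sub_min_le_max _ _ _ _).trans (max_le (by simp; positivity) ?_)
  refine (abs_min_sub_min_le_max _ _ _ _).trans (max_le ?_ ?_)
  · rw [← sub_div, abs_div, abs_of_pos hα]; ring_nf; rfl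
  · rw [← sub_div, abs_div, abs_of_pos hα]; ring_nf; rw [abs_neg, mul_comm]
lemma tz_jump {α : ℝ} (hα : 0 < α) (u t : ℝ) :
    |tz α u - tz α (u - t)| ≤ min 1 (|t| / α) * (if -α - |t| ≤ u ∧ u ≤ 2 * α + |t| then 1 else 0) := by
  split_ifs with h
  · rw [mul_one]
    refine le_min ?_ (tz_lip hα u t)
    rw [abs_le]; constructor <;> linarith [tz_nonneg α u, tz_le α u, tz_nonneg α (u-t), tz_le α (u-t)]
  · have ht := neg_abs_le t
    have ht' := le_abs_self t
    rw [not_and_or, not_le, not_le] at h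
    rcases h with h | h
    · rw [tz_zero_left hα (by linarith [abs_nonneg t]), tz_zero_left hα (by linarith)]; simp
    · rw [tz_zero_right hα (by linarith [abs_nonneg t]), tz_zero_right hα (by linarith)]; simp

noncomputable def Fp (α u : ℝ) : ℝ := ∫ s in (-α)..u, tz α s

lemma Fp_sub (α u v : ℝ) : Fp α u - Fp α v = ∫ s in v..u, tz α s := by
  unfold Fp
  exact intervalIntegral.integral_interval_sub_left ((tz_cont α).intervalIntegrable _ _) ((tz_cont α).intervalIntegrable _ _)
lemma Fp_mono (α : ℝ) : Monotone (Fp α) := by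
  intro v u h
  have := Fp_sub α u v
  have h2 : 0 ≤ ∫ s in v..u, tz α s := intervalIntegral.integral_nonneg h fun s _ => tz_nonneg α s
  linarith
lemma Fp_zero {α u : ℝ} (hα : 0 < α) (hu : u ≤ -α) : Fp α u = 0 := by
  unfold Fp
  rw [intervalIntegral.integral_congr (g := fun _ => 0)]
  · simp
  · intro s hs
    rw [Set.uIcc_of_ge hu] at hs
    exact tz_zero_left hα hs.2
lemma Fp_nonneg {α : ℝ} (hα : 0 < α) (u : ℝ) : 0 ≤ Fp α u := by
  rcases le_total u (-α) with h | h
  · rw [Fp_zero hα h]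
  · rw [← Fp_zero hα le_rfl]; exact Fp_mono α h
lemma Fp_le {α : ℝ} (hα : 0 < α) (u : ℝ) : Fp α u ≤ 3 * α := by
  have h1 : Fp α (2 * α) ≤ 3 * α := by
    unfold Fp
    have : ∫ s in (-α)..(2*α), tz α s ≤ ∫ s in (-α)..(2*α), (1:ℝ) :=
      intervalIntegral.integral_mono_on (by linarith) ((tz_cont α).intervalIntegrable _ _)
        (continuous_const.intervalIntegrable _ _) fun s _ => tz_le α s
    rw [intervalIntegral.integral_const] at this
    simp at this; linarith
  rcases le_total u (2 * α) with h | h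
  · exact (Fp_mono α h).trans h1
  · have := Fp_sub α u (2 * α)
    rw [intervalIntegral.integral_congr (g := fun _ => 0)] at this
    · simp at this; linarith
    · intro s hs
      rw [Set.uIcc_of_le h] at hs
      exact tz_zero_right hα hs.1
lemma Fp_cont (α : ℝ) : Continuous (Fp α) :=
  intervalIntegral.continuous_primitive (fun a b => (tz_cont α).intervalIntegrable a b) _

/-- kernel -/
noncomputable def kk (y t : ℝ) : ℝ := if 0 < t ∧ t ≤ y then 1 else if y < t ∧ t ≤ 0 then -1 else 0

/-- the reference measure on (-1,1] -/
noncomputable def nu : Measure ℝ := volume.restrict (Set.Ioc (-1) 1)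

instance : IsFiniteMeasure nu := by unfold nu; infer_instance

lemma kk_meas : Measurable (fun p : ℝ × ℝ => kk p.1 p.2) := by
  unfold kk
  refine Measurable.ite ?_ measurable_const (Measurable.ite ?_ measurable_const measurable_const)
  · exact (measurableSet_lt measurable_const measurable_snd).inter (measurableSet_le measurable_snd measurable_fst)
  · exact (measurableSet_lt measurable_fst measurable_snd).inter (measurableSet_le measurable_snd measurable_const)

lemma kk_abs_le (y t : ℝ) : |kk y t| ≤ 1 := by unfold kk; split_ifs <;> simp

lemma kk_int {g : ℝ → ℝ} (hg : Continuous g) {y : ℝ} (hy : |y| ≤ 1) :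
    ∫ t, g t * kk y t ∂nu = ∫ t in (0:ℝ)..y, g t := by
  have hy' := abs_le.1 hy
  unfold nu
  rcases le_total 0 y with h | h
  · rw [intervalIntegral.integral_of_le h]
    have : (fun t => g t * kk y t) = Set.indicator (Set.Ioc 0 y) g := by
      ext t; unfold kk Set.indicator
      by_cases h1 : t ∈ Set.Ioc 0 y
      · simp [h1, h1.1, h1.2]
      · have h2 : ¬ (0 < t ∧ t ≤ y) := h1
        have h3 : ¬ (y < t ∧ t ≤ 0) := by rintro ⟨a, b⟩; linarith
        rw [if_neg h2, if_neg h3, if_neg h1, mul_zero]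
    rw [this, integral_indicator measurableSet_Ioc, Measure.restrict_restrict measurableSet_Ioc,
      Set.inter_eq_left.2 (Set.Ioc_subset_Ioc (by norm_num) hy'.2)]
  · rw [intervalIntegral.integral_of_ge h, ← integral_neg]
    have : (fun t => g t * kk y t) = Set.indicator (Set.Ioc y 0) (fun t => - g t) := by
      ext t; unfold kk Set.indicator
      have h3 : ¬ (0 < t ∧ t ≤ y) := by rintro ⟨a, b⟩; linarith
      rw [if_neg h3]
      by_cases h1 : t ∈ Set.Ioc y 0
      · have h2 : (y < t ∧ t ≤ 0) := h1
        rw [if_pos h2, if_pos h1]; ring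
      · have h2 : ¬ (y < t ∧ t ≤ 0) := h1
        rw [if_neg h2, if_neg h1, mul_zero]
    rw [this, integral_indicator measurableSet_Ioc, Measure.restrict_restrict measurableSet_Ioc,
      Set.inter_eq_left.2 (Set.Ioc_subset_Ioc hy'.1 (by norm_num))]

lemma kk_abs_eq (y t : ℝ) : |kk y t| = if 0 ≤ y then kk y t else - kk y t := by
  unfold kk
  by_cases h1 : 0 < t ∧ t ≤ y
  · rw [if_pos h1, if_pos (by linarith [h1.1, h1.2])]; simp
  · rw [if_neg h1]
    by_cases h2 : y < t ∧ t ≤ 0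
    · rw [if_pos h2, if_neg (by push Not; linarith [h2.1, h2.2])]; simp
    · rw [if_neg h2]; simp

lemma kk_abs_int {y : ℝ} (hy : |y| ≤ 1) : ∫ t, |kk y t| ∂nu = |y| := by
  have := kk_int (g := fun _ => 1) continuous_const hy
  simp only [one_mul, intervalIntegral.integral_const, smul_eq_mul, mul_one, sub_zero] at this
  simp_rw [kk_abs_eq]
  split_ifs with h
  · rw [this, abs_of_nonneg h]
  · rw [integral_neg, this, abs_of_neg (by linarith)]

lemma kk_t_le (y t : ℝ) : |t| * |kk y t| ≤ |y| * |kk y t| := by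
  unfold kk
  split_ifs with h1 h2
  · simp; rw [abs_of_pos h1.1, abs_of_nonneg (by linarith [h1.1, h1.2])]; exact h1.2
  · simp; rw [abs_of_nonpos h2.2, abs_of_neg (by linarith [h2.1, h2.2])]; linarith [h2.1]
  · simp

lemma kk_tz {α y u : ℝ} (hy : |y| ≤ 1) :
    ∫ t, tz α (u - t) * kk y t ∂nu = Fp α u - Fp α (u - y) := by
  rw [kk_int (g := fun t => tz α (u - t)) ((tz_cont α).comp (by fun_prop)) hy, Fp_sub]
  rw [intervalIntegral.integral_comp_sub_left (fun s => tz α s) u]; simp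

lemma tz_nu_le {α u : ℝ} (hα : 0 < α) : ∫ t, tz α (u - t) ∂nu ≤ 3 * α := by
  unfold nu
  rw [← intervalIntegral.integral_of_le (by norm_num), intervalIntegral.integral_comp_sub_left (fun s => tz α s) u,
    ← Fp_sub]
  linarith [Fp_le hα (u - -1), Fp_nonneg hα (u-1)]

section
variable {Ω : Type*} [mΩ : MeasurableSpace Ω] {μ : Measure Ω} [IsProbabilityMeasure μ]

lemma BM.fst {U : Ω → ℝ} {m : MeasurableSpace Ω} (hm : m ≤ mΩ) (hU : BM m U) :
    BM (mΩ.prod Real.measurableSpace) (fun p => U p.1) :=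
  ⟨(hU.1.mono hm le_rfl).comp measurable_fst, hU.2.choose, fun p => hU.2.choose_spec p.1⟩

lemma BM.kkL {Y : Ω → ℝ} {m : MeasurableSpace Ω} (hm : m ≤ mΩ) (hY : BM m Y) :
    BM (mΩ.prod Real.measurableSpace) (fun p => kk (Y p.1) p.2) :=
  ⟨kk_meas.comp (((hY.1.mono hm le_rfl).comp measurable_fst).prodMk measurable_snd), 1, fun p => kk_abs_le _ _⟩

lemma BM.kkS {Y : Ω → ℝ} {m : MeasurableSpace Ω} (hY : BM m Y) (t : ℝ) :
    BM m (fun ω => kk (Y ω) t) :=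
  ⟨kk_meas.comp (hY.1.prodMk measurable_const), 1, fun p => kk_abs_le _ _⟩

lemma BM.tzL (α : ℝ) {U : Ω → ℝ} {m : MeasurableSpace Ω} (hm : m ≤ mΩ) (hU : BM m U) :
    BM (mΩ.prod Real.measurableSpace) (fun p => tz α (U p.1 - p.2)) :=
  ⟨(tz_cont α).measurable.comp (((hU.1.mono hm le_rfl).comp measurable_fst).sub measurable_snd), 1, fun p => by
    rw [abs_of_nonneg (tz_nonneg _ _)]; exact tz_le _ _⟩

lemma BM.secω {G : Ω × ℝ → ℝ} (hG : BM (mΩ.prod Real.measurableSpace) G) (t : ℝ) :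
    BM mΩ (fun ω => G (ω, t)) :=
  ⟨hG.1.comp measurable_prodMk_right, hG.2.choose, fun p => hG.2.choose_spec _⟩

lemma BM.sect {G : Ω × ℝ → ℝ} (hG : BM (mΩ.prod Real.measurableSpace) G) (ω : Ω) :
    Integrable (fun t => G (ω, t)) nu := by
  have : BM (inferInstance : MeasurableSpace ℝ) (fun t => G (ω, t)) :=
    ⟨hG.1.comp measurable_prodMk_left, hG.2.choose, fun p => hG.2.choose_spec _⟩
  exact this.integrable le_rfl

lemma fub1 (μ : Measure Ω) [IsProbabilityMeasure μ] {G : Ω × ℝ → ℝ} (hG : BM (mΩ.prod Real.measurableSpace) G) :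
    Integrable (fun t => ∫ ω, G (ω, t) ∂μ) nu := by
  have : Integrable G (μ.prod nu) := hG.integrable le_rfl
  exact this.integral_prod_right

lemma fub2 (μ : Measure Ω) [IsProbabilityMeasure μ] {G : Ω × ℝ → ℝ} (hG : BM (mΩ.prod Real.measurableSpace) G) :
    Integrable (fun ω => ∫ t, G (ω, t) ∂nu) μ := by
  have : Integrable G (μ.prod nu) := hG.integrable le_rfl
  exact this.integral_prod_left

lemma fub (μ : Measure Ω) [IsProbabilityMeasure μ] {G : Ω × ℝ → ℝ} (hG : BM (mΩ.prod Real.measurableSpace) G) :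
    ∫ t, ∫ ω, G (ω, t) ∂μ ∂nu = ∫ ω, ∫ t, G (ω, t) ∂nu ∂μ := by
  have : Integrable G (μ.prod nu) := hG.integrable le_rfl
  exact (integral_integral_swap (f := fun ω t => G (ω, t)) this).symm
end
end BE

namespace BE
/-- indicator of an interval -/
noncomputable def ind (a b w : ℝ) : ℝ := if a ≤ w ∧ w ≤ b then 1 else 0
lemma ind_nonneg (a b w : ℝ) : 0 ≤ ind a b w := by unfold ind; split_ifs <;> norm_num
lemma ind_le (a b w : ℝ) : ind a b w ≤ 1 := by unfold ind; split_ifs <;> norm_num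
lemma ind_le_exp (a b w : ℝ) : Real.exp (a / 4) * ind a b w ≤ Real.exp (w / 4) := by
  unfold ind; split_ifs with h
  · rw [mul_one]; apply Real.exp_le_exp.2; linarith [h.1]
  · rw [mul_zero]; positivity
lemma ind_mono {a b a' b' : ℝ} (w : ℝ) (h1 : a' ≤ a) (h2 : b ≤ b') : ind a b w ≤ ind a' b' w := by
  unfold ind; split_ifs with h h' h'
  · exact le_rfl
  · exact absurd ⟨h1.trans h.1, h.2.trans h2⟩ h'
  · norm_num
  · exact le_rfl

lemma BM.ind {Ω : Type*} {m : MeasurableSpace Ω} {a b w : Ω → ℝ} (ha : BM m a) (hb : BM m b) (hw : BM m w) :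
    BM m (fun ω => BE.ind (a ω) (b ω) (w ω)) :=
  BM.ite ((measurableSet_le ha.1 hw.1).inter (measurableSet_le hw.1 hb.1))

lemma cover (α : ℝ) (hα : 0 < α) (a v w : ℝ) (n : ℕ) (hn : v < n * α) :
    ind a (a + v) w ≤ ∑ k ∈ Finset.range n, (if k * α ≤ v then (1:ℝ) else 0) * ind (a + k * α) (a + k * α + α) w := by
  have hnn : ∀ k ∈ Finset.range n, 0 ≤ (if k * α ≤ v then (1:ℝ) else 0) * ind (a + k * α) (a + k * α + α) w :=
    fun k _ => mul_nonneg (by split_ifs <;> norm_num) (ind_nonneg _ _ _)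
  by_cases h : a ≤ w ∧ w ≤ a + v
  · set k := ⌊(w - a) / α⌋₊ with hk
    have h0 : 0 ≤ (w - a) / α := div_nonneg (by linarith [h.1]) hα.le
    have h1 : k * α ≤ w - a := by
      have := Nat.floor_le h0; rw [le_div_iff₀ hα] at this; exact this
    have h2 : w - a ≤ k * α + α := by
      have := Nat.lt_floor_add_one ((w - a) / α)
      rw [div_lt_iff₀ hα] at this; linarith
    have hkn : k ∈ Finset.range n := by
      rw [Finset.mem_range]
      have : (k:ℝ) * α < n * α := by linarith [h.2]
      exact_mod_cast lt_of_mul_lt_mul_right this hα.le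
    refine le_trans ?_ (Finset.single_le_sum hnn hkn)
    rw [if_pos (by linarith [h.2]), one_mul]
    unfold ind
    rw [if_pos h, if_pos ⟨by linarith, by linarith⟩]
  · have : ind a (a + v) w = 0 := by unfold ind; rw [if_neg h]
    rw [this]; exact Finset.sum_nonneg hnn

lemma cover_card (α : ℝ) (hα : 0 < α) (v : ℝ) (hv : 0 ≤ v) (n : ℕ) :
    ∑ k ∈ Finset.range n, (if k * α ≤ v then (1:ℝ) else 0) ≤ v / α + 1 := by
  rw [Finset.sum_ite]
  simp only [Finset.sum_const_zero, add_zero, Finset.sum_const, nsmul_eq_mul, mul_one]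
  have : (Finset.range n).filter (fun k : ℕ => k * α ≤ v) ⊆ Finset.range (⌊v / α⌋₊ + 1) := by
    intro k hk
    rw [Finset.mem_filter] at hk
    rw [Finset.mem_range, Nat.lt_succ_iff]
    apply Nat.le_floor; rw [le_div_iff₀ hα]; exact hk.2
  have h2 := Finset.card_le_card this
  rw [Finset.card_range] at h2
  have h3 := Nat.floor_le (div_nonneg hv hα.le)
  have h4 : ((Finset.card ((Finset.range n).filter (fun k : ℕ => k * α ≤ v)) : ℕ) : ℝ) ≤ ⌊v / α⌋₊ + 1 := by exact_mod_cast h2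
  linarith

section
variable {Ω ι : Type*} [mΩ : MeasurableSpace Ω] {μ : Measure Ω} [IsProbabilityMeasure μ] [Fintype ι]
  {F : Set ι → MeasurableSpace Ω} {D : ι → ι → ℕ} {X : ι → Ω → ℝ} {β : ℝ}

/-- concentration property with constant H -/
def PH (μ : Measure Ω) (F : Set ι → MeasurableSpace Ω) (D : ι → ι → ℕ) (X : ι → Ω → ℝ) (i : ι) (α H : ℝ) : Prop :=
  ∀ ξ x : Ω → ℝ, BM (F (NB D 2 i)) ξ → BM (F (NB D 2 i)) x → (∀ ω, 0 ≤ ξ ω) →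
    ∫ ω, ξ ω * (Real.exp (x ω / 4) * ind (x ω) (x ω + α) (WW X ω)) ∂μ ≤ H * ∫ ω, ξ ω ∂μ

namespace BF

lemma PH_init (h : BF μ F D X β) (i : ι) (α : ℝ) : PH μ F D X i α CE := by
  intro ξ x hξ hx h0
  have hx' := h.toTop hx
  have := h.locE' i hξ h0 (g := fun ω => Real.exp (x ω / 4) * ind (x ω) (x ω + α) (WW X ω))
    ((hx'.comp (g := fun s => Real.exp (s / 4)) (by fun_prop)).mul (hx'.ind (hx'.add (BM.const α)) h.bmW)) 1 (fun ω => ?_) zero_le_one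
  · rwa [one_mul] at this
  · refine (ind_le_exp _ _ _).trans ?_
    rw [one_mul]; apply Real.exp_le_exp.2
    linarith [le_abs_self (WW X ω), abs_nonneg (WW X ω)]

lemma PH_cover (h : BF μ F D X β) (i : ι) {α H : ℝ} (hα : 0 < α) (hH : 0 ≤ H) (hP : PH μ F D X i α H)
    {ξ x v : Ω → ℝ} (hξ : BM (F (NB D 2 i)) ξ) (hx : BM (F (NB D 2 i)) x) (hv : BM (F (NB D 2 i)) v)
    (h0 : ∀ ω, 0 ≤ ξ ω) (hv0 : ∀ ω, 0 ≤ v ω) :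
    ∫ ω, ξ ω * (Real.exp (x ω / 4) * ind (x ω) (x ω + v ω) (WW X ω)) ∂μ ≤ H * ∫ ω, ξ ω * (v ω / α + 1) ∂μ := by
  obtain ⟨c, hc⟩ := hv.2
  obtain ⟨n, hn⟩ := exists_nat_gt (c / α)
  rw [div_lt_iff₀ hα] at hn
  have hx' := h.toTop hx
  have hξ' := h.toTop hξ
  have hv' := h.toTop hv
  have be : BM (F Set.univ) (fun ω => Real.exp (x ω / 4)) := hx'.comp (g := fun s => Real.exp (s / 4)) (by fun_prop)
  have bt : ∀ k : ℕ, BM (F (NB D 2 i)) (fun ω => ξ ω * (if k * α ≤ v ω then (1:ℝ) else 0)) := fun k =>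
    hξ.mul ((BM.const (k * α)).iteLe hv)
  have bx : ∀ k : ℕ, BM (F (NB D 2 i)) (fun ω => x ω + k * α) := fun k => hx.add (BM.const _)
  have bi : ∀ k : ℕ, BM (F Set.univ) (fun ω => (ξ ω * (if k * α ≤ v ω then (1:ℝ) else 0)) *
      (Real.exp ((x ω + k * α) / 4) * ind (x ω + k * α) (x ω + k * α + α) (WW X ω))) := fun k =>
    (h.toTop (bt k)).mul (((h.toTop (bx k)).comp (g := fun s => Real.exp (s / 4)) (by fun_prop)).mul
      ((h.toTop (bx k)).ind ((h.toTop (bx k)).add (BM.const α)) h.bmW))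
  calc ∫ ω, ξ ω * (Real.exp (x ω / 4) * ind (x ω) (x ω + v ω) (WW X ω)) ∂μ
      ≤ ∫ ω, ∑ k ∈ Finset.range n, (ξ ω * (if k * α ≤ v ω then (1:ℝ) else 0)) *
          (Real.exp ((x ω + k * α) / 4) * ind (x ω + k * α) (x ω + k * α + α) (WW X ω)) ∂μ := by
        refine integral_mono (h.int (hξ'.mul (be.mul (hx'.ind (hx'.add hv') h.bmW))))
          (h.int (BM.sum _ fun k _ => bi k)) fun ω => ?_
        simp only
        have h1 := cover α hα (x ω) (v ω) (WW X ω) n (lt_of_le_of_lt ((le_abs_self _).trans (hc ω)) hn)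
        have h2 := mul_le_mul_of_nonneg_left h1 (mul_nonneg (h0 ω) (Real.exp_pos (x ω / 4)).le)
        rw [Finset.mul_sum] at h2
        rw [← mul_assoc]
        refine h2.trans (Finset.sum_le_sum fun k _ => ?_)
        have h3 : Real.exp (x ω / 4) ≤ Real.exp ((x ω + k * α) / 4) := by
          apply Real.exp_le_exp.2
          have : (0:ℝ) ≤ k * α := by positivity
          linarith
        have h4 : 0 ≤ ξ ω * ((if k * α ≤ v ω then (1:ℝ) else 0) * ind (x ω + k * α) (x ω + k * α + α) (WW X ω)) :=
          mul_nonneg (h0 ω) (mul_nonneg (by split_ifs <;> norm_num) (ind_nonneg _ _ _))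
        have := mul_le_mul_of_nonneg_right h3 h4
        linarith
    _ = ∑ k ∈ Finset.range n, ∫ ω, (ξ ω * (if k * α ≤ v ω then (1:ℝ) else 0)) *
          (Real.exp ((x ω + k * α) / 4) * ind (x ω + k * α) (x ω + k * α + α) (WW X ω)) ∂μ :=
        integral_finsetSum _ fun k _ => h.int (bi k)
    _ ≤ ∑ k ∈ Finset.range n, H * ∫ ω, ξ ω * (if k * α ≤ v ω then (1:ℝ) else 0) ∂μ :=
        Finset.sum_le_sum fun k _ => hP _ _ (bt k) (bx k) fun ω => mul_nonneg (h0 ω) (by split_ifs <;> norm_num)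
    _ = H * ∫ ω, ∑ k ∈ Finset.range n, ξ ω * (if k * α ≤ v ω then (1:ℝ) else 0) ∂μ := by
        rw [← Finset.mul_sum, integral_finsetSum _ fun k _ => h.int (bt k)]
    _ ≤ _ := by
        refine mul_le_mul_of_nonneg_left (integral_mono (h.int (BM.sum _ fun k _ => bt k)) (h.int (hξ.mul (BM.add ?_ (BM.const 1)))) fun ω => ?_) hH
        · simpa [div_eq_mul_inv] using hv.mul (BM.const α⁻¹)
        · simp only
          rw [← Finset.mul_sum]
          exact mul_le_mul_of_nonneg_left (cover_card α hα _ (hv0 ω) n) (h0 ω)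

/-- kernel term -/
noncomputable def Zt (X : ι → Ω → ℝ) (D : ι → ι → ℕ) (j : ι) (t : ℝ) (ω : Ω) : ℝ := X j ω * kk (Vs X D 1 j ω) t

lemma Zt_le (j : ι) (t : ℝ) (ω : Ω) : |Zt X D j t ω| ≤ |X j ω| := by
  unfold Zt; rw [abs_mul]
  exact mul_le_of_le_one_right (abs_nonneg _) (kk_abs_le _ _)

lemma bmZt (h : BF μ F D X β) (j : ι) (t : ℝ) : BM (F (NB D 1 j)) (Zt X D j t) :=
  (h.bm (h.self_mem 1 j)).mul ((h.bmVs 1 j).kkS t)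

lemma bmZ2 (h : BF μ F D X β) (j : ι) : BM (mΩ.prod Real.measurableSpace) (fun p => Zt X D j p.2 p.1) :=
  ((h.bm (Set.mem_univ j)).fst (h.le _)).mul ((h.bmVs 1 j).kkL (h.le _))

lemma Zt_abs_int (h : BF μ F D X β) (j : ι) (ω : Ω) : ∫ t, |Zt X D j t ω| ∂nu = |X j ω| * |Vs X D 1 j ω| := by
  unfold Zt
  simp_rw [abs_mul]
  rw [integral_const_mul, kk_abs_int (h.Vs_le 1 (by norm_num) j ω)]

lemma Zt_int (h : BF μ F D X β) (j : ι) (ω : Ω) : ∫ t, Zt X D j t ω ∂nu = X j ω * Vs X D 1 j ω := by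
  unfold Zt
  have := kk_int (g := fun _ => 1) continuous_const (h.Vs_le 1 (by norm_num) j ω)
  simp only [one_mul, intervalIntegral.integral_const, smul_eq_mul, mul_one, sub_zero] at this
  rw [integral_const_mul, this]

lemma sepNN (h : BF μ F D X β) (j k : ι) (hjk : 3 < D j k) : ∀ a ∈ NB D 1 j, ∀ b ∈ NB D 1 k, 1 < D a b := by
  intro a ha b hb
  have h1 := h.tri j a k
  have h2 := h.tri a b k
  have h3 := h.symm k b
  simp only [NB, Set.mem_ofPred_eq] at ha hb
  omega

lemma cov_bound (h : BF μ F D X β) (j k : ι) (t : ℝ) :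
    ∫ ω, (Zt X D j t ω - ∫ ω', Zt X D j t ω' ∂μ) * (Zt X D k t ω - ∫ ω', Zt X D k t ω' ∂μ) ∂μ ≤
      if D j k ≤ 9 then (∫ ω, |Zt X D j t ω| * |X k ω| ∂μ) + (∫ ω, |Zt X D j t ω| ∂μ) * ∫ ω, |X k ω| ∂μ else 0 := by
  set a := ∫ ω', Zt X D j t ω' ∂μ
  set b := ∫ ω', Zt X D k t ω' ∂μ
  have bj := h.bmZt j t
  have bk := h.bmZt k t
  have bXk : BM (F Set.univ) (X k) := h.bm (Set.mem_univ k)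
  by_cases h3 : 3 < D j k
  · have : ∫ ω, (Zt X D j t ω - a) * (Zt X D k t ω - b) ∂μ = 0 := by
      rw [h.imul (h.sepNN j k h3) (bj.sub (BM.const a)) (bk.sub (BM.const b)),
        integral_sub (h.int bj) (h.int (BM.const (m := F Set.univ) a))]
      simp [a]
    rw [this]
    split_ifs
    · have : 0 ≤ ∫ ω, |Zt X D j t ω| * |X k ω| ∂μ := integral_nonneg fun ω => by positivity
      have : 0 ≤ ∫ ω, |Zt X D j t ω| ∂μ := integral_nonneg fun ω => by positivity
      have : 0 ≤ ∫ ω, |X k ω| ∂μ := integral_nonneg fun ω => by positivity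
      positivity
    · exact le_rfl
  · rw [if_pos (by omega)]
    have bj' := h.toTop bj
    have bk' := h.toTop bk
    have e : ∫ ω, (Zt X D j t ω - a) * (Zt X D k t ω - b) ∂μ = (∫ ω, Zt X D j t ω * Zt X D k t ω ∂μ) - a * b := by
      have : ∀ ω, (Zt X D j t ω - a) * (Zt X D k t ω - b) = Zt X D j t ω * Zt X D k t ω - (b * Zt X D j t ω + a * Zt X D k t ω - a * b) :=
        fun ω => by ring
      simp_rw [this]
      rw [integral_sub (h.int (bj'.mul bk')) (h.int (((bj'.cmul b).add (bk'.cmul a)).sub (BM.const _))),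
        integral_sub (h.int ((bj'.cmul b).add (bk'.cmul a))) (h.int (BM.const (m := F Set.univ) _)),
        integral_add (h.int (bj'.cmul b)) (h.int (bk'.cmul a)), integral_const_mul, integral_const_mul]
      simp only [integral_const, probReal_univ, smul_eq_mul, one_mul]
      change _ - (b * a + a * b - a * b) = _
      ring
    rw [e]
    have h1 : ∫ ω, Zt X D j t ω * Zt X D k t ω ∂μ ≤ ∫ ω, |Zt X D j t ω| * |X k ω| ∂μ := by
      refine integral_mono (h.int (bj'.mul bk')) (h.int (bj'.abs.mul bXk.abs)) fun ω => ?_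
      simp only
      refine (le_abs_self _).trans ?_
      rw [abs_mul]
      exact mul_le_mul_of_nonneg_left (Zt_le k t ω) (abs_nonneg _)
    have h2 : -(a * b) ≤ (∫ ω, |Zt X D j t ω| ∂μ) * ∫ ω, |X k ω| ∂μ := by
      refine (neg_le_abs _).trans ?_
      rw [abs_mul]
      refine mul_le_mul abs_integral_le_integral_abs (abs_integral_le_integral_abs.trans ?_) (abs_nonneg _) (integral_nonneg fun ω => abs_nonneg _)
      exact integral_mono (h.int bk'.abs) (h.int bXk.abs) fun ω => Zt_le k t ω
    linarith

lemma var_pt (h : BF μ F D X β) (s : Finset ι) (t : ℝ) :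
    ∫ ω, (∑ j ∈ s, Zt X D j t ω - ∫ ω', ∑ j ∈ s, Zt X D j t ω' ∂μ) ^ 2 ∂μ ≤
      ∑ j ∈ s, ((∫ ω, |Zt X D j t ω| * Sb X D j ω ∂μ) + (∫ ω, |Zt X D j t ω| ∂μ) * ∫ ω, Sb X D j ω ∂μ) := by
  have bj := fun j => h.toTop (h.bmZt j t)
  have bc : ∀ j, BM (F Set.univ) (fun ω => Zt X D j t ω - ∫ ω', Zt X D j t ω' ∂μ) := fun j => (bj j).sub (BM.const _)
  rw [integral_finsetSum _ fun j _ => h.int (bj j)]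
  have e : ∀ ω, (∑ j ∈ s, Zt X D j t ω - ∑ j ∈ s, ∫ ω', Zt X D j t ω' ∂μ) ^ 2 =
      ∑ j ∈ s, ∑ k ∈ s, (Zt X D j t ω - ∫ ω', Zt X D j t ω' ∂μ) * (Zt X D k t ω - ∫ ω', Zt X D k t ω' ∂μ) := by
    intro ω; rw [← Finset.sum_sub_distrib, sq, Finset.sum_mul_sum]
  simp_rw [e]
  rw [integral_finsetSum _ fun j _ => h.int (BM.sum _ fun k _ => (bc j).mul (bc k))]
  refine Finset.sum_le_sum fun j _ => ?_
  rw [integral_finsetSum _ fun k _ => h.int ((bc j).mul (bc k))]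
  refine (Finset.sum_le_sum fun k _ => h.cov_bound j k t).trans ?_
  have hnn : ∀ k, 0 ≤ (∫ ω, |Zt X D j t ω| * |X k ω| ∂μ) + (∫ ω, |Zt X D j t ω| ∂μ) * ∫ ω, |X k ω| ∂μ := fun k =>
    add_nonneg (integral_nonneg fun ω => by positivity) (mul_nonneg (integral_nonneg fun ω => by positivity) (integral_nonneg fun ω => by positivity))
  rw [← Finset.sum_filter]
  refine (Finset.sum_le_sum_of_subset_of_nonneg (t := Finset.univ.filter fun k => D j k ≤ 9)
    (Finset.filter_subset_filter _ (Finset.subset_univ s)) fun k _ _ => hnn k).trans (le_of_eq ?_)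
  have bX : ∀ k, BM (F Set.univ) (fun ω => |X k ω|) := fun k => (h.bm (Set.mem_univ k)).abs
  rw [Finset.sum_add_distrib, ← Finset.mul_sum, ← integral_finsetSum _ fun k _ => h.int (bX k),
    ← integral_finsetSum _ fun k _ => h.int ((bj j).abs.mul (bX k))]
  simp_rw [← Finset.mul_sum]
  rfl

lemma var_int (h : BF μ F D X β) (s : Finset ι) :
    ∫ t, (∫ ω, (∑ j ∈ s, Zt X D j t ω - ∫ ω', ∑ j ∈ s, Zt X D j t ω' ∂μ) ^ 2 ∂μ) ∂nu ≤ 2 * β := by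
  have b1 : ∀ j, BM (mΩ.prod Real.measurableSpace) (fun p => |Zt X D j p.2 p.1| * Sb X D j p.1) := fun j =>
    (h.bmZ2 j).abs.mul ((h.bmSb j).fst (h.le _))
  have b2 : ∀ j, BM (mΩ.prod Real.measurableSpace) (fun p => |Zt X D j p.2 p.1|) := fun j => (h.bmZ2 j).abs
  have i1 : ∀ j, Integrable (fun t => ∫ ω, |Zt X D j t ω| * Sb X D j ω ∂μ) nu := fun j => fub1 μ (b1 j)
  have i2 : ∀ j, Integrable (fun t => ∫ ω, |Zt X D j t ω| ∂μ) nu := fun j => fub1 μ (b2 j)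
  have i3 : ∀ j, Integrable (fun t => (∫ ω, |Zt X D j t ω| * Sb X D j ω ∂μ) + (∫ ω, |Zt X D j t ω| ∂μ) * ∫ ω, Sb X D j ω ∂μ) nu :=
    fun j => (i1 j).add ((i2 j).mul_const _)
  have f1 : ∀ j, ∫ t, ∫ ω, |Zt X D j t ω| * Sb X D j ω ∂μ ∂nu = ∫ ω, ∫ t, |Zt X D j t ω| * Sb X D j ω ∂nu ∂μ := fun j => fub μ (b1 j)
  have f2 : ∀ j, ∫ t, ∫ ω, |Zt X D j t ω| ∂μ ∂nu = ∫ ω, ∫ t, |Zt X D j t ω| ∂nu ∂μ := fun j => fub μ (b2 j)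
  calc _ ≤ ∫ t, ∑ j ∈ s, ((∫ ω, |Zt X D j t ω| * Sb X D j ω ∂μ) + (∫ ω, |Zt X D j t ω| ∂μ) * ∫ ω, Sb X D j ω ∂μ) ∂nu := by
        refine integral_mono_of_nonneg (Filter.Eventually.of_forall fun t => integral_nonneg fun ω => sq_nonneg _)
          (integrable_finsetSum _ fun j _ => (i1 j).add ((i2 j).mul_const _)) (Filter.Eventually.of_forall fun t => h.var_pt s t)
    _ = ∑ j ∈ s, ((∫ ω, |X j ω| * |Vs X D 1 j ω| * Sb X D j ω ∂μ) + (∫ ω, |X j ω| * |Vs X D 1 j ω| ∂μ) * ∫ ω, Sb X D j ω ∂μ) := by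
        rw [integral_finsetSum _ fun j _ => i3 j]
        refine Finset.sum_congr rfl fun j _ => ?_
        rw [integral_add (i1 j) ((i2 j).mul_const _), integral_mul_const, f1, f2]
        simp only [integral_mul_const, h.Zt_abs_int j]
    _ ≤ ∑ j ∈ s, 2 * ∫ ω, Sb X D j ω ^ 3 ∂μ := by
        refine Finset.sum_le_sum fun j _ => ?_
        have bS := h.bmSb j
        have bX := (h.bm (Set.mem_univ j)).abs
        have bY := (h.toTop (h.bmVs 1 j)).abs
        have hXY : ∀ ω, |X j ω| * |Vs X D 1 j ω| ≤ Sb X D j ω ^ 2 := fun ω => by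
          rw [sq]; exact mul_le_mul (h.X_le_Sb j j (by simp [h.self]) ω) (Vs_le_Sb X D 1 (by norm_num) j ω) (abs_nonneg _) (Sb_nonneg X D j ω)
        have g1 : ∫ ω, |X j ω| * |Vs X D 1 j ω| * Sb X D j ω ∂μ ≤ ∫ ω, Sb X D j ω ^ 3 ∂μ := by
          refine integral_mono (h.int ((bX.mul bY).mul bS)) (h.int (bS.pow 3)) fun ω => ?_
          simp only
          calc _ ≤ Sb X D j ω ^ 2 * Sb X D j ω := mul_le_mul_of_nonneg_right (hXY ω) (Sb_nonneg X D j ω)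
            _ = _ := by ring
        have g2 : (∫ ω, |X j ω| * |Vs X D 1 j ω| ∂μ) * ∫ ω, Sb X D j ω ∂μ ≤ ∫ ω, Sb X D j ω ^ 3 ∂μ := by
          refine le_trans ?_ (h.ES_jensen j)
          exact mul_le_mul_of_nonneg_right (integral_mono (h.int (bX.mul bY)) (h.int (bS.pow 2)) hXY) (integral_nonneg fun ω => Sb_nonneg X D j ω)
        linarith
    _ ≤ 2 * β := by
        rw [← Finset.mul_sum]
        have := Finset.sum_le_sum_of_subset_of_nonneg (Finset.subset_univ s) (f := fun j => ∫ ω, Sb X D j ω ^ 3 ∂μ) fun j _ _ => h.ES3_nonneg j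
        linarith [h.third]

end BF
end
end BE

namespace BE
lemma exp_half_le : Real.exp (1/2) ≤ 2 := by
  have := Real.exp_bound_div_one_sub_of_interval (x := 1/2) (by norm_num) (by norm_num)
  norm_num at this ⊢; exact this
lemma exp_one_le : Real.exp 1 ≤ 3 := by linarith [Real.exp_one_lt_d9]

section
variable {Ω ι : Type*} [mΩ : MeasurableSpace Ω] {μ : Measure Ω} [IsProbabilityMeasure μ] [Fintype ι]
  {F : Set ι → MeasurableSpace Ω} {D : ι → ι → ℕ} {X : ι → Ω → ℝ} {β : ℝ}
namespace BF

lemma kappa (h : BF μ F D X β) (i : ι) (hβ : β ≤ 1/16) (hv : 1 - β ≤ ∫ ω, WW X ω ^ 2 ∂μ) :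
    1/2 ≤ ∑ j with 4 < D i j, ∫ ω, X j ω * Vs X D 1 j ω ∂μ := by
  have h1 := h.sum_XY
  rw [← Finset.sum_filter_add_sum_filter_not Finset.univ (fun j => 4 < D i j)] at h1
  have bXY : ∀ j, BM (F Set.univ) (fun ω => X j ω * Vs X D 1 j ω) := fun j => (h.bm (Set.mem_univ j)).mul (h.toTop (h.bmVs 1 j))
  have bS := h.bmSb i
  have h2 : ∑ j with ¬ 4 < D i j, ∫ ω, X j ω * Vs X D 1 j ω ∂μ ≤ ∫ ω, (1/8 + 3 * Sb X D i ω ^ 3) ∂μ := by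
    rw [← integral_finsetSum _ fun j _ => h.int (bXY j)]
    refine integral_mono (h.int (BM.sum _ fun j _ => bXY j)) (h.int ((BM.const _).add ((bS.pow 3).cmul 3))) fun ω => ?_
    simp only
    have hS := Sb_nonneg X D i ω
    calc ∑ j with ¬ 4 < D i j, X j ω * Vs X D 1 j ω ≤ ∑ j with ¬ 4 < D i j, |X j ω| * Sb X D i ω := by
          refine Finset.sum_le_sum fun j hj => ?_
          refine (le_abs_self _).trans ?_
          rw [abs_mul]
          refine mul_le_mul_of_nonneg_left ?_ (abs_nonneg _)
          refine (Finset.abs_sum_le_sum_abs _ _).trans (abs_sum_le_Sb X D i ω _ fun k hk => ?_)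
          simp only [Finset.mem_filter, Finset.mem_univ, true_and] at hj hk
          have := h.tri i j k
          omega
      _ = (∑ j with ¬ 4 < D i j, |X j ω|) * Sb X D i ω := by rw [Finset.sum_mul]
      _ ≤ Sb X D i ω * Sb X D i ω := by
          refine mul_le_mul_of_nonneg_right (abs_sum_le_Sb X D i ω _ fun k hk => ?_) hS
          simp only [Finset.mem_filter, Finset.mem_univ, true_and] at hk
          omega
      _ ≤ _ := by
          by_cases hc : Sb X D i ω ≤ 1/3
          · nlinarith [pow_nonneg hS 3]
          · push Not at hc
            nlinarith [mul_nonneg hS hS]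
  rw [integral_add (h.int (BM.const (m := F Set.univ) _)) (h.int ((bS.pow 3).cmul 3)), integral_const_mul] at h2
  simp only [integral_const, probReal_univ, smul_eq_mul, one_mul] at h2
  have := h.ES3_le i
  linarith

lemma nb_sub_fb (h : BF μ F D X β) (i j : ι) (hij : 4 < D i j) : NB D 2 i ⊆ FB D 1 j := by
  intro a ha
  have h1 := h.tri i a j
  have h2 := h.symm a j
  simp only [NB, FB, Set.mem_ofPred_eq] at ha ⊢
  omega

lemma Fterm (h : BF μ F D X β) (i : ι) (α : ℝ) (hα : 0 < α) {g x : Ω → ℝ} (hg : BM (F (NB D 2 i)) g)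
    (hx : BM (F (NB D 2 i)) x) :
    ∫ t, (∫ ω, g ω * tz α (WW X ω - x ω - t) * (∑ j with 4 < D i j, Zt X D j t ω) ∂μ) ∂nu =
      ∫ ω, g ω * (Wf X D 4 i ω * Fp α (WW X ω - x ω)) ∂μ := by
  have hg' := h.toTop hg
  have hx' := h.toTop hx
  have bu : BM (F Set.univ) (fun ω => WW X ω - x ω) := h.bmW.sub hx'
  have b0 : BM (mΩ.prod Real.measurableSpace) (fun p => g p.1 * tz α (WW X p.1 - x p.1 - p.2)) :=
    (hg'.fst (h.le _)).mul (bu.tzL α (h.le _))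
  have b1 : BM (mΩ.prod Real.measurableSpace) (fun p => g p.1 * tz α (WW X p.1 - x p.1 - p.2) * (∑ j with 4 < D i j, Zt X D j p.2 p.1)) :=
    b0.mul (BM.sum _ fun j _ => h.bmZ2 j)
  refine (fub μ b1).trans ?_
  simp only
  have bF : BM (F Set.univ) (fun ω => Fp α (WW X ω - x ω)) := bu.comp (Fp_cont α)
  have bX : ∀ j, BM (F Set.univ) (X j) := fun j => h.bm (Set.mem_univ j)
  have bFY : ∀ j, BM (F Set.univ) (fun ω => Fp α (WW X ω - x ω - Vs X D 1 j ω)) := fun j => (bu.sub (h.toTop (h.bmVs 1 j))).comp (Fp_cont α)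
  have e1 : ∀ ω, ∫ t, g ω * tz α (WW X ω - x ω - t) * (∑ j with 4 < D i j, Zt X D j t ω) ∂nu =
      ∑ j with 4 < D i j, (g ω * (X j ω * Fp α (WW X ω - x ω)) - X j ω * (g ω * Fp α (WW X ω - x ω - Vs X D 1 j ω))) := by
    intro ω
    simp_rw [Finset.mul_sum]
    rw [integral_finsetSum _ fun j _ => (b0.mul (h.bmZ2 j)).sect ω]
    refine Finset.sum_congr rfl fun j _ => ?_
    have := kk_tz (α := α) (u := WW X ω - x ω) (h.Vs_le 1 (by norm_num) j ω)
    have e : ∀ t, g ω * tz α (WW X ω - x ω - t) * Zt X D j t ω = (g ω * X j ω) * (tz α (WW X ω - x ω - t) * kk (Vs X D 1 j ω) t) := by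
      intro t; unfold Zt; ring
    simp_rw [e]
    rw [integral_const_mul, this]; ring
  simp_rw [e1]
  have e2 : ∀ j, 4 < D i j → ∫ ω, X j ω * (g ω * Fp α (WW X ω - x ω - Vs X D 1 j ω)) ∂μ = 0 := by
    intro j hj
    have hsub := h.mono _ _ (h.nb_sub_fb i j hj)
    have : ∀ ω, WW X ω - x ω - Vs X D 1 j ω = Wf X D 1 j ω - x ω := fun ω => by rw [W_split X D 1 j ω]; ring
    simp_rw [this]
    exact h.X_indep j ((hg.mono hsub).mul (((h.bmWf 1 j).sub (hx.mono hsub)).comp (Fp_cont α)))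
  rw [integral_finsetSum _ fun j _ => h.int ((hg'.mul ((bX j).mul bF)).sub ((bX j).mul (hg'.mul (bFY j))))]
  have e3 : ∀ j ∈ Finset.univ.filter (fun j => 4 < D i j), ∫ ω, (g ω * (X j ω * Fp α (WW X ω - x ω)) - X j ω * (g ω * Fp α (WW X ω - x ω - Vs X D 1 j ω))) ∂μ
      = ∫ ω, g ω * (X j ω * Fp α (WW X ω - x ω)) ∂μ := by
    intro j hj
    rw [integral_sub (h.int (hg'.mul ((bX j).mul bF))) (h.int ((bX j).mul (hg'.mul (bFY j)))), e2 j (Finset.mem_filter.1 hj).2, sub_zero]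
  rw [Finset.sum_congr rfl e3, ← integral_finsetSum _ fun j _ => h.int (hg'.mul ((bX j).mul bF))]
  congr 1; ext ω
  rw [← Finset.mul_sum, ← Finset.sum_mul]; rfl

lemma T3 (h : BF μ F D X β) (i : ι) {α : ℝ} (hα : 0 < α) (hα1 : α ≤ 1) {ξ x : Ω → ℝ} (hξ : BM (F (NB D 2 i)) ξ)
    (hx : BM (F (NB D 2 i)) x) (h0 : ∀ ω, 0 ≤ ξ ω) :
    ∫ ω, (ξ ω * Real.exp (x ω / 4)) * (Wf X D 4 i ω * Fp α (WW X ω - x ω)) ∂μ ≤ 18 * α * CE * ∫ ω, ξ ω ∂μ := by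
  have hx' := h.toTop hx
  have be : BM (F Set.univ) (fun ω => Real.exp (x ω / 4)) := hx'.comp (g := fun s => Real.exp (s / 4)) (by fun_prop)
  simp_rw [mul_assoc (ξ _)]
  refine h.locE' i hξ h0 (be.mul ((h.toTop (h.bmWf 4 i)).mul ((h.bmW.sub hx').comp (Fp_cont α)))) (18 * α) (fun ω => ?_) (by positivity)
  rcases le_total (WW X ω - x ω) (-α) with hc | hc
  · rw [Fp_zero hα hc]; simp; positivity
  · have hw : |Wf X D 4 i ω| ≤ |WW X ω| + 1 := by
      have h1 := W_split X D 4 i ω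
      have h2 := h.Vs_le 4 (by norm_num) i ω
      have : Wf X D 4 i ω = WW X ω - Vs X D 4 i ω := by linarith
      rw [this]; exact (abs_sub _ _).trans (by linarith)
    set s := |WW X ω| with hs
    have hs0 : 0 ≤ s := abs_nonneg _
    have h3 : s + 1 ≤ 2 * Real.exp (s / 2) := by linarith [Real.add_one_le_exp (s/2)]
    have h4 : Real.exp (x ω / 4) ≤ Real.exp (1/2) * Real.exp (s / 2) := by
      rw [← Real.exp_add]; apply Real.exp_le_exp.2
      linarith [le_abs_self (WW X ω)]
    have h5 : Real.exp (x ω / 4) ≤ 2 * Real.exp (s / 2) := h4.trans (mul_le_mul_of_nonneg_right exp_half_le (Real.exp_pos _).le)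
    have h6 : Real.exp s = Real.exp (s/2) * Real.exp (s/2) := by rw [← Real.exp_add]; congr 1; ring
    have h7 : Wf X D 4 i ω * Fp α (WW X ω - x ω) ≤ (2 * Real.exp (s/2)) * (3 * α) := by
      refine mul_le_mul ((le_abs_self _).trans (hw.trans h3)) (Fp_le hα _) (Fp_nonneg hα _) (by positivity)
    calc Real.exp (x ω / 4) * (Wf X D 4 i ω * Fp α (WW X ω - x ω)) ≤ Real.exp (x ω / 4) * ((2 * Real.exp (s/2)) * (3 * α)) :=
          mul_le_mul_of_nonneg_left h7 (Real.exp_pos _).le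
      _ ≤ 2 * Real.exp (s / 2) * ((2 * Real.exp (s/2)) * (3 * α)) := mul_le_mul_of_nonneg_right h5 (by positivity)
      _ = 12 * α * Real.exp s := by rw [h6]; ring
      _ ≤ _ := by nlinarith [Real.exp_pos s, mul_pos hα (Real.exp_pos s)]

lemma T1 (h : BF μ F D X β) (i : ι) {α H : ℝ} (hα : 0 < α) (hα1 : α ≤ 1) (hH : 0 ≤ H) (hP : PH μ F D X i α H)
    {ξ x : Ω → ℝ} (hξ : BM (F (NB D 2 i)) ξ) (hx : BM (F (NB D 2 i)) x) (h0 : ∀ ω, 0 ≤ ξ ω) {t : ℝ} (ht : |t| ≤ 1) :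
    ∫ ω, (ξ ω * Real.exp (x ω / 4)) * |tz α (WW X ω - x ω) - tz α (WW X ω - x ω - t)| ∂μ ≤ 12 * H * (|t| / α) * ∫ ω, ξ ω ∂μ := by
  have hx' := h.toTop hx
  have hξ' := h.toTop hξ
  have be : BM (F Set.univ) (fun ω => Real.exp (x ω / 4)) := hx'.comp (g := fun s => Real.exp (s / 4)) (by fun_prop)
  have bt := (((h.bmW.sub hx').comp (tz_cont α)).sub (((h.bmW.sub hx').sub (BM.const t)).comp (tz_cont α))).abs
  have bx2 : BM (F (NB D 2 i)) (fun ω => x ω - (α + |t|)) := hx.sub (BM.const _)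
  have hc := h.PH_cover i hα hH hP hξ bx2 (v := fun _ => 3 * α + 2 * |t|) (BM.const _) h0 (fun _ => by positivity)
  have bx2' := h.toTop bx2
  have bR : BM (F Set.univ) (fun ω => ξ ω * (Real.exp ((x ω - (α + |t|)) / 4) * ind (x ω - (α + |t|)) (x ω - (α + |t|) + (3 * α + 2 * |t|)) (WW X ω))) :=
    hξ'.mul ((bx2'.comp (g := fun s => Real.exp (s / 4)) (by fun_prop)).mul (bx2'.ind (bx2'.add (BM.const _)) h.bmW))
  set M := min 1 (|t| / α) with hM
  have hM0 : 0 ≤ M := le_min zero_le_one (by positivity)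
  have hta : 0 ≤ |t| / α := by positivity
  have s1 : ∫ ω, (ξ ω * Real.exp (x ω / 4)) * |tz α (WW X ω - x ω) - tz α (WW X ω - x ω - t)| ∂μ ≤
      ∫ ω, (M * 2) * (ξ ω * (Real.exp ((x ω - (α + |t|)) / 4) * ind (x ω - (α + |t|)) (x ω - (α + |t|) + (3 * α + 2 * |t|)) (WW X ω))) ∂μ := by
    refine integral_mono (h.int ((hξ'.mul be).mul bt)) (h.int (bR.cmul _)) fun ω => ?_
    simp only
    have h1 := tz_jump hα (WW X ω - x ω) t
    have h2 : (if -α - |t| ≤ WW X ω - x ω ∧ WW X ω - x ω ≤ 2 * α + |t| then (1:ℝ) else 0) =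
        ind (x ω - (α + |t|)) (x ω - (α + |t|) + (3 * α + 2 * |t|)) (WW X ω) := by
      unfold ind; congr 1
      apply propext
      constructor <;> rintro ⟨a, b⟩ <;> constructor <;> linarith
    rw [h2] at h1
    set I := ind (x ω - (α + |t|)) (x ω - (α + |t|) + (3 * α + 2 * |t|)) (WW X ω)
    have hI : 0 ≤ I := ind_nonneg _ _ _
    have h3 : Real.exp (x ω / 4) ≤ 2 * Real.exp ((x ω - (α + |t|)) / 4) := by
      calc Real.exp (x ω / 4) ≤ Real.exp (1/2) * Real.exp ((x ω - (α + |t|)) / 4) := by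
            rw [← Real.exp_add]; apply Real.exp_le_exp.2; linarith
        _ ≤ _ := mul_le_mul_of_nonneg_right exp_half_le (Real.exp_pos _).le
    calc ξ ω * Real.exp (x ω / 4) * |tz α (WW X ω - x ω) - tz α (WW X ω - x ω - t)|
        ≤ ξ ω * Real.exp (x ω / 4) * (M * I) := mul_le_mul_of_nonneg_left h1 (mul_nonneg (h0 ω) (Real.exp_pos _).le)
      _ ≤ ξ ω * (2 * Real.exp ((x ω - (α + |t|)) / 4)) * (M * I) :=
          mul_le_mul_of_nonneg_right (mul_le_mul_of_nonneg_left h3 (h0 ω)) (by positivity)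
      _ = _ := by ring
  rw [integral_const_mul] at s1
  rw [integral_mul_const] at hc
  have hE : 0 ≤ ∫ ω, ξ ω ∂μ := integral_nonneg h0
  have h4 : M * ((3 * α + 2 * |t|) / α + 1) ≤ 6 * (|t| / α) := by
    have : (3 * α + 2 * |t|) / α = 3 + 2 * (|t| / α) := by field_simp
    rw [this]
    have a1 : M ≤ 1 := min_le_left _ _
    have a2 : M ≤ |t| / α := min_le_right _ _
    nlinarith
  have h5 := mul_le_mul_of_nonneg_left hc (mul_nonneg hM0 (by norm_num : (0:ℝ) ≤ 2))
  have h6 := mul_le_mul_of_nonneg_right h4 (mul_nonneg hH hE)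
  refine s1.trans (h5.trans ?_)
  linarith

lemma T2 (h : BF μ F D X β) (i : ι) {α : ℝ} (hα : 0 < α) (hα1 : α ≤ 1)
    {ξ x K : Ω → ℝ} (hξ : BM (F (NB D 2 i)) ξ) (hx : BM (F (NB D 2 i)) x) (h0 : ∀ ω, 0 ≤ ξ ω) {t : ℝ} (ht : |t| ≤ 1)
    (hK : BM (F (FB D 3 i)) K) (c : ℝ) :
    ∫ ω, (ξ ω * Real.exp (x ω / 4)) * tz α (WW X ω - x ω - t) * (c - K ω) ∂μ ≤
      3 / 2 * (∫ ω, (ξ ω * Real.exp |WW X ω|) * tz α (WW X ω - x ω - t) ∂μ) + 1/2 * ((∫ ω, ξ ω ∂μ) * ∫ ω, (K ω - c) ^ 2 ∂μ) := by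
  have hx' := h.toTop hx
  have hξ' := h.toTop hξ
  have hK' := h.toTop hK
  have be : BM (F Set.univ) (fun ω => Real.exp (x ω / 4)) := hx'.comp (g := fun s => Real.exp (s / 4)) (by fun_prop)
  have bt := (((h.bmW.sub hx').sub (BM.const t)).comp (tz_cont α))
  have bA := (hξ'.mul h.bmEA).mul bt
  have bK2 : BM (F (FB D 3 i)) (fun ω => (K ω - c) ^ 2) := (hK.sub (BM.const c)).pow 2
  rw [← h.imul (h.sepNF 2 i) hξ bK2, ← integral_const_mul, ← integral_const_mul,
    ← integral_add (h.int (bA.cmul _)) (h.int ((hξ'.mul (h.toTop bK2)).cmul _))]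
  refine integral_mono (h.int (((hξ'.mul be).mul bt).mul ((BM.const c).sub hK'))) (h.int ((bA.cmul _).add ((hξ'.mul (h.toTop bK2)).cmul _))) fun ω => ?_
  simp only
  set k := tz α (WW X ω - x ω - t) with hk
  have hk0 : 0 ≤ k := tz_nonneg _ _
  have hk1 : k ≤ 1 := tz_le _ _
  set e := Real.exp (x ω / 4) with he
  have h1 : e ^ 2 * k ≤ 3 * Real.exp |WW X ω| * k := by
    rcases le_total (WW X ω - x ω - t) (-α) with hc | hc
    · have : k = 0 := tz_zero_left hα hc
      rw [this]; simp
    · refine mul_le_mul_of_nonneg_right ?_ hk0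
      calc e ^ 2 = Real.exp (x ω / 2) := by rw [he, ← Real.exp_nat_mul]; congr 1; push_cast; ring
        _ ≤ Real.exp (1 + |WW X ω|) := by
            apply Real.exp_le_exp.2
            linarith [le_abs_self (WW X ω), abs_nonneg (WW X ω), neg_abs_le t]
        _ = Real.exp 1 * Real.exp |WW X ω| := Real.exp_add _ _
        _ ≤ _ := mul_le_mul_of_nonneg_right exp_one_le (Real.exp_pos _).le
  have h2 : e * k * (c - K ω) ≤ 1/2 * (e ^ 2 * k) + 1/2 * (K ω - c) ^ 2 := by
    have : (e * k) ^ 2 ≤ e ^ 2 * k := by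
      rw [mul_pow]; refine mul_le_mul_of_nonneg_left ?_ (sq_nonneg _); nlinarith
    nlinarith [sq_nonneg (e * k - (c - K ω))]
  have h3 : e * k * (c - K ω) ≤ 3/2 * (Real.exp |WW X ω| * k) + 1/2 * (K ω - c)^2 := by linarith
  have := mul_le_mul_of_nonneg_left h3 (h0 ω)
  linarith

end BF
end
end BE

namespace BE
section
variable {Ω ι : Type*} [mΩ : MeasurableSpace Ω] {μ : Measure Ω} [IsProbabilityMeasure μ] [Fintype ι]
  {F : Set ι → MeasurableSpace Ω} {D : ι → ι → ℕ} {X : ι → Ω → ℝ} {β : ℝ}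
namespace BF

lemma tK_pt (h : BF μ F D X β) (s : Finset ι) (t : ℝ) :
    |t| * |∫ ω, ∑ j ∈ s, Zt X D j t ω ∂μ| ≤ ∑ j ∈ s, ∫ ω, |Zt X D j t ω| * |Vs X D 1 j ω| ∂μ := by
  have bj := fun j => h.toTop (h.bmZt j t)
  have bY := fun j => (h.toTop (h.bmVs 1 j)).abs
  rw [integral_finsetSum _ fun j _ => h.int (bj j)]
  refine (mul_le_mul_of_nonneg_left (Finset.abs_sum_le_sum_abs _ _) (abs_nonneg _)).trans ?_
  rw [Finset.mul_sum]
  refine Finset.sum_le_sum fun j _ => ?_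
  refine (mul_le_mul_of_nonneg_left abs_integral_le_integral_abs (abs_nonneg _)).trans ?_
  rw [← integral_const_mul]
  refine integral_mono (h.int ((bj j).abs.cmul _)) (h.int ((bj j).abs.mul (bY j))) fun ω => ?_
  simp only
  unfold Zt
  rw [abs_mul]
  have := mul_le_mul_of_nonneg_left (kk_t_le (Vs X D 1 j ω) t) (abs_nonneg (X j ω))
  linarith

lemma tK (h : BF μ F D X β) (s : Finset ι) :
    ∫ t, |t| * |∫ ω, ∑ j ∈ s, Zt X D j t ω ∂μ| ∂nu ≤ β := by
  have b1 : ∀ j, BM (mΩ.prod Real.measurableSpace) (fun p => |Zt X D j p.2 p.1| * |Vs X D 1 j p.1|) := fun j =>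
    (h.bmZ2 j).abs.mul ((h.bmVs 1 j).abs.fst (h.le _))
  have i1 : ∀ j, Integrable (fun t => ∫ ω, |Zt X D j t ω| * |Vs X D 1 j ω| ∂μ) nu := fun j => fub1 μ (b1 j)
  have f1 : ∀ j, ∫ t, ∫ ω, |Zt X D j t ω| * |Vs X D 1 j ω| ∂μ ∂nu = ∫ ω, ∫ t, |Zt X D j t ω| * |Vs X D 1 j ω| ∂nu ∂μ := fun j => fub μ (b1 j)
  calc _ ≤ ∫ t, ∑ j ∈ s, ∫ ω, |Zt X D j t ω| * |Vs X D 1 j ω| ∂μ ∂nu :=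
        integral_mono_of_nonneg (Filter.Eventually.of_forall fun t => by positivity)
          (integrable_finsetSum _ fun j _ => i1 j) (Filter.Eventually.of_forall fun t => h.tK_pt s t)
    _ = ∑ j ∈ s, ∫ ω, |X j ω| * |Vs X D 1 j ω| * |Vs X D 1 j ω| ∂μ := by
        rw [integral_finsetSum _ fun j _ => i1 j]
        simp only [f1, integral_mul_const, h.Zt_abs_int]
    _ ≤ ∑ j ∈ s, ∫ ω, Sb X D j ω ^ 3 ∂μ := by
        refine Finset.sum_le_sum fun j _ => ?_
        have bS := h.bmSb j
        have bX := (h.bm (Set.mem_univ j)).abs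
        have bY := (h.toTop (h.bmVs 1 j)).abs
        refine integral_mono (h.int ((bX.mul bY).mul bY)) (h.int (bS.pow 3)) fun ω => ?_
        have hS := Sb_nonneg X D j ω
        have hY := Vs_le_Sb X D 1 (by norm_num) j ω
        have hX := h.X_le_Sb j j (by simp [h.self]) ω
        simp only
        calc _ ≤ Sb X D j ω * Sb X D j ω * Sb X D j ω := by gcongr
          _ = _ := by ring
    _ ≤ β := by
        have := Finset.sum_le_sum_of_subset_of_nonneg (Finset.subset_univ s) (f := fun j => ∫ ω, Sb X D j ω ^ 3 ∂μ) fun j _ _ => h.ES3_nonneg j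
        linarith [h.third]

lemma Kint (h : BF μ F D X β) (s : Finset ι) :
    ∫ t, ∫ ω, ∑ j ∈ s, Zt X D j t ω ∂μ ∂nu = ∑ j ∈ s, ∫ ω, X j ω * Vs X D 1 j ω ∂μ := by
  have b1 : BM (mΩ.prod Real.measurableSpace) (fun p => ∑ j ∈ s, Zt X D j p.2 p.1) := BM.sum _ fun j _ => h.bmZ2 j
  refine (fub μ b1).trans ?_
  simp only
  rw [← integral_finsetSum _ fun j _ => h.int ((h.bm (Set.mem_univ j)).mul (h.toTop (h.bmVs 1 j)))]
  congr 1; ext ω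
  rw [integral_finsetSum _ fun j _ => (h.bmZ2 j).sect ω]
  exact Finset.sum_congr rfl fun j _ => h.Zt_int j ω

lemma PH_step (h : BF μ F D X β) (i : ι) {α H : ℝ} (hα : 0 < α) (hα1 : α ≤ 1) (hH : 0 ≤ H)
    (hβ : β ≤ 1/16) (hv : 1 - β ≤ ∫ ω, WW X ω ^ 2 ∂μ) (hαβ : 96 * β ≤ α) (hP : PH μ F D X i α H) :
    PH μ F D X i α (48 * CE * α + H / 2) := by
  intro ξ x hξ hx h0
  have hx' := h.toTop hx
  have hξ' := h.toTop hξ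
  have be2 : BM (F (NB D 2 i)) (fun ω => Real.exp (x ω / 4)) := hx.comp (g := fun s => Real.exp (s / 4)) (by fun_prop)
  have be := h.toTop be2
  set E0 := ∫ ω, ξ ω ∂μ with hE0
  have hE : 0 ≤ E0 := integral_nonneg h0
  set s := Finset.univ.filter (fun j => 4 < D i j) with hs
  set g := fun ω => ξ ω * Real.exp (x ω / 4) with hg
  have hg0 : ∀ ω, 0 ≤ g ω := fun ω => mul_nonneg (h0 ω) (Real.exp_pos _).le
  have bg2 : BM (F (NB D 2 i)) g := hξ.mul be2
  have bg := h.toTop bg2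
  set K := fun t => ∫ ω, ∑ j ∈ s, Zt X D j t ω ∂μ with hK
  have bZ : BM (mΩ.prod Real.measurableSpace) (fun p => ∑ j ∈ s, Zt X D j p.2 p.1) := BM.sum _ fun j _ => h.bmZ2 j
  have iK : Integrable K nu := fub1 μ bZ
  have bu : BM (F Set.univ) (fun ω => WW X ω - x ω) := h.bmW.sub hx'
  have bt0 := bu.comp (tz_cont α)
  have btt : ∀ t, BM (F Set.univ) (fun ω => tz α (WW X ω - x ω - t)) := fun t => (bu.sub (BM.const t)).comp (tz_cont α)
  set G := ∫ ω, g ω * tz α (WW X ω - x ω) ∂μ with hG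
  have hG0 : 0 ≤ G := integral_nonneg fun ω => mul_nonneg (hg0 ω) (tz_nonneg _ _)
  -- the sum of kernels is far measurable
  have bS : ∀ t, BM (F (FB D 3 i)) (fun ω => ∑ j ∈ s, Zt X D j t ω) := by
    intro t
    refine BM.sum _ fun j hj => (h.bmZt j t).mono (h.mono _ _ ?_)
    intro a ha
    have hj' : 4 < D i j := (Finset.mem_filter.1 hj).2
    have t1 := h.tri i a j
    have t2 := h.symm a j
    simp only [NB, FB, Set.mem_ofPred_eq] at ha ⊢
    omega
  -- integrable pieces in t
  have i1 : Integrable (fun t => |t| * |K t|) nu := by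
    refine Integrable.mono' (iK.abs) ((measurable_id.abs.aestronglyMeasurable).mul iK.abs.aestronglyMeasurable) ?_
    refine (ae_restrict_mem measurableSet_Ioc).mono fun t ht => ?_
    have : |t| ≤ 1 := abs_le.2 ⟨ht.1.le, ht.2⟩
    simp only [norm_mul, Real.norm_eq_abs, abs_abs]
    exact mul_le_of_le_one_left (abs_nonneg _) this
  have b2 : BM (mΩ.prod Real.measurableSpace) (fun p => (ξ p.1 * Real.exp |WW X p.1|) * tz α (WW X p.1 - x p.1 - p.2)) :=
    ((hξ'.mul h.bmEA).fst (h.le _)).mul (bu.tzL α (h.le _))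
  have i2 : Integrable (fun t => ∫ ω, (ξ ω * Real.exp |WW X ω|) * tz α (WW X ω - x ω - t) ∂μ) nu := fub1 μ b2
  have f2 : ∫ t, ∫ ω, (ξ ω * Real.exp |WW X ω|) * tz α (WW X ω - x ω - t) ∂μ ∂nu = ∫ ω, ∫ t, (ξ ω * Real.exp |WW X ω|) * tz α (WW X ω - x ω - t) ∂nu ∂μ := fub μ b2
  have i3 : Integrable (fun t => ∫ ω, (∑ j ∈ s, Zt X D j t ω - K t) ^ 2 ∂μ) nu := by
    have hb : ∃ c, ∀ t, |K t| ≤ c := by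
      obtain ⟨c, hc⟩ := bZ.2
      refine ⟨c, fun t => abs_integral_le_integral_abs.trans ?_⟩
      have : ∫ ω, |∑ j ∈ s, Zt X D j t ω| ∂μ ≤ ∫ ω, c ∂μ :=
        integral_mono (h.int (bS t).abs) (h.int (BM.const (m := F Set.univ) c)) fun ω => hc (ω, t)
      simpa using this
    have hKm : Measurable K := by
      have : StronglyMeasurable (fun p : ℝ × Ω => ∑ j ∈ s, Zt X D j p.1 p.2) :=
        (bZ.1.comp measurable_swap).stronglyMeasurable
      exact (this.integral_prod_right (ν := μ)).measurable
    have bK : BM (mΩ.prod Real.measurableSpace) (fun p => K p.2) := ⟨hKm.comp measurable_snd, hb.choose, fun p => hb.choose_spec p.2⟩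
    exact fub1 μ ((bZ.sub bK).pow 2)
  have b4 : BM (mΩ.prod Real.measurableSpace) (fun p => g p.1 * tz α (WW X p.1 - x p.1 - p.2) * (∑ j ∈ s, Zt X D j p.2 p.1)) :=
    ((bg.fst (h.le _)).mul (bu.tzL α (h.le _))).mul bZ
  have i4 : Integrable (fun t => ∫ ω, g ω * tz α (WW X ω - x ω - t) * (∑ j ∈ s, Zt X D j t ω) ∂μ) nu := fub1 μ b4
  have f4 : ∫ t, ∫ ω, g ω * tz α (WW X ω - x ω - t) * (∑ j ∈ s, Zt X D j t ω) ∂μ ∂nu = ∫ ω, g ω * (Wf X D 4 i ω * Fp α (WW X ω - x ω)) ∂μ :=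
    h.Fterm i α hα bg2 hx
  -- pointwise in t
  have key : ∀ t ∈ Set.Ioc (-1:ℝ) 1, K t * G ≤ 12 * H / α * E0 * (|t| * |K t|) +
      (3 / 2 * (∫ ω, (ξ ω * Real.exp |WW X ω|) * tz α (WW X ω - x ω - t) ∂μ) +
      (E0 / 2 * (∫ ω, (∑ j ∈ s, Zt X D j t ω - K t) ^ 2 ∂μ) +
      ∫ ω, g ω * tz α (WW X ω - x ω - t) * (∑ j ∈ s, Zt X D j t ω) ∂μ)) := by
    intro t ht
    have ht1 : |t| ≤ 1 := abs_le.2 ⟨ht.1.le, ht.2⟩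
    have u1 := h.T1 i hα hα1 hH hP hξ hx h0 ht1
    have u2 := h.T2 i hα hα1 hξ hx h0 ht1 (bS t) (K t)
    have bZt := h.toTop (bS t)
    have e : K t * G = K t * (∫ ω, g ω * (tz α (WW X ω - x ω) - tz α (WW X ω - x ω - t)) ∂μ) +
        ((∫ ω, g ω * tz α (WW X ω - x ω - t) * (K t - ∑ j ∈ s, Zt X D j t ω) ∂μ) +
        ∫ ω, g ω * tz α (WW X ω - x ω - t) * (∑ j ∈ s, Zt X D j t ω) ∂μ) := by
      rw [← integral_const_mul, ← integral_const_mul, ← integral_add (h.int ((bg.mul (btt t)).mul ((BM.const _).sub bZt))) (h.int ((bg.mul (btt t)).mul bZt)),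
        ← integral_add (h.int ((bg.mul (bt0.sub (btt t))).cmul _)) (h.int (((bg.mul (btt t)).mul ((BM.const _).sub bZt)).add ((bg.mul (btt t)).mul bZt)))]
      congr 1; ext ω; ring
    have u3 : K t * (∫ ω, g ω * (tz α (WW X ω - x ω) - tz α (WW X ω - x ω - t)) ∂μ) ≤ 12 * H / α * E0 * (|t| * |K t|) := by
      refine (le_abs_self _).trans ?_
      rw [abs_mul]
      have : |∫ ω, g ω * (tz α (WW X ω - x ω) - tz α (WW X ω - x ω - t)) ∂μ| ≤ 12 * H * (|t| / α) * E0 := by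
        refine abs_integral_le_integral_abs.trans (le_trans (le_of_eq ?_) u1)
        congr 1; ext ω; rw [abs_mul, abs_of_nonneg (hg0 ω)]
      have := mul_le_mul_of_nonneg_left this (abs_nonneg (K t))
      refine this.trans (le_of_eq ?_)
      ring
    rw [e]
    linarith
  have hIntg := integral_mono_ae (μ := nu) (iK.mul_const G) ((i1.const_mul (12 * H / α * E0)).add ((i2.const_mul (3/2)).add ((i3.const_mul (E0/2)).add i4)))
    ((ae_restrict_mem measurableSet_Ioc).mono fun t ht => key t ht)
  simp only [Pi.add_apply] at hIntg
  have ia34 : Integrable (fun t => E0 / 2 * (∫ ω, (∑ j ∈ s, Zt X D j t ω - K t) ^ 2 ∂μ) +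
      ∫ ω, g ω * tz α (WW X ω - x ω - t) * (∑ j ∈ s, Zt X D j t ω) ∂μ) nu := (i3.const_mul (E0/2)).add i4
  have ia234 : Integrable (fun t => 3 / 2 * (∫ ω, (ξ ω * Real.exp |WW X ω|) * tz α (WW X ω - x ω - t) ∂μ) + (E0 / 2 * (∫ ω, (∑ j ∈ s, Zt X D j t ω - K t) ^ 2 ∂μ) +
      ∫ ω, g ω * tz α (WW X ω - x ω - t) * (∑ j ∈ s, Zt X D j t ω) ∂μ)) nu := (i2.const_mul (3/2)).add ia34
  rw [integral_mul_const, integral_add (i1.const_mul _) ia234, integral_add (i2.const_mul _) ia34,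
    integral_add (i3.const_mul _) i4, integral_const_mul, integral_const_mul, integral_const_mul, f4, f2] at hIntg
  have k1 : 1/2 ≤ ∫ t, K t ∂nu := by
    rw [hK, h.Kint s]; exact h.kappa i hβ hv
  have k2 : ∫ t, |t| * |K t| ∂nu ≤ β := h.tK s
  have k3 : ∫ ω, ∫ t, (ξ ω * Real.exp |WW X ω|) * tz α (WW X ω - x ω - t) ∂nu ∂μ ≤ 3 * α * (CE * E0) := by
    calc _ ≤ ∫ ω, 3 * α * (ξ ω * Real.exp |WW X ω|) ∂μ := by
          refine integral_mono (fub2 μ b2) (h.int ((hξ'.mul h.bmEA).cmul _)) fun ω => ?_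
          simp only
          rw [integral_const_mul, mul_comm (3 * α)]
          exact mul_le_mul_of_nonneg_left (tz_nu_le hα) (mul_nonneg (h0 ω) (Real.exp_pos _).le)
      _ ≤ _ := by
          rw [integral_const_mul]
          exact mul_le_mul_of_nonneg_left (h.locE i hξ h0) (by positivity)
  have k4 : ∫ t, (∫ ω, (∑ j ∈ s, Zt X D j t ω - K t) ^ 2 ∂μ) ∂nu ≤ 2 * β := h.var_int s
  have k5 := h.T3 i hα hα1 hξ hx h0
  have hCE := CE_ge
  have hβ0 := h.beta_nonneg
  -- compare indicator
  have fin : ∫ ω, ξ ω * (Real.exp (x ω / 4) * ind (x ω) (x ω + α) (WW X ω)) ∂μ ≤ G := by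
    refine integral_mono (h.int (hξ'.mul (be.mul (hx'.ind (hx'.add (BM.const α)) h.bmW)))) (h.int (bg.mul bt0)) fun ω => ?_
    simp only [hg]
    rw [← mul_assoc]
    refine mul_le_mul_of_nonneg_left ?_ (hg0 ω)
    unfold ind
    split_ifs with hc
    · exact tz_one hα (by linarith [hc.1]) (by linarith [hc.2])
    · exact tz_nonneg _ _
  have m1 : 12 * H / α * E0 * (∫ t, |t| * |K t| ∂nu) ≤ H / 8 * E0 := by
    calc _ ≤ 12 * H / α * E0 * β := mul_le_mul_of_nonneg_left k2 (by positivity)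
      _ ≤ 12 * H / α * E0 * (α / 96) := mul_le_mul_of_nonneg_left (by linarith) (by positivity)
      _ = _ := by field_simp; ring
  have m2 : E0 / 2 * (∫ t, (∫ ω, (∑ j ∈ s, Zt X D j t ω - K t) ^ 2 ∂μ) ∂nu) ≤ α * CE * E0 := by
    calc _ ≤ E0 / 2 * (2 * β) := mul_le_mul_of_nonneg_left k4 (by positivity)
      _ = β * E0 := by ring
      _ ≤ α * CE * E0 := mul_le_mul_of_nonneg_right (by nlinarith) hE
  have m3 : 1/2 * G ≤ (∫ t, K t ∂nu) * G := mul_le_mul_of_nonneg_right k1 hG0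
  have m4 : 0 ≤ α * CE * E0 := by positivity
  have m5 : 0 ≤ H * E0 := by positivity
  linarith

lemma conc (h : BF μ F D X β) (i : ι) {α : ℝ} (hα : 0 < α) (hα1 : α ≤ 1)
    (hβ : β ≤ 1/16) (hv : 1 - β ≤ ∫ ω, WW X ω ^ 2 ∂μ) (hαβ : 96 * β ≤ α) :
    PH μ F D X i α (96 * CE * α) := by
  have hCE := CE_ge
  have := iter_lem (P := fun H => PH μ F D X i α H) (H0 := CE) (c := 48 * CE * α) (by positivity) (by linarith) (h.PH_init i α)
    (fun H hH hP => h.PH_step i hα hα1 hH hβ hv hαβ hP) ?_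
  · convert this using 1; ring
  · intro H hε ξ x hξ hx h0
    have hE : 0 ≤ ∫ ω, ξ ω ∂μ := integral_nonneg h0
    refine le_of_forall_pos_le_add fun ε he => ?_
    obtain ⟨δ, hδ, hP⟩ := hε (ε / ((∫ ω, ξ ω ∂μ) + 1)) (by positivity)
    refine (hP ξ x hξ hx h0).trans ?_
    rw [add_mul]
    have h1 : δ * (∫ ω, ξ ω ∂μ) ≤ (ε / ((∫ ω, ξ ω ∂μ) + 1)) * ∫ ω, ξ ω ∂μ := mul_le_mul_of_nonneg_right hδ hE
    have h2 : (ε / ((∫ ω, ξ ω ∂μ) + 1)) * (∫ ω, ξ ω ∂μ) ≤ ε := by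
      rw [div_mul_eq_mul_div, div_le_iff₀ (by positivity)]
      nlinarith
    linarith

end BF
end
end BE

namespace BE
lemma jmp_eq (z α w v : ℝ) : jmp z α w v = min 1 (v / α) * ind (z - v) (z - v + (α + 2 * v)) w := by
  unfold jmp ind
  have : (z - v ≤ w ∧ w ≤ z - v + (α + 2 * v)) ↔ (z - v ≤ w ∧ w ≤ z + α + v) := by
    constructor <;> rintro ⟨a, b⟩ <;> constructor <;> linarith
  simp only [this]
  split_ifs <;> simp

section
variable {Ω ι : Type*} [mΩ : MeasurableSpace Ω] {μ : Measure Ω} [IsProbabilityMeasure μ] [Fintype ι]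
  {F : Set ι → MeasurableSpace Ω} {D : ι → ι → ℕ} {X : ι → Ω → ℝ} {β : ℝ}
namespace BF

lemma expE (h : BF μ F D X β) : ∫ ω, Real.exp |WW X ω| ∂μ ≤ CE := by
  rcases isEmpty_or_nonempty ι with he | ⟨⟨i⟩⟩
  · simp [WW]; linarith [CE_ge]
  · have := h.locE i (ξ := fun _ => 1) (BM.const 1) (fun _ => zero_le_one)
    simpa using this

lemma jump_bound (h : BF μ F D X β) (i : ι) {α : ℝ} (hα : 0 < α) (hα1 : α ≤ 1)
    (hβ : β ≤ 1/16) (hv : 1 - β ≤ ∫ ω, WW X ω ^ 2 ∂μ) (hαβ : 96 * β ≤ α) (z : ℝ)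
    {ξ v : Ω → ℝ} (hξ : BM (F (NB D 2 i)) ξ) (bv : BM (F (NB D 2 i)) v)
    (h0 : ∀ ω, 0 ≤ ξ ω) (hv0 : ∀ ω, 0 ≤ v ω) (hv1 : ∀ ω, v ω ≤ 1) :
    ∫ ω, ξ ω * jmp z α (WW X ω) (v ω) ∂μ ≤ 768 * CE * Real.exp (-z / 4) * ∫ ω, ξ ω * v ω ∂μ := by
  have hCE := CE_ge
  have bM : BM (F (NB D 2 i)) (fun ω => min 1 (v ω / α)) := bv.comp (g := fun s => min 1 (s / α)) (by fun_prop)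
  have hM0 : ∀ ω, 0 ≤ min 1 (v ω / α) := fun ω => le_min zero_le_one (div_nonneg (hv0 ω) hα.le)
  have bξM := hξ.mul bM
  have bx : BM (F (NB D 2 i)) (fun ω => z - v ω) := (BM.const z).sub bv
  have bw : BM (F (NB D 2 i)) (fun ω => α + 2 * v ω) := (BM.const α).add (bv.cmul 2)
  have hc := h.PH_cover i hα (by positivity) (h.conc i hα hα1 hβ hv hαβ) bξM bx bw
    (fun ω => mul_nonneg (h0 ω) (hM0 ω)) (fun ω => by have := hv0 ω; positivity)
  have bx' := h.toTop bx
  have bI : BM (F Set.univ) (fun ω => ind (z - v ω) (z - v ω + (α + 2 * v ω)) (WW X ω)) := bx'.ind (bx'.add (h.toTop bw)) h.bmW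
  have be : BM (F Set.univ) (fun ω => Real.exp ((z - v ω) / 4)) := bx'.comp (g := fun s => Real.exp (s / 4)) (by fun_prop)
  calc ∫ ω, ξ ω * jmp z α (WW X ω) (v ω) ∂μ
      ≤ ∫ ω, (2 * Real.exp (-z / 4)) * (ξ ω * min 1 (v ω / α) * (Real.exp ((z - v ω) / 4) * ind (z - v ω) (z - v ω + (α + 2 * v ω)) (WW X ω))) ∂μ := by
        simp_rw [jmp_eq]
        refine integral_mono (h.int ((h.toTop hξ).mul ((h.toTop bM).mul bI))) (h.int (((h.toTop bξM).mul (be.mul bI)).cmul _)) fun ω => ?_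
        simp only
        have h1 : 1 ≤ 2 * Real.exp (-z / 4) * Real.exp ((z - v ω) / 4) := by
          rw [mul_assoc, ← Real.exp_add]
          have : Real.exp (1/2) * Real.exp (-z / 4 + (z - v ω) / 4) ≥ 1 := by
            rw [← Real.exp_add]; apply Real.one_le_exp; linarith [hv1 ω]
          nlinarith [exp_half_le, Real.exp_pos (-z / 4 + (z - v ω) / 4)]
        have h2 : 0 ≤ ξ ω * min 1 (v ω / α) * ind (z - v ω) (z - v ω + (α + 2 * v ω)) (WW X ω) :=
          mul_nonneg (mul_nonneg (h0 ω) (hM0 ω)) (ind_nonneg _ _ _)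
        have := mul_le_mul_of_nonneg_right h1 h2
        linarith
    _ ≤ (2 * Real.exp (-z / 4)) * (96 * CE * α * ∫ ω, ξ ω * min 1 (v ω / α) * ((α + 2 * v ω) / α + 1) ∂μ) := by
        rw [integral_const_mul]; exact mul_le_mul_of_nonneg_left hc (by positivity)
    _ ≤ (2 * Real.exp (-z / 4)) * (96 * CE * α * ∫ ω, (4 / α) * (ξ ω * v ω) ∂μ) := by
        refine mul_le_mul_of_nonneg_left (mul_le_mul_of_nonneg_left ?_ (by positivity)) (by positivity)
        refine integral_mono (h.int (bξM.mul (bw.comp (g := fun s => s / α + 1) (by fun_prop)))) (h.int ((hξ.mul bv).cmul _)) fun ω => ?_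
        simp only
        have e : (α + 2 * v ω) / α = 1 + 2 * (v ω / α) := by field_simp
        have e2 : 4 / α * (ξ ω * v ω) = ξ ω * (4 * (v ω / α)) := by ring
        rw [e, e2, mul_assoc]
        refine mul_le_mul_of_nonneg_left ?_ (h0 ω)
        have a1 : min 1 (v ω / α) ≤ 1 := min_le_left _ _
        have a2 : min 1 (v ω / α) ≤ v ω / α := min_le_right _ _
        have a3 := div_nonneg (hv0 ω) hα.le
        nlinarith [hM0 ω]
    _ = _ := by rw [integral_const_mul]; field_simp; ring

lemma smooth_jump (h : BF μ F D X β) (i : ι) {α : ℝ} (hα : 0 < α) (hα1 : α ≤ 1)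
    (hβ : β ≤ 1/16) (hv : 1 - β ≤ ∫ ω, WW X ω ^ 2 ∂μ) (hαβ : 96 * β ≤ α) (z : ℝ)
    {ξ v : Ω → ℝ} (hξ : BM (F (NB D 2 i)) ξ) (bv : BM (F (NB D 2 i)) v)
    (h0 : ∀ ω, 0 ≤ ξ ω) (hv0 : ∀ ω, 0 ≤ v ω) (hv1 : ∀ ω, v ω ≤ 1) :
    ∫ ω, ξ ω * (2000 * (Real.exp (-z/4) * Real.exp (|WW X ω|/2)) * v ω + jmp z α (WW X ω) (v ω)) ∂μ ≤
      2768 * CE * Real.exp (-z / 4) * ∫ ω, ξ ω * v ω ∂μ := by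
  have hξ' := h.toTop hξ
  have bv' := h.toTop bv
  have bE : BM (F Set.univ) (fun ω => Real.exp (|WW X ω|/2)) := h.bmW.comp (g := fun s => Real.exp (|s|/2)) (by fun_prop)
  have h1 := h.locE' i (hξ.mul bv) (fun ω => mul_nonneg (h0 ω) (hv0 ω)) (bE.cmul (2000 * Real.exp (-z/4))) (2000 * Real.exp (-z/4))
    (fun ω => mul_le_mul_of_nonneg_left (Real.exp_le_exp.2 (by linarith [abs_nonneg (WW X ω)])) (by positivity)) (by positivity)
  have h2 := h.jump_bound i hα hα1 hβ hv hαβ z hξ bv h0 hv0 hv1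
  have bM : BM (F Set.univ) (fun ω => min 1 (v ω / α)) := bv'.comp (g := fun s => min 1 (s / α)) (by fun_prop)
  have bx : BM (F Set.univ) (fun ω => z - v ω) := (BM.const z).sub bv'
  have bJ : BM (F Set.univ) (fun ω => jmp z α (WW X ω) (v ω)) := by
    simp_rw [jmp_eq]
    exact bM.mul (bx.ind (bx.add ((BM.const α).add (bv'.cmul 2))) h.bmW)
  have e : ∀ ω, ξ ω * (2000 * (Real.exp (-z/4) * Real.exp (|WW X ω|/2)) * v ω + jmp z α (WW X ω) (v ω)) =
      ξ ω * v ω * (2000 * Real.exp (-z/4) * Real.exp (|WW X ω|/2)) + ξ ω * jmp z α (WW X ω) (v ω) := fun ω => by ring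
  simp_rw [e]
  rw [integral_add (h.int ((hξ'.mul bv').mul (bE.cmul _))) (h.int (hξ'.mul bJ))]
  linarith

end BF
end
end BE

namespace BE
section
variable {Ω ι : Type*} [mΩ : MeasurableSpace Ω] {μ : Measure Ω} [IsProbabilityMeasure μ] [Fintype ι]
  {F : Set ι → MeasurableSpace Ω} {D : ι → ι → ℕ} {X : ι → Ω → ℝ} {β : ℝ}
namespace BF

lemma bJ (h : BF μ F D X β) (z α : ℝ) {v : Ω → ℝ} (bv' : BM (F Set.univ) v) :
    BM (F Set.univ) (fun ω => 2000 * (Real.exp (-z/4) * Real.exp (|WW X ω|/2)) * v ω + jmp z α (WW X ω) (v ω)) := by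
  have bM : BM (F Set.univ) (fun ω => min 1 (v ω / α)) := bv'.comp (g := fun s => min 1 (s / α)) (by fun_prop)
  have bx : BM (F Set.univ) (fun ω => z - v ω) := (BM.const z).sub bv'
  have bJ : BM (F Set.univ) (fun ω => jmp z α (WW X ω) (v ω)) := by
    simp_rw [jmp_eq]
    exact bM.mul (bx.ind (bx.add ((BM.const α).add (bv'.cmul 2))) h.bmW)
  have bE : BM (F Set.univ) (fun ω => Real.exp (|WW X ω|/2)) := h.bmW.comp (g := fun s => Real.exp (|s|/2)) (by fun_prop)
  exact (((bE.cmul _).cmul _).mul bv').add bJ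

lemma stein_term (h : BF μ F D X β) (i : ι) {α : ℝ} (hα : 0 < α) (hα1 : α ≤ 1)
    (hβ : β ≤ 1/16) (hv : 1 - β ≤ ∫ ω, WW X ω ^ 2 ∂μ) (hαβ : 96 * β ≤ α) {z : ℝ} (hz : -1 ≤ z) :
    |(∫ ω, X i ω * sf z α (WW X ω) ∂μ) - (∫ ω, X i ω * Vs X D 1 i ω ∂μ) * ∫ ω, sf' z α (WW X ω) ∂μ| ≤
      8304 * CE * Real.exp (-z / 4) * ∫ ω, Sb X D i ω ^ 3 ∂μ := by
  have hCE := CE_ge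
  have bX : BM (F Set.univ) (X i) := h.bm (Set.mem_univ i)
  have bY := h.toTop (h.bmVs 1 i)
  have bV := h.toTop (h.bmVs 2 i)
  have bS := h.bmSb i
  set Y := Vs X D 1 i with hY
  set V := Vs X D 2 i with hV
  set c := ∫ ω, X i ω * Y ω ∂μ with hc
  have bX1 : BM (F (NB D 1 i)) (X i) := h.bm (h.self_mem 1 i)
  have bXY : BM (F (NB D 1 i)) (fun ω => X i ω * Y ω) := bX1.mul (h.bmVs 1 i)
  have hYS : ∀ ω, |Y ω| ≤ Sb X D i ω := Vs_le_Sb X D 1 (by norm_num) i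
  have hVS : ∀ ω, |V ω| ≤ Sb X D i ω := Vs_le_Sb X D 2 (by norm_num) i
  have hXS : ∀ ω, |X i ω| ≤ Sb X D i ω := h.X_le_Sb i i (by simp [h.self])
  have bz : BM (F (NB D 1 i)) (fun ω => X i ω * Y ω - c) := bXY.sub (BM.const c)
  have bz' := h.toTop bz
  have bf : BM (F Set.univ) (fun ω => sf z α (WW X ω)) := h.bmW.comp (sf_cont z α)
  have bf' : BM (F Set.univ) (fun ω => sf' z α (WW X ω)) := h.bmW.comp (sf'_cont z α)
  have bf1 : BM (F (FB D 1 i)) (fun ω => sf z α (Wf X D 1 i ω)) := (h.bmWf 1 i).comp (sf_cont z α)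
  have bf2 : BM (F (FB D 2 i)) (fun ω => sf' z α (Wf X D 2 i ω)) := (h.bmWf 2 i).comp (sf'_cont z α)
  have e1 : ∫ ω, X i ω * sf z α (Wf X D 1 i ω) ∂μ = 0 := h.X_indep i bf1
  have e2 : ∫ ω, (X i ω * Y ω - c) * sf' z α (Wf X D 2 i ω) ∂μ = 0 := by
    rw [h.imul (h.sepNF 1 i) bz bf2, integral_sub (h.int bXY) (h.int (BM.const (m := F Set.univ) c))]
    simp [hc]
  have i1 := h.int (bX.mul (h.toTop bf1))
  have i2 := h.int (bz'.mul (h.toTop bf2))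
  have eq : (∫ ω, X i ω * sf z α (WW X ω) ∂μ) - c * ∫ ω, sf' z α (WW X ω) ∂μ =
      ∫ ω, (X i ω * sf z α (WW X ω) - c * sf' z α (WW X ω) - X i ω * sf z α (Wf X D 1 i ω)
        - (X i ω * Y ω - c) * sf' z α (Wf X D 2 i ω)) ∂μ := by
    have b12 := (bX.mul bf).sub (bf'.cmul c)
    rw [integral_sub (h.int (b12.sub (bX.mul (h.toTop bf1)))) i2,
      integral_sub (h.int b12) i1,
      integral_sub (h.int (bX.mul bf)) (h.int (bf'.cmul c)), e1, e2, integral_const_mul]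
    ring
  have s1 := h.smooth_jump i hα hα1 hβ hv hαβ z (ξ := fun ω => |X i ω| * |Y ω|) (v := fun ω => |Y ω|)
    (h.bmNB (by norm_num) i (bX1.abs.mul (h.bmVs 1 i).abs)) (h.bmNB (by norm_num) i (h.bmVs 1 i).abs)
    (fun ω => by positivity) (fun ω => abs_nonneg _) (fun ω => (hYS ω).trans (h.bdd i ω))
  have s2 := h.smooth_jump i hα hα1 hβ hv hαβ z (ξ := fun ω => |X i ω * Y ω - c|) (v := fun ω => |V ω|)
    (h.bmNB (by norm_num) i bz.abs) (h.bmVs 2 i).abs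
    (fun ω => by positivity) (fun ω => abs_nonneg _) (fun ω => (hVS ω).trans (h.bdd i ω))
  have t1 : ∫ ω, |X i ω| * |Y ω| * |Y ω| ∂μ ≤ ∫ ω, Sb X D i ω ^ 3 ∂μ := by
    refine integral_mono (h.int ((bX.abs.mul bY.abs).mul bY.abs)) (h.int (bS.pow 3)) fun ω => ?_
    have := Sb_nonneg X D i ω
    calc |X i ω| * |Y ω| * |Y ω| ≤ Sb X D i ω * Sb X D i ω * Sb X D i ω := by
          gcongr <;> first | exact hXS ω | exact hYS ω
      _ = _ := by ring
  have t2 := h.zeta_dom i (U := fun ω => X i ω * Y ω) (V := V) (h.toTop bXY) bV (fun ω => by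
    rw [abs_mul, sq]; exact mul_le_mul (hXS ω) (hYS ω) (abs_nonneg _) (Sb_nonneg X D i ω)) hVS
  have bJ1 := (bX.abs.mul bY.abs).mul (h.bJ z α bY.abs)
  have bJ2 := bz'.abs.mul (h.bJ z α bV.abs)
  rw [eq]
  refine abs_integral_le_integral_abs.trans ?_
  have key := integral_mono (μ := μ) (h.int ((((bX.mul bf).sub (bf'.cmul c)).sub (bX.mul (h.toTop bf1))).sub (bz'.mul (h.toTop bf2))).abs)
    (h.int (bJ1.add bJ2)) (fun ω => by
    simp only
    have w1 : Wf X D 1 i ω = WW X ω - Y ω := by rw [W_split X D 1 i ω]; ring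
    have w2 : Wf X D 2 i ω = WW X ω - V ω := by rw [W_split X D 2 i ω]; ring
    have a1 := sf_taylor hz hα (WW X ω) (Y ω) |Y ω| le_rfl ((hYS ω).trans (h.bdd i ω))
    have a2 := sf'_lip hz hα (WW X ω) (V ω) |V ω| le_rfl ((hVS ω).trans (h.bdd i ω))
    rw [w1, w2]
    have : X i ω * sf z α (WW X ω) - c * sf' z α (WW X ω) - X i ω * sf z α (WW X ω - Y ω)
        - (X i ω * Y ω - c) * sf' z α (WW X ω - V ω) =
        X i ω * (sf z α (WW X ω) - sf z α (WW X ω - Y ω) - Y ω * sf' z α (WW X ω)) +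
        (X i ω * Y ω - c) * (sf' z α (WW X ω) - sf' z α (WW X ω - V ω)) := by ring
    rw [this]
    refine (abs_add_le _ _).trans ?_
    rw [abs_mul, abs_mul (X i ω * Y ω - c), mul_assoc |X i ω|]
    exact add_le_add (mul_le_mul_of_nonneg_left a1 (abs_nonneg _)) (mul_le_mul_of_nonneg_left a2 (abs_nonneg _)))
  refine key.trans ?_
  rw [integral_add (h.int bJ1) (h.int bJ2)]
  have hp : 0 ≤ 2768 * CE * Real.exp (-z/4) := by positivity
  have := mul_le_mul_of_nonneg_left t1 hp
  have := mul_le_mul_of_nonneg_left t2 hp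
  linarith

lemma bounded_smooth (h : BF μ F D X β) {α : ℝ} (hα : 0 < α) (hα1 : α ≤ 1)
    (hβ : β ≤ 1/16) (hv : |(∫ ω, WW X ω ^ 2 ∂μ) - 1| ≤ β) (hαβ : 96 * β ≤ α) {z : ℝ} (hz : -1 ≤ z) :
    |(∫ ω, hh z α (WW X ω) ∂μ) - Nh z α| ≤ 10000 * CE * β * Real.exp (-z / 4) := by
  have hCE := CE_ge
  have hβ0 := h.beta_nonneg
  have hv' : 1 - β ≤ ∫ ω, WW X ω ^ 2 ∂μ := by linarith [(abs_le.1 hv).1]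
  have bf : BM (F Set.univ) (fun ω => sf z α (WW X ω)) := h.bmW.comp (sf_cont z α)
  have bf' : BM (F Set.univ) (fun ω => sf' z α (WW X ω)) := h.bmW.comp (sf'_cont z α)
  have bh : BM (F Set.univ) (fun ω => hh z α (WW X ω)) := h.bmW.comp (hh_cont z α)
  set M := ∫ ω, sf' z α (WW X ω) ∂μ with hM
  have e0 : M = (∫ ω, WW X ω * sf z α (WW X ω) ∂μ) + ((∫ ω, hh z α (WW X ω) ∂μ) - Nh z α) := by
    rw [hM]; unfold sf'
    rw [integral_add (h.int (h.bmW.mul bf)) (h.int (bh.sub (BM.const _))), integral_sub (h.int bh) (h.int (BM.const (m := F Set.univ) _))]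
    simp
  have e1 : ∫ ω, WW X ω * sf z α (WW X ω) ∂μ = ∑ i, ∫ ω, X i ω * sf z α (WW X ω) ∂μ := by
    rw [← integral_finsetSum _ (fun i _ => h.int ((h.bm (Set.mem_univ i)).mul bf))]
    congr 1; ext ω; rw [← Finset.sum_mul]; rfl
  have e2 := h.sum_XY
  have hs : |∑ i, ((∫ ω, X i ω * sf z α (WW X ω) ∂μ) - (∫ ω, X i ω * Vs X D 1 i ω ∂μ) * M)| ≤ 8304 * CE * Real.exp (-z / 4) * β := by
    refine (Finset.abs_sum_le_sum_abs _ _).trans ?_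
    refine (Finset.sum_le_sum fun i _ => h.stein_term i hα hα1 hβ hv' hαβ hz).trans ?_
    rw [← Finset.mul_sum]
    exact mul_le_mul_of_nonneg_left h.third (by positivity)
  rw [Finset.sum_sub_distrib, ← e1, ← Finset.sum_mul, e2] at hs
  have hMb : |M| ≤ 1000 * Real.exp (-z/4) * CE := by
    refine abs_integral_le_integral_abs.trans ?_
    have bE : BM (F Set.univ) (fun ω => Real.exp |WW X ω|) := h.bmW.abs.exp
    refine (integral_mono (h.int bf'.abs) (h.int (bE.cmul (1000 * Real.exp (-z/4)))) fun ω => ?_).trans ?_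
    · refine (sf'_bound (WW X ω) hz hα).trans ?_
      rw [← mul_assoc]
      refine mul_le_mul_of_nonneg_left (Real.exp_le_exp.2 (by linarith [abs_nonneg (WW X ω)])) (by positivity)
    · rw [integral_const_mul]; exact mul_le_mul_of_nonneg_left h.expE (by positivity)
  have hm : |((∫ ω, WW X ω ^ 2 ∂μ) - 1) * M| ≤ β * (1000 * Real.exp (-z/4) * CE) := by
    rw [abs_mul]; exact mul_le_mul hv hMb (abs_nonneg _) hβ0
  have hp : 0 ≤ CE * β * Real.exp (-z/4) := by positivity
  rw [abs_le] at *
  constructor <;> nlinarith [hs.1, hs.2, hm.1, hm.2]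

lemma bounded_thm (h : BF μ F D X β) (hβ0 : 0 < β) (hβ : β ≤ 1/192) (hv : |(∫ ω, WW X ω ^ 2 ∂μ) - 1| ≤ β)
    {z : ℝ} (hz : -(1/2) ≤ z) {E : Set ℝ} (hE : MeasurableSet E) (h1 : Set.Iio z ⊆ E) (h2 : E ⊆ Set.Iic z) :
    |μ.real (WW X ⁻¹' E) - stdGaussianCDF z| ≤ 21000 * CE * β * Real.exp (-z / 4) := by
  have hCE := CE_ge
  set α := 96 * β with hα
  have hα0 : 0 < α := by positivity
  have hα1 : α ≤ 1/2 := by linarith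
  have bh : ∀ z, BM (F Set.univ) (fun ω => hh z α (WW X ω)) := fun z => h.bmW.comp (hh_cont z α)
  have mW : Measurable (WW X) := h.bmW.1.mono (h.le _) le_rfl
  have mE : MeasurableSet (WW X ⁻¹' E) := mW hE
  have i1 : Integrable ((WW X ⁻¹' E).indicator (fun _ => (1:ℝ))) μ := (integrable_const 1).indicator mE
  have r1 : μ.real (WW X ⁻¹' E) = ∫ ω, (WW X ⁻¹' E).indicator (fun _ => (1:ℝ)) ω ∂μ := by
    rw [integral_indicator mE]; simp
  have u : μ.real (WW X ⁻¹' E) ≤ ∫ ω, hh z α (WW X ω) ∂μ := by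
    rw [r1]
    refine integral_mono i1 (h.int (bh z)) fun ω => ?_
    by_cases hω : WW X ω ∈ E
    · simp [Set.indicator, hω, hh_one hα0 (h2 hω)]
    · simp [Set.indicator, hω, hh_nonneg]
  have l : ∫ ω, hh (z - α) α (WW X ω) ∂μ ≤ μ.real (WW X ⁻¹' E) := by
    rw [r1]
    refine integral_mono (h.int (bh _)) i1 fun ω => ?_
    by_cases hω : WW X ω ∈ E
    · simp [Set.indicator, hω, hh_le_one]
    · have : z ≤ WW X ω := by by_contra hc; exact hω (h1 (not_le.1 hc))
      simp [Set.indicator, hω, hh_zero hα0 (show z - α + α ≤ WW X ω by linarith)]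
  have b1 := abs_le.1 (h.bounded_smooth hα0 (by linarith) (by linarith) hv le_rfl (z := z) (by linarith))
  have b2 := abs_le.1 (h.bounded_smooth hα0 (by linarith) (by linarith) hv le_rfl (z := z - α) (by linarith))
  have n1 := Nh_upper (z := z) hα0
  have n2 := Nh_lower (z := z - α) hα0
  have c1 := cdf_incr z α hα0.le
  have c2 := cdf_incr (z - α) α hα0.le
  rw [sub_add_cancel] at c2
  have e : Real.exp (-(z - α)/4) ≤ 2 * Real.exp (-z/4) := by
    rw [show -(z - α)/4 = α/4 + -z/4 by ring, Real.exp_add]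
    refine mul_le_mul_of_nonneg_right ((Real.exp_le_exp.2 ?_).trans exp_half_le) (Real.exp_pos _).le
    linarith
  have hp : 0 < Real.exp (-z/4) := Real.exp_pos _
  have q1 : 10000 * CE * β * Real.exp (-(z - α)/4) ≤ 10000 * CE * β * (2 * Real.exp (-z/4)) := mul_le_mul_of_nonneg_left e (by positivity)
  have q2 : α * Real.exp (-(z - α)/4) ≤ α * (2 * Real.exp (-z/4)) := mul_le_mul_of_nonneg_left e hα0.le
  have q3 : 2 * (β * Real.exp (-z/4)) ≤ CE * (β * Real.exp (-z/4)) := mul_le_mul_of_nonneg_right hCE (by positivity)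
  rw [abs_le]
  constructor <;> nlinarith

end BF
end
end BE

namespace BE
section
variable {Ω ι : Type*} [mΩ : MeasurableSpace Ω] {μ : Measure Ω} [IsProbabilityMeasure μ] [Fintype ι]
  {F : Set ι → MeasurableSpace Ω} {D : ι → ι → ℕ} {X : ι → Ω → ℝ} {p L : ℝ}

structure PF (μ : Measure Ω) (F : Set ι → MeasurableSpace Ω) (D : ι → ι → ℕ) (X : ι → Ω → ℝ)
    (p L : ℝ) : Prop extends Fld μ F D where
  meas : ∀ i, Measurable[F {i}] (X i)
  mean : ∀ i, ∫ ω, X i ω ∂μ = 0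
  mom : ∀ i, Integrable (fun ω => |X i ω| ^ p) μ
  hp2 : 2 < p
  hp3 : p ≤ 3
  hL : 1 ≤ L
  card : ∀ i, ((Finset.univ.filter (fun j => D i j ≤ 9)).card : ℝ) ≤ L

/-- truncation -/
noncomputable def tr (L x : ℝ) : ℝ := if |x| ≤ 1 / (2 * L) then x else 0
/-- large indicator -/
noncomputable def lg (L x : ℝ) : ℝ := if |x| ≤ 1 / (2 * L) then 0 else 1

lemma tr_meas (L : ℝ) : Measurable (tr L) := by
  unfold tr; exact Measurable.ite (measurableSet_le (by fun_prop) (by fun_prop)) measurable_id measurable_const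
lemma lg_meas (L : ℝ) : Measurable (lg L) := by
  unfold lg; exact Measurable.ite (measurableSet_le (by fun_prop) (by fun_prop)) measurable_const measurable_const
lemma tr_abs (hL : 1 ≤ L) (x : ℝ) : |tr L x| ≤ 1 / (2 * L) := by
  unfold tr; split_ifs with h
  · exact h
  · simp; linarith
lemma tr_le (L x : ℝ) : |tr L x| ≤ |x| := by
  unfold tr; split_ifs with h <;> simp
lemma lg_nonneg (L x : ℝ) : 0 ≤ lg L x := by unfold lg; split_ifs <;> norm_num
lemma lg_le_one (L x : ℝ) : lg L x ≤ 1 := by unfold lg; split_ifs <;> norm_num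

lemma big_one (hL : 1 ≤ L) {x : ℝ} (h : ¬ |x| ≤ 1 / (2 * L)) : 1 ≤ 2 * L * |x| := by
  have := (not_le.1 h).le
  rw [div_le_iff₀ (by positivity)] at this; linarith

lemma lg_le_Z (hL : 1 ≤ L) (hp : 2 < p) (x : ℝ) : lg L x ≤ (2 * L * |x|) ^ p := by
  unfold lg; split_ifs with h
  · positivity
  · exact Real.one_le_rpow (big_one hL h) (by linarith)

lemma R_le_Z (hL : 1 ≤ L) (hp : 2 < p) (x : ℝ) : 2 * L * |x - tr L x| ≤ (2 * L * |x|) ^ p := by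
  unfold tr; split_ifs with h
  · simp; positivity
  · rw [sub_zero]
    exact Real.self_le_rpow_of_one_le (big_one hL h) (by linarith)

lemma R2_le_Z (hL : 1 ≤ L) (hp : 2 < p) (x : ℝ) : 4 * L ^ 2 * (x - tr L x) ^ 2 ≤ (2 * L * |x|) ^ p := by
  unfold tr; split_ifs with h
  · simp; positivity
  · rw [sub_zero, ← sq_abs x, show 4 * L ^ 2 * |x| ^ 2 = (2 * L * |x|) ^ (2:ℝ) by norm_cast; ring]
    exact Real.rpow_le_rpow_of_exponent_le (big_one hL h) hp.le

lemma T3_le_Z (hL : 1 ≤ L) (hp : 2 < p) (hp3 : p ≤ 3) (x : ℝ) : L ^ 3 * |tr L x| ^ 3 ≤ (2 * L * |x|) ^ p := by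
  have h1 := tr_abs hL x
  have h0 : 0 ≤ L * |tr L x| := by positivity
  have h2 : L * |tr L x| ≤ 1 := by
    rw [le_div_iff₀ (by positivity)] at h1; nlinarith
  calc L ^ 3 * |tr L x| ^ 3 = (L * |tr L x|) ^ (3:ℝ) := by norm_cast; ring
    _ ≤ (L * |tr L x|) ^ p := Real.rpow_le_rpow_of_exponent_ge_of_imp h0 h2 hp3 (by intro _ h; linarith)
    _ ≤ _ := Real.rpow_le_rpow h0 (by have := tr_le L x; nlinarith [abs_nonneg x, abs_nonneg (tr L x)]) (by linarith)

noncomputable def bb (μ : Measure Ω) (X : ι → Ω → ℝ) (p L : ℝ) : ℝ := ∑ i, ∫ ω, (2 * L * |X i ω|) ^ p ∂μ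

noncomputable def XB (μ : Measure Ω) (X : ι → Ω → ℝ) (L : ℝ) (i : ι) (ω : Ω) : ℝ := tr L (X i ω) - ∫ ω', tr L (X i ω') ∂μ

lemma psum {ι : Type*} (s : Finset ι) {p L : ℝ} (hp : 1 ≤ p) (hc : (s.card : ℝ) ≤ L) (f : ι → ℝ) :
    |∑ i ∈ s, f i| ^ p ≤ L ^ (p - 1) * ∑ i ∈ s, |f i| ^ p := by
  calc |∑ i ∈ s, f i| ^ p ≤ (∑ i ∈ s, |f i|) ^ p := Real.rpow_le_rpow (abs_nonneg _) (Finset.abs_sum_le_sum_abs _ _) (by linarith)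
    _ ≤ (s.card : ℝ) ^ (p - 1) * ∑ i ∈ s, |f i| ^ p := Real.rpow_sum_le_const_mul_sum_rpow s f hp
    _ ≤ _ := mul_le_mul_of_nonneg_right (Real.rpow_le_rpow (by positivity) hc (by linarith)) (Finset.sum_nonneg fun _ _ => by positivity)

lemma inner_le_cube {ι : Type*} (s : Finset ι) (f : ι → ℝ) (hf : ∀ i ∈ s, 0 ≤ f i) :
    (∑ i ∈ s, f i) ^ 3 ≤ (s.card : ℝ) ^ 2 * ∑ i ∈ s, f i ^ 3 :=
  pow_sum_le_card_mul_sum_pow hf 2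

namespace PF

lemma mX (h : PF μ F D X p L) (i : ι) : Measurable (X i) := (h.meas i).mono (h.le _) le_rfl

lemma mW (h : PF μ F D X p L) : Measurable (WW X) := by
  unfold WW; exact Finset.measurable_sum _ fun i _ => h.mX i

lemma Zint (h : PF μ F D X p L) (i : ι) : Integrable (fun ω => (2 * L * |X i ω|) ^ p) μ := by
  have hL := h.hL
  have : ∀ ω, (2 * L * |X i ω|) ^ p = (2 * L) ^ p * |X i ω| ^ p := fun ω => Real.mul_rpow (by positivity) (abs_nonneg _)
  simp_rw [this]
  exact (h.mom i).const_mul _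

lemma EZ_nonneg (h : PF μ F D X p L) (i : ι) : 0 ≤ ∫ ω, (2 * L * |X i ω|) ^ p ∂μ := by
  have hL := h.hL
  exact integral_nonneg fun ω => by positivity

lemma bb_nonneg (h : PF μ F D X p L) : 0 ≤ bb μ X p L := Finset.sum_nonneg fun i _ => h.EZ_nonneg i

lemma bb_le (h : PF μ F D X p L) : bb μ X p L ≤ 8 * (L ^ p * ∑ i, ∫ ω, |X i ω| ^ p ∂μ) := by
  have hL := h.hL
  have e : ∀ i, ∫ ω, (2 * L * |X i ω|) ^ p ∂μ = (2 * L) ^ p * ∫ ω, |X i ω| ^ p ∂μ := fun i => by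
    rw [← integral_const_mul]; congr 1; ext ω; exact Real.mul_rpow (by positivity) (abs_nonneg _)
  unfold bb
  simp_rw [e]
  rw [← Finset.mul_sum, Real.mul_rpow (by norm_num) (by positivity), mul_assoc]
  refine mul_le_mul_of_nonneg_right ?_ (by
    have := Finset.sum_nonneg fun i (_ : i ∈ Finset.univ) => integral_nonneg (μ := μ) (f := fun ω => |X i ω| ^ p) fun ω => by positivity
    positivity)
  calc (2:ℝ) ^ p ≤ 2 ^ (3:ℝ) := Real.rpow_le_rpow_of_exponent_le (by norm_num) h.hp3
    _ = 8 := by norm_num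

lemma mean_X_memLp (h : PF μ F D X p L) (i : ι) : MemLp (X i) (ENNReal.ofReal p) μ := by
  have hp := h.hp2
  rw [← integrable_norm_rpow_iff (h.mX i).aestronglyMeasurable (by simp; linarith) (by simp)]
  rw [ENNReal.toReal_ofReal (by linarith)]
  exact h.mom i

lemma memLp2 (h : PF μ F D X p L) (i : ι) : MemLp (X i) 2 μ := by
  refine (h.mean_X_memLp i).mono_exponent ?_
  rw [show (2:ENNReal) = ENNReal.ofReal 2 by simp]
  exact ENNReal.ofReal_le_ofReal h.hp2.le

lemma Xint (h : PF μ F D X p L) (i : ι) : Integrable (X i) μ := (h.memLp2 i).integrable (by norm_num)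

lemma XXint (h : PF μ F D X p L) (i j : ι) : Integrable (fun ω => X i ω * X j ω) μ :=
  (h.memLp2 i).integrable_mul (h.memLp2 j)

lemma Wp_int (h : PF μ F D X p L) : Integrable (fun ω => |WW X ω| ^ p) μ := by
  have hp := h.hp2
  have : MemLp (WW X) (ENNReal.ofReal p) μ := by
    unfold WW; exact memLp_finsetSum _ fun i _ => h.mean_X_memLp i
  have := this.integrable_norm_rpow (by simp; linarith) (by simp)
  rwa [ENNReal.toReal_ofReal (by linarith)] at this

lemma card_le (h : PF μ F D X p L) (r : ℕ) (hr : r ≤ 9) (i : ι) : ((Finset.univ.filter (fun j => D i j ≤ r)).card : ℝ) ≤ L := by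
  refine le_trans ?_ (h.card i)
  exact_mod_cast Finset.card_le_card fun j hj => by
    simp only [Finset.mem_filter, Finset.mem_univ, true_and] at hj ⊢; omega

lemma sum_swap (h : PF μ F D X p L) (r : ℕ) (hr : r ≤ 9) (g : ι → ℝ) (hg : ∀ i, 0 ≤ g i) :
    ∑ i, ∑ j with D i j ≤ r, g j ≤ L * ∑ j, g j := by
  simp_rw [Finset.sum_filter]
  rw [Finset.sum_comm, Finset.mul_sum]
  refine Finset.sum_le_sum fun j _ => ?_
  simp_rw [h.symm _ j]
  rw [← Finset.sum_filter, Finset.sum_const, nsmul_eq_mul]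
  exact mul_le_mul_of_nonneg_right (h.card_le r hr j) (hg j)

lemma sum_const (h : PF μ F D X p L) (r : ℕ) (hr : r ≤ 9) (g : ι → ℝ) (hg : ∀ i, 0 ≤ g i) :
    ∑ i, ∑ j with D i j ≤ r, g i ≤ L * ∑ j, g j := by
  rw [Finset.mul_sum]
  refine Finset.sum_le_sum fun j _ => ?_
  rw [Finset.sum_const, nsmul_eq_mul]
  exact mul_le_mul_of_nonneg_right (h.card_le r hr j) (hg j)

lemma bmT (h : PF μ F D X p L) (i : ι) : BM (F {i}) (fun ω => tr L (X i ω)) :=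
  ⟨(tr_meas L).comp (h.meas i), _, fun ω => tr_abs h.hL _⟩
lemma bmlg (h : PF μ F D X p L) (i : ι) : BM (F {i}) (fun ω => lg L (X i ω)) :=
  ⟨(lg_meas L).comp (h.meas i), 1, fun ω => by rw [abs_of_nonneg (lg_nonneg _ _)]; exact lg_le_one _ _⟩
lemma bmXB (h : PF μ F D X p L) (i : ι) : BM (F {i}) (XB μ X L i) := (h.bmT i).sub (BM.const _)
lemma int (h : PF μ F D X p L) {S : Set ι} {U : Ω → ℝ} (hU : BM (F S) U) : Integrable U μ := hU.integrable (h.le S)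

lemma XB_mean (h : PF μ F D X p L) (i : ι) : ∫ ω, XB μ X L i ω ∂μ = 0 := by
  unfold XB
  rw [integral_sub (h.int (h.bmT i)) (integrable_const _)]; simp

lemma ET_le (h : PF μ F D X p L) (i : ι) : |∫ ω, tr L (X i ω) ∂μ| ≤ 1 / (2 * L) := by
  have := norm_integral_le_of_norm_le_const (μ := μ) (f := fun ω => tr L (X i ω)) (C := 1/(2*L))
    (Filter.Eventually.of_forall fun ω => tr_abs h.hL _)
  simpa using this

lemma XB_le (h : PF μ F D X p L) (i : ι) (ω : Ω) : |XB μ X L i ω| ≤ 1 / L := by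
  have h1 := tr_abs h.hL (X i ω)
  have h2 := h.ET_le i
  have e : 1 / L = 1 / (2 * L) + 1 / (2 * L) := by have := h.hL; field_simp; norm_num
  rw [e]; exact (abs_sub _ _).trans (add_le_add h1 h2)

lemma ET_R (h : PF μ F D X p L) (i : ι) : ∫ ω, (X i ω - tr L (X i ω)) ∂μ = - ∫ ω, tr L (X i ω) ∂μ := by
  rw [integral_sub (h.Xint i) (h.int (h.bmT i)), h.mean i, zero_sub]

lemma Rint (h : PF μ F D X p L) (i : ι) : Integrable (fun ω => X i ω - tr L (X i ω)) μ := (h.Xint i).sub (h.int (h.bmT i))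

lemma ER_le (h : PF μ F D X p L) (i : ι) : 2 * L * |∫ ω, tr L (X i ω) ∂μ| ≤ ∫ ω, (2 * L * |X i ω|) ^ p ∂μ := by
  have hL := h.hL
  rw [← abs_neg, ← h.ET_R i]
  calc 2 * L * |∫ ω, (X i ω - tr L (X i ω)) ∂μ| ≤ 2 * L * ∫ ω, |X i ω - tr L (X i ω)| ∂μ :=
        mul_le_mul_of_nonneg_left abs_integral_le_integral_abs (by positivity)
    _ = ∫ ω, 2 * L * |X i ω - tr L (X i ω)| ∂μ := (integral_const_mul _ _).symm
    _ ≤ _ := integral_mono ((h.Rint i).abs.const_mul _) (h.Zint i) fun ω => R_le_Z hL h.hp2 _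

lemma lgE (h : PF μ F D X p L) (i : ι) : ∫ ω, lg L (X i ω) ∂μ ≤ ∫ ω, (2 * L * |X i ω|) ^ p ∂μ :=
  integral_mono (h.int (h.bmlg i)) (h.Zint i) fun ω => lg_le_Z h.hL h.hp2 _

lemma shift_le (h : PF μ F D X p L) : |∑ i, ∫ ω, tr L (X i ω) ∂μ| ≤ bb μ X p L := by
  have hL := h.hL
  refine (Finset.abs_sum_le_sum_abs _ _).trans (Finset.sum_le_sum fun i _ => ?_)
  refine le_trans ?_ (h.ER_le i)
  nlinarith [abs_nonneg (∫ ω, tr L (X i ω) ∂μ)]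

lemma cube_jensen (h : PF μ F D X p L) {S : Set ι} {U : Ω → ℝ} (hU : BM (F S) U) : |∫ ω, U ω ∂μ| ^ 3 ≤ ∫ ω, |U ω| ^ 3 ∂μ := by
  set c := ∫ ω, |U ω| ∂μ with hc
  have hc0 : 0 ≤ c := integral_nonneg fun ω => abs_nonneg _
  have h1 : |∫ ω, U ω ∂μ| ^ 3 ≤ c ^ 3 := pow_le_pow_left₀ (abs_nonneg _) abs_integral_le_integral_abs 3
  have h0 : 0 ≤ ∫ ω, (|U ω| ^ 3 - (3 * c ^ 2 * |U ω| - 2 * c ^ 3)) ∂μ := integral_nonneg fun ω => by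
    have := abs_nonneg (U ω)
    have : 0 ≤ (|U ω| - c) ^ 2 * (|U ω| + 2 * c) := by positivity
    simp only [Pi.zero_apply]; nlinarith
  rw [integral_sub (h.int (hU.abs.pow 3)) (h.int ((hU.abs.cmul _).sub (BM.const _))),
    integral_sub (h.int (hU.abs.cmul _)) (integrable_const _), integral_const_mul, ← hc] at h0
  simp at h0
  nlinarith

lemma XB3 (h : PF μ F D X p L) (i : ι) : L ^ 3 * ∫ ω, |XB μ X L i ω| ^ 3 ∂μ ≤ 8 * ∫ ω, (2 * L * |X i ω|) ^ p ∂μ := by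
  have hL := h.hL
  have bT := h.bmT i
  set c := ∫ ω, tr L (X i ω) ∂μ with hc
  have s1 : ∫ ω, |XB μ X L i ω| ^ 3 ∂μ ≤ ∫ ω, (4 * |tr L (X i ω)| ^ 3 + 4 * |c| ^ 3) ∂μ := by
    refine integral_mono (h.int ((h.bmXB i).abs.pow 3)) (h.int (((bT.abs.pow 3).cmul 4).add (BM.const _))) fun ω => ?_
    have : |XB μ X L i ω| ≤ |tr L (X i ω)| + |c| := abs_sub _ _
    have h2 := pow_le_pow_left₀ (abs_nonneg _) this 3
    have a := abs_nonneg (tr L (X i ω)); have b := abs_nonneg c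
    simp only
    have : 0 ≤ (|tr L (X i ω)| - |c|) ^ 2 * (|tr L (X i ω)| + |c|) := by positivity
    nlinarith
  rw [integral_add (h.int ((bT.abs.pow 3).cmul 4)) (integrable_const _), integral_const_mul] at s1
  have s2 := h.cube_jensen bT
  rw [← hc] at s2
  have s3 : L ^ 3 * ∫ ω, |tr L (X i ω)| ^ 3 ∂μ ≤ ∫ ω, (2 * L * |X i ω|) ^ p ∂μ := by
    rw [← integral_const_mul]
    exact integral_mono (h.int ((bT.abs.pow 3).cmul _)) (h.Zint i) fun ω => T3_le_Z hL h.hp2 h.hp3 _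
  simp at s1
  have : L ^ 3 * ∫ ω, |XB μ X L i ω| ^ 3 ∂μ ≤ L ^ 3 * (8 * ∫ ω, |tr L (X i ω)| ^ 3 ∂μ) :=
    mul_le_mul_of_nonneg_left (by linarith) (by positivity)
  linarith

lemma XB_third (h : PF μ F D X p L) : ∑ i, ∫ ω, Sb (XB μ X L) D i ω ^ 3 ∂μ ≤ 8 * bb μ X p L := by
  have hL := h.hL
  have b3 : ∀ j, Integrable (fun ω => |XB μ X L j ω| ^ 3) μ := fun j => h.int ((h.bmXB j).abs.pow 3)
  have s : ∀ i, ∫ ω, Sb (XB μ X L) D i ω ^ 3 ∂μ ≤ L ^ 2 * ∑ j with D i j ≤ 9, ∫ ω, |XB μ X L j ω| ^ 3 ∂μ := fun i => by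
    rw [← integral_finsetSum _ (fun j _ => b3 j), ← integral_const_mul]
    have bS : BM mΩ (Sb (XB μ X L) D i) := BM.sum _ fun j _ => ((h.bmXB j).mono (h.le _)).abs
    refine integral_mono ((bS.pow 3).integrable le_rfl) ((integrable_finsetSum _ fun j _ => b3 j).const_mul _) fun ω => ?_
    simp only [Sb]
    have := inner_le_cube (Finset.univ.filter (fun j => D i j ≤ 9)) (fun j => |XB μ X L j ω|) (fun j _ => abs_nonneg _)
    refine this.trans (mul_le_mul_of_nonneg_right ?_ (Finset.sum_nonneg fun j _ => by positivity))
    exact pow_le_pow_left₀ (by positivity) (h.card i) 2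
  refine (Finset.sum_le_sum fun i _ => s i).trans ?_
  rw [← Finset.mul_sum]
  have := h.sum_swap 9 le_rfl (fun j => ∫ ω, |XB μ X L j ω| ^ 3 ∂μ) (fun j => integral_nonneg fun ω => by positivity)
  calc L ^ 2 * ∑ i, ∑ j with D i j ≤ 9, ∫ ω, |XB μ X L j ω| ^ 3 ∂μ ≤ L ^ 2 * (L * ∑ j, ∫ ω, |XB μ X L j ω| ^ 3 ∂μ) :=
        mul_le_mul_of_nonneg_left this (by positivity)
    _ = ∑ j, L ^ 3 * ∫ ω, |XB μ X L j ω| ^ 3 ∂μ := by rw [← Finset.mul_sum]; ring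
    _ ≤ ∑ j, 8 * ∫ ω, (2 * L * |X j ω|) ^ p ∂μ := Finset.sum_le_sum fun j _ => h.XB3 j
    _ = _ := by rw [← Finset.mul_sum]; rfl

end PF
end
end BE

namespace BE
section
variable {Ω ι : Type*} [mΩ : MeasurableSpace Ω] {μ : Measure Ω} [IsProbabilityMeasure μ] [Fintype ι]
  {F : Set ι → MeasurableSpace Ω} {D : ι → ι → ℕ} {X : ι → Ω → ℝ} {p L : ℝ}

lemma var_exp {Y : ι → Ω → ℝ} (hi : ∀ i j, Integrable (fun ω => Y i ω * Y j ω) μ)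
    (h0 : ∀ i j, 1 < D i j → ∫ ω, Y i ω * Y j ω ∂μ = 0) :
    ∫ ω, WW Y ω ^ 2 ∂μ = ∑ i, ∑ j with D i j ≤ 1, ∫ ω, Y i ω * Y j ω ∂μ := by
  have e : ∀ ω, WW Y ω ^ 2 = ∑ i, ∑ j, Y i ω * Y j ω := fun ω => by
    unfold WW; rw [sq, Finset.sum_mul_sum]
  simp_rw [e]
  rw [integral_finsetSum _ (fun i _ => integrable_finsetSum _ fun j _ => hi i j)]
  refine Finset.sum_congr rfl fun i _ => ?_
  rw [integral_finsetSum _ (fun j _ => hi i j), Finset.sum_filter]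
  refine Finset.sum_congr rfl fun j _ => ?_
  split_ifs with hd
  · rfl
  · exact h0 i j (not_le.1 hd)

namespace PF

lemma sep (h : PF μ F D X p L) {i j : ι} (hD : 1 < D i j) : Indep (F {i}) (F {j}) μ :=
  h.indep _ _ fun a ha b hb => by simp only [Set.mem_singleton_iff] at ha hb; subst ha; subst hb; exact hD

lemma crossX (h : PF μ F D X p L) (i j : ι) (hD : 1 < D i j) : ∫ ω, X i ω * X j ω ∂μ = 0 := by
  rw [indep_mul (h.sep hD) (h.le _) (h.le _) (h.meas i) (h.meas j), h.mean i, zero_mul]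
lemma crossB (h : PF μ F D X p L) (i j : ι) (hD : 1 < D i j) : ∫ ω, XB μ X L i ω * XB μ X L j ω ∂μ = 0 := by
  rw [indep_mul (h.sep hD) (h.le _) (h.le _) (h.bmXB i).1 (h.bmXB j).1, h.XB_mean i, zero_mul]

lemma bmTop (h : PF μ F D X p L) (i : ι) : BM mΩ (XB μ X L i) := (h.bmXB i).mono (h.le _)

lemma BBint (h : PF μ F D X p L) (i j : ι) : Integrable (fun ω => XB μ X L i ω * XB μ X L j ω) μ :=
  ((h.bmTop i).mul (h.bmTop j)).integrable le_rfl

lemma rL2 (h : PF μ F D X p L) (i : ι) : MemLp (fun ω => X i ω - XB μ X L i ω) 2 μ := by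
  refine (h.memLp2 i).sub ?_
  obtain ⟨c, hc⟩ := (h.bmTop i).2
  exact MemLp.of_bound (h.bmTop i).1.aestronglyMeasurable c (Filter.Eventually.of_forall hc)

lemma r1 (h : PF μ F D X p L) (i : ι) : ∫ ω, |X i ω - XB μ X L i ω| ∂μ ≤ (∫ ω, (2 * L * |X i ω|) ^ p ∂μ) / L := by
  have hL := h.hL
  set c := ∫ ω, tr L (X i ω) ∂μ with hc
  have h1 : ∫ ω, |X i ω - XB μ X L i ω| ∂μ ≤ ∫ ω, (1 / (2 * L) * (2 * L * |X i ω|) ^ p + |c|) ∂μ := by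
    refine integral_mono ((h.rL2 i).integrable (by norm_num)).abs (((h.Zint i).const_mul _).add (integrable_const _)) fun ω => ?_
    have e : X i ω - XB μ X L i ω = (X i ω - tr L (X i ω)) + c := by unfold XB; ring
    simp only
    rw [e]
    refine (abs_add_le _ _).trans (add_le_add ?_ le_rfl)
    have := R_le_Z hL h.hp2 (X i ω)
    rw [one_div_mul_eq_div, le_div_iff₀ (by positivity)]; linarith
  rw [integral_add ((h.Zint i).const_mul _) (integrable_const _), integral_const_mul] at h1
  simp only [integral_const, probReal_univ, smul_eq_mul, one_mul] at h1
  have h2 := h.ER_le i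
  rw [← hc] at h2
  have h3 : |c| ≤ 1 / (2 * L) * ∫ ω, (2 * L * |X i ω|) ^ p ∂μ := by
    rw [one_div_mul_eq_div, le_div_iff₀ (by positivity)]; linarith
  refine h1.trans ((add_le_add le_rfl h3).trans (le_of_eq ?_))
  field_simp; ring

lemma r2 (h : PF μ F D X p L) (i : ι) : ∫ ω, (X i ω - XB μ X L i ω) ^ 2 ∂μ ≤ (∫ ω, (2 * L * |X i ω|) ^ p ∂μ) / L ^ 2 := by
  have hL := h.hL
  set c := ∫ ω, tr L (X i ω) ∂μ with hc
  have e : ∀ ω, (X i ω - XB μ X L i ω) ^ 2 = (X i ω - tr L (X i ω)) ^ 2 + (2 * c * (X i ω - tr L (X i ω)) + c ^ 2) := fun ω => by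
    unfold XB; ring
  have hT : MemLp (fun ω => tr L (X i ω)) 2 μ :=
    MemLp.of_bound ((tr_meas L).comp (h.mX i)).aestronglyMeasurable _ (Filter.Eventually.of_forall fun ω => tr_abs hL _)
  have hR2 : Integrable (fun ω => (X i ω - tr L (X i ω)) ^ 2) μ := ((h.memLp2 i).sub hT).integrable_sq
  simp_rw [e]
  have hI : Integrable (fun ω => 2 * c * (X i ω - tr L (X i ω)) + c ^ 2) μ := ((h.Rint i).const_mul _).add (integrable_const _)
  rw [integral_add hR2 hI,
    integral_add ((h.Rint i).const_mul _) (integrable_const _), integral_const_mul, h.ET_R i, ← hc]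
  have h1 : ∫ ω, (X i ω - tr L (X i ω)) ^ 2 ∂μ ≤ (∫ ω, (2 * L * |X i ω|) ^ p ∂μ) / L ^ 2 := by
    rw [← integral_div]
    refine integral_mono hR2 ((h.Zint i).div_const _) fun ω => ?_
    have := R2_le_Z hL h.hp2 (X i ω)
    simp only
    rw [le_div_iff₀ (by positivity)]
    nlinarith [mul_nonneg (sq_nonneg L) (sq_nonneg (X i ω - tr L (X i ω)))]
  simp only [integral_const, probReal_univ, smul_eq_mul, one_mul]
  nlinarith [sq_nonneg c]

lemma var_term (h : PF μ F D X p L) (i j : ι) :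
    |(∫ ω, XB μ X L i ω * XB μ X L j ω ∂μ) - ∫ ω, X i ω * X j ω ∂μ| ≤
      2 / L ^ 2 * (∫ ω, (2 * L * |X j ω|) ^ p ∂μ) + 2 / L ^ 2 * (∫ ω, (2 * L * |X i ω|) ^ p ∂μ) := by
  have hL := h.hL
  have hr := fun i => (h.rL2 i).integrable (by norm_num)
  have hr2 := fun i => (h.rL2 i).integrable_sq
  rw [← integral_sub (h.BBint i j) (h.XXint i j)]
  refine abs_integral_le_integral_abs.trans ?_
  have key : ∫ ω, |XB μ X L i ω * XB μ X L j ω - X i ω * X j ω| ∂μ ≤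
      ∫ ω, ((1 / L * |X j ω - XB μ X L j ω| + 1 / L * |X i ω - XB μ X L i ω|) +
        ((X j ω - XB μ X L j ω) ^ 2 + (X i ω - XB μ X L i ω) ^ 2)) ∂μ := by
    refine integral_mono ((h.BBint i j).sub (h.XXint i j)).abs
      ((((hr j).abs.const_mul _).add ((hr i).abs.const_mul _)).add ((hr2 j).add (hr2 i))) fun ω => ?_
    have e : XB μ X L i ω * XB μ X L j ω - X i ω * X j ω = -(XB μ X L i ω * (X j ω - XB μ X L j ω)
      + XB μ X L j ω * (X i ω - XB μ X L i ω) + (X j ω - XB μ X L j ω) * (X i ω - XB μ X L i ω)) := by ring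
    simp only
    rw [e, abs_neg]
    refine (abs_add_le _ _).trans (add_le_add ((abs_add_le _ _).trans (add_le_add ?_ ?_)) ?_)
    · rw [abs_mul]; exact mul_le_mul_of_nonneg_right (h.XB_le i ω) (abs_nonneg _)
    · rw [abs_mul]; exact mul_le_mul_of_nonneg_right (h.XB_le j ω) (abs_nonneg _)
    · generalize X j ω - XB μ X L j ω = a
      generalize X i ω - XB μ X L i ω = b
      rw [abs_le]; constructor <;> nlinarith [sq_nonneg (a - b), sq_nonneg (a + b), sq_nonneg a, sq_nonneg b]
  refine key.trans ?_
  have I1 : Integrable (fun ω => 1 / L * |X j ω - XB μ X L j ω| + 1 / L * |X i ω - XB μ X L i ω|) μ :=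
    ((hr j).abs.const_mul _).add ((hr i).abs.const_mul _)
  have I2 : Integrable (fun ω => (X j ω - XB μ X L j ω) ^ 2 + (X i ω - XB μ X L i ω) ^ 2) μ := (hr2 j).add (hr2 i)
  rw [integral_add I1 I2,
    integral_add ((hr j).abs.const_mul _) ((hr i).abs.const_mul _), integral_add (hr2 j) (hr2 i),
    integral_const_mul, integral_const_mul]
  have a1 := mul_le_mul_of_nonneg_left (h.r1 i) (show 0 ≤ 1 / L by positivity)
  have a2 := mul_le_mul_of_nonneg_left (h.r1 j) (show 0 ≤ 1 / L by positivity)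
  have a3 := h.r2 i
  have a4 := h.r2 j
  have e : ∀ x : ℝ, 2 / L ^ 2 * x = 1 / L * (x / L) + x / L ^ 2 := fun x => by field_simp; ring
  rw [e, e]; linarith

lemma var_diff (h : PF μ F D X p L) : |(∫ ω, WW (XB μ X L) ω ^ 2 ∂μ) - ∫ ω, WW X ω ^ 2 ∂μ| ≤ 4 * bb μ X p L := by
  have hL := h.hL
  rw [var_exp h.XXint h.crossX, var_exp h.BBint h.crossB, ← Finset.sum_sub_distrib]
  simp_rw [← Finset.sum_sub_distrib]
  refine (Finset.abs_sum_le_sum_abs _ _).trans ?_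
  refine (Finset.sum_le_sum fun i _ => (Finset.abs_sum_le_sum_abs _ _).trans (Finset.sum_le_sum fun j _ => h.var_term i j)).trans ?_
  simp_rw [Finset.sum_add_distrib]
  have hg : ∀ i, 0 ≤ 2 / L ^ 2 * ∫ ω, (2 * L * |X i ω|) ^ p ∂μ := fun i => mul_nonneg (by positivity) (h.EZ_nonneg i)
  refine (add_le_add (h.sum_swap 1 (by norm_num) _ hg) (h.sum_const 1 (by norm_num) _ hg)).trans ?_
  rw [← Finset.mul_sum]
  have e : L * (2 / L ^ 2 * ∑ i, ∫ ω, (2 * L * |X i ω|) ^ p ∂μ) = (2 * bb μ X p L) / L := by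
    unfold bb; field_simp
  rw [e]
  have := div_le_self (show 0 ≤ 2 * bb μ X p L by linarith [h.bb_nonneg]) hL
  linarith

lemma toBF (h : PF μ F D X p L) (hb : 8 * bb μ X p L ≤ 1) (hv : ∫ ω, WW X ω ^ 2 ∂μ ≤ 1) :
    BF μ F D (XB μ X L) (8 * bb μ X p L) where
  toFld := h.toFld
  meas i := (h.bmXB i).1
  mean := h.XB_mean
  bdd i ω := by
    have hL := h.hL
    unfold Sb
    refine (Finset.sum_le_sum fun j _ => h.XB_le j ω).trans ?_
    rw [Finset.sum_const, nsmul_eq_mul, mul_one_div, div_le_one (by positivity)]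
    exact h.card i
  third := h.XB_third
  small := hb
  var := by
    have := abs_le.1 h.var_diff
    linarith [this.2]

/-- sum of truncated -/
lemma WT (h : PF μ F D X p L) (ω : Ω) : ∑ i, tr L (X i ω) = WW (XB μ X L) ω + ∑ i, ∫ ω, tr L (X i ω) ∂μ := by
  unfold WW XB; rw [← Finset.sum_add_distrib]; simp

lemma WT_eq (ω : Ω) (hω : ∀ i, lg L (X i ω) = 0) : ∑ i, tr L (X i ω) = WW X ω := by
  unfold WW
  refine Finset.sum_congr rfl fun i _ => ?_
  have := hω i
  unfold lg at this
  unfold tr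
  split_ifs at this ⊢ with h1
  · rfl
  · norm_num at this

end PF
end
end BE

namespace BE
section
variable {Ω ι : Type*} [mΩ : MeasurableSpace Ω] {μ : Measure Ω} [IsProbabilityMeasure μ] [Fintype ι]
  {F : Set ι → MeasurableSpace Ω} {D : ι → ι → ℕ} {X : ι → Ω → ℝ} {p L : ℝ}

lemma real_scale {p : ℝ} (hp : 2 < p) (hp3 : p ≤ 3) {z : ℝ} (hz : 0 < z) (n : ℕ) (hn : 1 ≤ n) {a : ℝ} (ha : 0 ≤ a) :
    z ^ p * a ≤ (n:ℝ) ^ 3 * ((z / n) ^ p * a) := by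
  have hn' : (1:ℝ) ≤ n := by exact_mod_cast hn
  have e : z ^ p = (n:ℝ) ^ p * (z / n) ^ p := by
    rw [← Real.mul_rpow (by positivity) (by positivity)]; congr 1; field_simp
  rw [e, mul_assoc]
  refine mul_le_mul_of_nonneg_right ?_ (by positivity)
  calc (n:ℝ) ^ p ≤ (n:ℝ) ^ (3:ℝ) := Real.rpow_le_rpow_of_exponent_le hn' hp3
    _ = _ := by norm_cast

lemma rpow_exp {p : ℝ} (hp : 2 < p) (hp3 : p ≤ 3) {z : ℝ} (hz : 0 ≤ z) : (1 + z) ^ p ≤ 768 * Real.exp (z / 4) := by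
  have h1 : (1 + z) ^ p ≤ (1 + z) ^ 3 := by
    calc (1 + z) ^ p ≤ (1 + z) ^ (3:ℝ) := Real.rpow_le_rpow_of_exponent_le (by linarith) hp3
      _ = _ := by norm_cast
  have h2 := Real.pow_div_factorial_le_exp ((1 + z) / 4) (by positivity) 3
  have h3 : Real.exp ((1 + z) / 4) ≤ 2 * Real.exp (z / 4) := by
    rw [add_div, Real.exp_add]
    refine mul_le_mul_of_nonneg_right ((Real.exp_le_exp.2 (by norm_num)).trans exp_half_le) (Real.exp_pos _).le
  norm_num [Nat.factorial] at h2
  have : ((1 + z) / 4) ^ 3 = (1 + z) ^ 3 / 64 := by ring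
  rw [this] at h2
  linarith

lemma markov_p {p : ℝ} (hp : 2 < p) {U : Ω → ℝ} (hU : Integrable (fun ω => |U ω| ^ p) μ) {y : ℝ} (hy : 0 < y) :
    y ^ p * μ.real {ω | y ≤ |U ω|} ≤ ∫ ω, |U ω| ^ p ∂μ := by
  have := mul_meas_ge_le_integral_of_nonneg (μ := μ) (Filter.Eventually.of_forall fun ω => by positivity) hU (y ^ p)
  refine le_trans (mul_le_mul_of_nonneg_left (le_of_eq ?_) (by positivity)) this
  congr 1; ext ω
  simp only [Set.mem_ofPred_eq]
  exact (Real.rpow_le_rpow_iff hy.le (abs_nonneg _) (by linarith)).symm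

/-- big set -/
def Ab (X : ι → Ω → ℝ) (L : ℝ) (i : ι) : Set Ω := {ω | ¬ |X i ω| ≤ 1 / (2 * L)}

namespace BF
variable {β : ℝ}
lemma tail (h : BF μ F D X β) (y : ℝ) : μ.real {ω | y ≤ |WW X ω|} ≤ CE * Real.exp (-y) := by
  have bE : BM (F Set.univ) (fun ω => Real.exp |WW X ω|) := h.bmW.abs.exp
  have := mul_meas_ge_le_integral_of_nonneg (μ := μ) (Filter.Eventually.of_forall fun ω => (Real.exp_pos |WW X ω|).le) (h.int bE) (Real.exp y)
  simp only [Real.exp_le_exp] at this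
  have h2 := this.trans h.expE
  rw [Real.exp_neg, ← div_eq_mul_inv, le_div_iff₀ (Real.exp_pos _)]
  change Real.exp y * μ.real _ ≤ _ at h2
  linarith
end BF

namespace PF
open BF (CE CE_ge)

lemma mA (h : PF μ F D X p L) (i : ι) : MeasurableSet[F {i}] (Ab X L i) :=
  ((measurable_abs.comp (h.meas i)) (measurableSet_Iic (a := 1 / (2 * L)))).compl

lemma lg_ind (i : ι) (ω : Ω) : lg L (X i ω) = (Ab X L i).indicator (fun _ => (1:ℝ)) ω := by
  by_cases hω : |X i ω| ≤ 1 / (2 * L)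
  · have : ω ∉ Ab X L i := fun h => h hω
    simp only [Set.indicator, this, if_false, lg, hω, if_true]
  · have : ω ∈ Ab X L i := hω
    simp only [Set.indicator, this, if_true, lg, hω, if_false]

lemma lg_int (h : PF μ F D X p L) (i : ι) : ∫ ω, lg L (X i ω) ∂μ = μ.real (Ab X L i) := by
  simp_rw [lg_ind i]
  rw [integral_indicator (h.le _ _ (h.mA i))]; simp

lemma A_le (h : PF μ F D X p L) (i : ι) : μ.real (Ab X L i) ≤ ∫ ω, (2 * L * |X i ω|) ^ p ∂μ := by
  rw [← h.lg_int i]; exact h.lgE i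

lemma A_sum (h : PF μ F D X p L) : ∑ i, μ.real (Ab X L i) ≤ bb μ X p L :=
  Finset.sum_le_sum fun i _ => h.A_le i

lemma Yint (h : PF μ F D X p L) (i : ι) : Integrable (fun ω => |Vs X D 1 i ω| ^ p) μ := by
  have hp := h.hp2
  have : MemLp (Vs X D 1 i) (ENNReal.ofReal p) μ := by
    unfold Vs; exact memLp_finsetSum _ fun i _ => h.mean_X_memLp i
  have := this.integrable_norm_rpow (by simp; linarith) (by simp)
  rwa [ENNReal.toReal_ofReal (by linarith)] at this

lemma Y_tail (h : PF μ F D X p L) {y : ℝ} (hy : 0 < y) : ∑ i, y ^ p * μ.real {ω | y ≤ |Vs X D 1 i ω|} ≤ bb μ X p L := by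
  have hL := h.hL
  have hp := h.hp2
  have s : ∀ i, y ^ p * μ.real {ω | y ≤ |Vs X D 1 i ω|} ≤ L ^ (p - 1) * ∑ j with D i j ≤ 1, ∫ ω, |X j ω| ^ p ∂μ := fun i => by
    refine (markov_p hp (h.Yint i) hy).trans ?_
    rw [← integral_finsetSum _ (fun j _ => h.mom j), ← integral_const_mul]
    refine integral_mono (h.Yint i) ((integrable_finsetSum _ fun j _ => h.mom j).const_mul _) fun ω => ?_
    exact psum _ (by linarith) (h.card_le 1 (by norm_num) i) _
  refine (Finset.sum_le_sum fun i _ => s i).trans ?_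
  rw [← Finset.mul_sum]
  have h0 : ∀ j, 0 ≤ ∫ ω, |X j ω| ^ p ∂μ := fun j => integral_nonneg fun ω => by positivity
  refine (mul_le_mul_of_nonneg_left (h.sum_swap 1 (by norm_num) _ h0) (by positivity)).trans ?_
  have e : ∀ i, ∫ ω, (2 * L * |X i ω|) ^ p ∂μ = (2 * L) ^ p * ∫ ω, |X i ω| ^ p ∂μ := fun i => by
    rw [← integral_const_mul]; congr 1; ext ω; exact Real.mul_rpow (by positivity) (abs_nonneg _)
  unfold bb
  simp_rw [e]
  rw [← Finset.mul_sum, ← mul_assoc]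
  refine mul_le_mul_of_nonneg_right ?_ (Finset.sum_nonneg fun j _ => h0 j)
  calc L ^ (p - 1) * L = L ^ p := by rw [← Real.rpow_add_one (by positivity)]; congr 1; ring
    _ ≤ _ := Real.rpow_le_rpow (by positivity) (by linarith) (by linarith)

lemma mWf (h : PF μ F D X p L) (r : ℕ) (i : ι) : Measurable[F (FB D r i)] (Wf X D r i) := by
  unfold Wf
  exact Finset.measurable_sum _ fun j hj => (h.meas j).mono (h.mono _ _ (by
    simp only [Finset.mem_filter, Finset.mem_univ, true_and] at hj
    simpa [FB] using hj)) le_rfl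

lemma far_term (h : PF μ F D X p L) {H : ℝ} (hH : ∀ z, 0 < z → z ^ p * μ.real {ω | z ≤ |WW X ω|} ≤ H) {z : ℝ} (hz : 0 < z) (i : ι) :
    z ^ p * μ.real (Ab X L i ∩ {ω | z ≤ |WW X ω|}) ≤ 64 * H * (∫ ω, (2 * L * |X i ω|) ^ p ∂μ) +
      64 * ((z / 4) ^ p * μ.real {ω | z / 4 ≤ |Vs X D 1 i ω|}) + 8 * ((z / 2) ^ p * μ.real {ω | z / 2 ≤ |Vs X D 1 i ω|}) := by
  have hp := h.hp2
  have hp3 := h.hp3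
  have s1 : μ.real (Ab X L i ∩ {ω | z ≤ |WW X ω|}) ≤ μ.real (Ab X L i ∩ {ω | z / 2 ≤ |Wf X D 1 i ω|}) + μ.real {ω | z / 2 ≤ |Vs X D 1 i ω|} := by
    refine (measureReal_mono ?_).trans (measureReal_union_le _ _)
    rintro ω ⟨h1, h2⟩
    by_cases h3 : z / 2 ≤ |Vs X D 1 i ω|
    · exact Or.inr h3
    · refine Or.inl ⟨h1, ?_⟩
      simp only [Set.mem_ofPred_eq] at h2 ⊢
      rw [W_split X D 1 i ω] at h2
      have := abs_add_le (Vs X D 1 i ω) (Wf X D 1 i ω)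
      linarith
  have s2 : μ.real (Ab X L i ∩ {ω | z / 2 ≤ |Wf X D 1 i ω|}) = μ.real (Ab X L i) * μ.real {ω | z / 2 ≤ |Wf X D 1 i ω|} := by
    have hi := h.indep {i} (FB D 1 i) (fun a ha b hb => by simp only [Set.mem_singleton_iff] at ha; subst ha; exact hb)
    have := (Indep_iff _ _ μ).1 hi (Ab X L i) {ω | z / 2 ≤ |Wf X D 1 i ω|} (h.mA i)
      ((measurable_abs.comp (h.mWf 1 i)) (measurableSet_Ici (a := z / 2)))
    simp only [Measure.real, this, ENNReal.toReal_mul]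
  have s3 : μ.real {ω | z / 2 ≤ |Wf X D 1 i ω|} ≤ μ.real {ω | z / 4 ≤ |WW X ω|} + μ.real {ω | z / 4 ≤ |Vs X D 1 i ω|} := by
    refine (measureReal_mono ?_).trans (measureReal_union_le _ _)
    intro ω h2
    by_cases h3 : z / 4 ≤ |Vs X D 1 i ω|
    · exact Or.inr h3
    · refine Or.inl ?_
      simp only [Set.mem_ofPred_eq] at h2 ⊢
      have e : Wf X D 1 i ω = WW X ω - Vs X D 1 i ω := by rw [W_split X D 1 i ω]; ring
      rw [e] at h2
      have := abs_sub (WW X ω) (Vs X D 1 i ω)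
      linarith
  have a0 : 0 ≤ μ.real (Ab X L i) := measureReal_nonneg
  have a1 : μ.real (Ab X L i) ≤ 1 := measureReal_le_one
  have a2 := h.A_le i
  have b1 := real_scale hp hp3 hz 4 (by norm_num) (measureReal_nonneg (μ := μ) (s := {ω | z / 4 ≤ |WW X ω|}))
  have b2 := real_scale hp hp3 hz 4 (by norm_num) (measureReal_nonneg (μ := μ) (s := {ω | z / 4 ≤ |Vs X D 1 i ω|}))
  have b3 := real_scale hp hp3 hz 2 (by norm_num) (measureReal_nonneg (μ := μ) (s := {ω | z / 2 ≤ |Vs X D 1 i ω|}))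
  push_cast at b1 b2 b3
  have c1 := hH (z / 4) (by positivity)
  have hz0 : 0 < z ^ p := by positivity
  set PA := μ.real (Ab X L i)
  set PW := μ.real {ω | z / 4 ≤ |WW X ω|}
  set PY4 := μ.real {ω | z / 4 ≤ |Vs X D 1 i ω|}
  set PY2 := μ.real {ω | z / 2 ≤ |Vs X D 1 i ω|}
  have hPW : 0 ≤ PW := measureReal_nonneg
  have hPY4 : 0 ≤ PY4 := measureReal_nonneg
  have hHH : z ^ p * PW ≤ 64 * H := by linarith
  have hH0 : 0 ≤ 64 * H := le_trans (by positivity) hHH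
  calc z ^ p * μ.real (Ab X L i ∩ {ω | z ≤ |WW X ω|}) ≤ z ^ p * (PA * (PW + PY4) + PY2) := by
        refine mul_le_mul_of_nonneg_left (s1.trans ?_) hz0.le
        rw [s2]; exact add_le_add (mul_le_mul_of_nonneg_left s3 a0) le_rfl
    _ = PA * (z ^ p * PW) + PA * (z ^ p * PY4) + z ^ p * PY2 := by ring
    _ ≤ _ := by
      have t1 : PA * (z ^ p * PW) ≤ 64 * H * (∫ ω, (2 * L * |X i ω|) ^ p ∂μ) := by
        rw [mul_comm]; exact mul_le_mul hHH a2 a0 hH0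
      have t2 : PA * (z ^ p * PY4) ≤ z ^ p * PY4 := mul_le_of_le_one_left (by positivity) a1
      linarith

lemma far_sum (h : PF μ F D X p L) {H : ℝ} (hH : ∀ z, 0 < z → z ^ p * μ.real {ω | z ≤ |WW X ω|} ≤ H) {z : ℝ} (hz : 0 < z) :
    z ^ p * ∑ i, μ.real (Ab X L i ∩ {ω | z ≤ |WW X ω|}) ≤ bb μ X p L * (64 * H + 72) := by
  rw [Finset.mul_sum]
  refine (Finset.sum_le_sum fun i _ => h.far_term hH hz i).trans ?_
  rw [Finset.sum_add_distrib, Finset.sum_add_distrib]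
  have h1 := h.Y_tail (show 0 < z / 4 by positivity)
  have h2 := h.Y_tail (show 0 < z / 2 by positivity)
  have : ∑ i, ∫ ω, (2 * L * |X i ω|) ^ p ∂μ = bb μ X p L := rfl
  rw [← Finset.mul_sum, this]
  have e1 := Finset.mul_sum Finset.univ (fun i => (z / 4) ^ p * μ.real {ω | z / 4 ≤ |Vs X D 1 i ω|}) 64
  have e2 := Finset.mul_sum Finset.univ (fun i => (z / 2) ^ p * μ.real {ω | z / 2 ≤ |Vs X D 1 i ω|}) 8
  rw [← e1, ← e2]
  linarith

lemma shift_one (h : PF μ F D X p L) (hb : bb μ X p L ≤ 1/1536) : |∑ i, ∫ ω, tr L (X i ω) ∂μ| ≤ 1/2 :=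
  h.shift_le.trans (by linarith)

lemma T_tail (h : PF μ F D X p L) (hb : bb μ X p L ≤ 1/1536) (hv : ∫ ω, WW X ω ^ 2 ∂μ ≤ 1) (z : ℝ) :
    μ.real {ω | z ≤ |∑ i, tr L (X i ω)|} ≤ 2 * CE * Real.exp (-z) := by
  have hB := h.toBF (by linarith) hv
  have hCE := CE_ge
  calc μ.real {ω | z ≤ |∑ i, tr L (X i ω)|} ≤ μ.real {ω | z - 1/2 ≤ |WW (XB μ X L) ω|} := by
        refine measureReal_mono fun ω hω => ?_
        simp only [Set.mem_ofPred_eq] at hω ⊢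
        rw [h.WT ω] at hω
        have := abs_add_le (WW (XB μ X L) ω) (∑ i, ∫ ω, tr L (X i ω) ∂μ)
        linarith [h.shift_one hb]
    _ ≤ CE * Real.exp (-(z - 1/2)) := hB.tail _
    _ = CE * (Real.exp (1/2) * Real.exp (-z)) := by rw [← Real.exp_add]; ring_nf
    _ ≤ CE * (2 * Real.exp (-z)) := mul_le_mul_of_nonneg_left (mul_le_mul_of_nonneg_right exp_half_le (Real.exp_pos _).le) (by linarith)
    _ = _ := by ring

lemma W_sub (z : ℝ) : {ω | z ≤ |WW X ω|} ⊆ {ω | z ≤ |∑ i, tr L (X i ω)|} ∪ ⋃ i, (Ab X L i ∩ {ω | z ≤ |WW X ω|}) := by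
  intro ω hω
  by_cases hA : ∃ i, ω ∈ Ab X L i
  · obtain ⟨i, hi⟩ := hA
    exact Or.inr (Set.mem_iUnion.2 ⟨i, hi, hω⟩)
  · left
    push Not at hA
    simp only [Set.mem_ofPred_eq] at hω ⊢
    rw [WT_eq ω fun i => by rw [lg_ind]; simp [hA i]]
    exact hω

lemma tailR (h : PF μ F D X p L) (hb : bb μ X p L ≤ 1/1536) (hv : ∫ ω, WW X ω ^ 2 ∂μ ≤ 1) :
    ∀ z, 0 < z → z ^ p * μ.real {ω | z ≤ |WW X ω|} ≤ 2 * (1536 * CE + 1) := by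
  have hCE := CE_ge
  have hb0 := h.bb_nonneg
  refine iter_lem (P := fun H => ∀ z, 0 < z → z ^ p * μ.real {ω | z ≤ |WW X ω|} ≤ H) (c := 1536 * CE + 1)
    (H0 := ∫ ω, |WW X ω| ^ p ∂μ) (by positivity) (integral_nonneg fun ω => by positivity)
    (fun z hz => markov_p h.hp2 h.Wp_int hz) ?_ ?_
  · intro H hH0 hH z hz
    have h1 : μ.real {ω | z ≤ |WW X ω|} ≤ 2 * CE * Real.exp (-z) + ∑ i, μ.real (Ab X L i ∩ {ω | z ≤ |WW X ω|}) := by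
      refine (measureReal_mono (W_sub (L := L) z)).trans ((measureReal_union_le _ _).trans ?_)
      exact add_le_add (h.T_tail hb hv z) (measureReal_iUnion_fintype_le _)
    have h2 := h.far_sum hH hz
    have h3 : z ^ p * Real.exp (-z) ≤ 768 := by
      have a : z ^ p ≤ (1 + z) ^ p := Real.rpow_le_rpow hz.le (by linarith) (by linarith [h.hp2])
      have b := rpow_exp h.hp2 h.hp3 hz.le
      have c : Real.exp (z / 4) ≤ Real.exp z := Real.exp_le_exp.2 (by linarith)
      rw [Real.exp_neg, ← div_eq_mul_inv, div_le_iff₀ (Real.exp_pos _)]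
      linarith
    have h4 := mul_le_mul_of_nonneg_left h1 (show 0 ≤ z ^ p by positivity)
    have h5 : bb μ X p L * (64 * H + 72) ≤ 1/1536 * (64 * H + 72) := mul_le_mul_of_nonneg_right hb (by positivity)
    nlinarith
  · intro H hcl z hz
    refine le_of_forall_pos_le_add fun ε hε => ?_
    obtain ⟨δ, hδ, hP⟩ := hcl ε hε
    exact (hP z hz).trans (by linarith)

end PF
end
end BE

namespace BE
section
variable {Ω ι : Type*} [mΩ : MeasurableSpace Ω] {μ : Measure Ω} [IsProbabilityMeasure μ] [Fintype ι]
  {F : Set ι → MeasurableSpace Ω} {D : ι → ι → ℕ} {X : ι → Ω → ℝ} {p L : ℝ}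

namespace PF
open BF (CE CE_ge)

lemma near_term (h : PF μ F D X p L) (hb : bb μ X p L ≤ 1/1536) (hv : ∫ ω, WW X ω ^ 2 ∂μ ≤ 1) (z : ℝ) (i : ι) :
    μ.real (Ab X L i ∩ {ω | z ≤ |∑ i, tr L (X i ω)|}) ≤ 2 * CE * Real.exp (-z) * μ.real (Ab X L i) := by
  have hB := h.toBF (by linarith) hv
  have hCE := CE_ge
  have bl : BM (F (NB D 2 i)) (fun ω => lg L (X i ω)) := (h.bmlg i).mono (h.mono _ _ (by
    intro j hj; simp only [Set.mem_singleton_iff] at hj; subst hj; simp [NB, h.self]))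
  have h1 := hB.locE i bl (fun ω => lg_nonneg _ _)
  rw [h.lg_int i] at h1
  set S := Ab X L i ∩ {ω | z ≤ |∑ i, tr L (X i ω)|} with hS
  have mT : Measurable (fun ω => ∑ i, tr L (X i ω)) := Finset.measurable_sum _ fun j _ => (tr_meas L).comp (h.mX j)
  have mS : MeasurableSet S := (h.le _ _ (h.mA i)).inter ((measurable_abs.comp mT) (measurableSet_Ici (a := z)))
  have h2 : Real.exp (z - 1/2) * μ.real S ≤ ∫ ω, lg L (X i ω) * Real.exp |WW (XB μ X L) ω| ∂μ := by
    have e : Real.exp (z - 1/2) * μ.real S = ∫ ω, S.indicator (fun _ => Real.exp (z - 1/2)) ω ∂μ := by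
      rw [integral_indicator mS]; simp [mul_comm]
    rw [e]
    have bW : BM mΩ (WW (XB μ X L)) := BM.sum _ fun j _ => h.bmTop j
    have bm : BM mΩ (fun ω => lg L (X i ω) * Real.exp |WW (XB μ X L) ω|) := ((h.bmlg i).mono (h.le _)).mul bW.abs.exp
    refine integral_mono ((integrable_const _).indicator mS) (bm.integrable le_rfl) fun ω => ?_
    by_cases hω : ω ∈ S
    · have hA : ω ∈ Ab X L i := hω.1
      have hz : z ≤ |∑ i, tr L (X i ω)| := hω.2
      rw [h.WT ω] at hz
      have := abs_add_le (WW (XB μ X L) ω) (∑ i, ∫ ω, tr L (X i ω) ∂μ)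
      simp only [Set.indicator_of_mem hω, lg_ind i, Set.indicator_of_mem hA, one_mul]
      exact Real.exp_le_exp.2 (by linarith [h.shift_one hb])
    · simp only [Set.indicator_of_notMem hω]
      exact mul_nonneg (lg_nonneg _ _) (Real.exp_pos _).le
  have h3 := h2.trans h1
  have h4 : μ.real S = Real.exp (1/2) * Real.exp (-z) * (Real.exp (z - 1/2) * μ.real S) := by
    rw [← mul_assoc, ← Real.exp_add, ← Real.exp_add]; ring_nf; simp
  rw [h4]
  calc _ ≤ Real.exp (1/2) * Real.exp (-z) * (CE * μ.real (Ab X L i)) := mul_le_mul_of_nonneg_left h3 (by positivity)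
    _ ≤ 2 * Real.exp (-z) * (CE * μ.real (Ab X L i)) := by
      have := exp_half_le
      gcongr
    _ = _ := by ring

lemma comp1 (z : ℝ) {E : Set ℝ} (h1 : Set.Iio z ⊆ E) {T U : Ω → ℝ} (hTU : ∀ ω, (∀ i, ω ∉ Ab X L i) → T ω = U ω) :
    μ.real (U ⁻¹' E) ≤ μ.real (T ⁻¹' E) + ∑ i, μ.real (Ab X L i ∩ {ω | z ≤ |T ω|}) := by
  have : U ⁻¹' E ⊆ T ⁻¹' E ∪ ⋃ i, (Ab X L i ∩ {ω | z ≤ |T ω|}) := by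
    intro ω hω
    by_cases hT : T ω ∈ E
    · exact Or.inl hT
    · right
      have hz : z ≤ |T ω| := by
        refine le_trans ?_ (le_abs_self _)
        by_contra hlt
        exact hT (h1 (not_le.1 hlt))
      by_cases hA : ∀ i, ω ∉ Ab X L i
      · exact absurd (by rw [hTU ω hA]; exact hω) hT
      · push Not at hA
        obtain ⟨i, hi⟩ := hA
        exact Set.mem_iUnion.2 ⟨i, hi, hz⟩
  exact (measureReal_mono this).trans ((measureReal_union_le _ _).trans (add_le_add le_rfl (measureReal_iUnion_fintype_le _)))

lemma bb_pos (h : PF μ F D X p L) (hv : ∫ ω, WW X ω ^ 2 ∂μ = 1) : 0 < bb μ X p L := by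
  refine lt_of_le_of_ne h.bb_nonneg fun h0 => ?_
  have hp := h.hp2
  have hL := h.hL
  have h1 : ∀ i, ∫ ω, (2 * L * |X i ω|) ^ p ∂μ = 0 := fun i =>
    (Finset.sum_eq_zero_iff_of_nonneg fun i _ => h.EZ_nonneg i).1 h0.symm i (Finset.mem_univ i)
  have h2 : ∀ i, ∀ᵐ ω ∂μ, X i ω = 0 := fun i => by
    have := (integral_eq_zero_iff_of_nonneg (fun ω => by positivity) (h.Zint i)).1 (h1 i)
    filter_upwards [this] with ω hω
    simp only [Pi.zero_apply] at hω
    rw [Real.rpow_eq_zero (by positivity) (by linarith)] at hω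
    rcases mul_eq_zero.1 hω with h' | h'
    · linarith
    · exact abs_eq_zero.1 h'
  have h3 : ∀ᵐ ω ∂μ, WW X ω ^ 2 = 0 := by
    filter_upwards [ae_all_iff.2 h2] with ω hω
    unfold WW; simp [hω]
  have : ∫ ω, WW X ω ^ 2 ∂μ = 0 := integral_eq_zero_of_ae h3
  linarith

lemma pow8 {p : ℝ} (hp : 2 < p) (hp3 : p ≤ 3) {z : ℝ} (hz : 1 ≤ z) : (1 + z) ^ p ≤ 8 * z ^ p := by
  calc (1 + z) ^ p ≤ (2 * z) ^ p := Real.rpow_le_rpow (by linarith) (by linarith) (by linarith)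
    _ = 2 ^ p * z ^ p := Real.mul_rpow (by norm_num) (by linarith)
    _ ≤ 8 * z ^ p := by
      refine mul_le_mul_of_nonneg_right ?_ (by positivity)
      calc (2:ℝ) ^ p ≤ 2 ^ (3:ℝ) := Real.rpow_le_rpow_of_exponent_le (by norm_num) hp3
        _ = 8 := by norm_num

lemma pow8' {p : ℝ} (hp : 2 < p) (hp3 : p ≤ 3) {z : ℝ} (hz0 : 0 ≤ z) (hz : z ≤ 1) : (1 + z) ^ p ≤ 8 := by
  calc (1 + z) ^ p ≤ 2 ^ p := Real.rpow_le_rpow (by linarith) (by linarith) (by linarith)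
      _ ≤ 2 ^ (3:ℝ) := Real.rpow_le_rpow_of_exponent_le (by norm_num) hp3
      _ = 8 := by norm_num

lemma far_all (h : PF μ F D X p L) (hb : bb μ X p L ≤ 1/1536) (hv : ∫ ω, WW X ω ^ 2 ∂μ ≤ 1) {z : ℝ} (hz : 0 ≤ z) :
    (1 + z) ^ p * ∑ i, μ.real (Ab X L i ∩ {ω | z ≤ |WW X ω|}) ≤ 2000000 * CE * bb μ X p L := by
  have hCE := CE_ge
  have hb0 := h.bb_nonneg
  have hs : 0 ≤ ∑ i, μ.real (Ab X L i ∩ {ω | z ≤ |WW X ω|}) := Finset.sum_nonneg fun i _ => measureReal_nonneg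
  rcases le_total z 1 with h1 | h1
  · have a := pow8' h.hp2 h.hp3 hz h1
    have b : ∑ i, μ.real (Ab X L i ∩ {ω | z ≤ |WW X ω|}) ≤ bb μ X p L :=
      (Finset.sum_le_sum fun i _ => measureReal_mono Set.inter_subset_left).trans h.A_sum
    have := mul_le_mul a b hs (by norm_num)
    nlinarith [mul_nonneg (sub_nonneg.2 hCE) hb0]
  · have a := mul_le_mul_of_nonneg_right (pow8 h.hp2 h.hp3 h1) hs
    have b := h.far_sum (h.tailR hb hv) (by linarith : 0 < z)
    nlinarith [mul_nonneg (sub_nonneg.2 hCE) hb0]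

lemma near_all (h : PF μ F D X p L) (hb : bb μ X p L ≤ 1/1536) (hv : ∫ ω, WW X ω ^ 2 ∂μ ≤ 1) {z : ℝ} (hz : 0 ≤ z) :
    (1 + z) ^ p * ∑ i, μ.real (Ab X L i ∩ {ω | z ≤ |∑ i, tr L (X i ω)|}) ≤ 1536 * CE * bb μ X p L := by
  have hCE := CE_ge
  have hb0 := h.bb_nonneg
  have a := Finset.sum_le_sum fun i (_ : i ∈ Finset.univ) => h.near_term hb hv z i
  rw [← Finset.mul_sum] at a
  have b := mul_le_mul_of_nonneg_left h.A_sum (by positivity : 0 ≤ 2 * CE * Real.exp (-z))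
  have c := rpow_exp h.hp2 h.hp3 hz
  have d : Real.exp (z / 4) * Real.exp (-z) ≤ 1 := by
    rw [← Real.exp_add]; exact Real.exp_le_one_iff.2 (by linarith)
  calc _ ≤ (768 * Real.exp (z / 4)) * (2 * CE * Real.exp (-z) * bb μ X p L) :=
        mul_le_mul c (a.trans b) (Finset.sum_nonneg fun i _ => measureReal_nonneg) (by positivity)
    _ = 1536 * CE * bb μ X p L * (Real.exp (z / 4) * Real.exp (-z)) := by ring
    _ ≤ _ := mul_le_of_le_one_right (by positivity) d

lemma bulk (h : PF μ F D X p L) (hb : bb μ X p L ≤ 1/1536) (hv : ∫ ω, WW X ω ^ 2 ∂μ = 1) {z : ℝ} (hz : 0 ≤ z)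
    {E : Set ℝ} (hE : MeasurableSet E) (h1 : Set.Iio z ⊆ E) (h2 : E ⊆ Set.Iic z) :
    (1 + z) ^ p * |μ.real ((fun ω => ∑ i, tr L (X i ω)) ⁻¹' E) - stdGaussianCDF z| ≤ 260000000 * CE * bb μ X p L := by
  have hCE := CE_ge
  have hb0 := h.bb_pos hv
  have hB := h.toBF (by linarith) hv.le
  have hvd := h.var_diff
  rw [hv] at hvd
  set s := ∑ i, ∫ ω, tr L (X i ω) ∂μ with hs
  have hsb : |s| ≤ bb μ X p L := h.shift_le
  have hs2 := abs_le.1 hsb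
  have m1 := hB.bounded_thm (by linarith) (by linarith) (by linarith) (z := z - s) (by linarith)
    (E := (fun x => x + s) ⁻¹' E) ((measurable_id.add_const s) hE)
    (fun x hx => h1 (by simp only [Set.mem_Iio] at hx ⊢; linarith))
    (fun x hx => by have := h2 hx; simp only [Set.mem_Iic] at this ⊢; linarith)
  have e : (fun ω => ∑ i, tr L (X i ω)) ⁻¹' E = WW (XB μ X L) ⁻¹' ((fun x => x + s) ⁻¹' E) := by
    ext ω; simp only [Set.mem_preimage]; rw [h.WT ω]
  rw [e]
  have hex : ∀ t, z - 1 ≤ t → Real.exp (-t / 4) ≤ 2 * Real.exp (-z / 4) := fun t ht => by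
    calc Real.exp (-t / 4) ≤ Real.exp (1/2 + -z/4) := Real.exp_le_exp.2 (by linarith)
      _ = Real.exp (1/2) * Real.exp (-z/4) := Real.exp_add _ _
      _ ≤ _ := mul_le_mul_of_nonneg_right exp_half_le (Real.exp_pos _).le
  have m2 : |stdGaussianCDF (z - s) - stdGaussianCDF z| ≤ bb μ X p L * (2 * Real.exp (-z / 4)) := by
    rcases le_total 0 s with h0 | h0
    · have a := cdf_incr (z - s) s h0
      have b := cdf_mono (show z - s ≤ z by linarith)
      rw [sub_add_cancel] at a
      rw [abs_sub_comm, abs_of_nonneg (by linarith)]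
      exact a.trans (mul_le_mul (by linarith) (hex _ (by linarith)) (Real.exp_pos _).le hb0.le)
    · have a := cdf_incr z (-s) (by linarith)
      have b := cdf_mono (show z ≤ z - s by linarith)
      rw [← sub_eq_add_neg] at a
      rw [abs_of_nonneg (by linarith)]
      exact a.trans (mul_le_mul (by linarith) (hex _ (by linarith)) (Real.exp_pos _).le hb0.le)
  have m3 := mul_le_mul_of_nonneg_left (hex (z - s) (by linarith)) (by positivity : 0 ≤ 21000 * CE * (8 * bb μ X p L))
  have m4 : |μ.real (WW (XB μ X L) ⁻¹' ((fun x => x + s) ⁻¹' E)) - stdGaussianCDF z| ≤ (336000 * CE + 2) * bb μ X p L * Real.exp (-z/4) := by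
    refine (abs_sub_le _ (stdGaussianCDF (z - s)) _).trans ?_
    calc _ ≤ 21000 * CE * (8 * bb μ X p L) * (2 * Real.exp (-z / 4)) + bb μ X p L * (2 * Real.exp (-z / 4)) := add_le_add (m1.trans m3) m2
      _ = _ := by ring
  have d : Real.exp (z / 4) * Real.exp (-z / 4) = 1 := by
    rw [← Real.exp_add]; ring_nf; simp
  calc _ ≤ (768 * Real.exp (z / 4)) * ((336000 * CE + 2) * bb μ X p L * Real.exp (-z/4)) :=
        mul_le_mul (rpow_exp h.hp2 h.hp3 hz) m4 (abs_nonneg _) (by positivity)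
    _ = 768 * (336000 * CE + 2) * bb μ X p L * (Real.exp (z / 4) * Real.exp (-z / 4)) := by ring
    _ ≤ _ := by
      rw [d]
      nlinarith [mul_nonneg (sub_nonneg.2 hCE) hb0.le]

lemma main_small (h : PF μ F D X p L) (hb : bb μ X p L ≤ 1/1536) (hv : ∫ ω, WW X ω ^ 2 ∂μ = 1) {z : ℝ} (hz : 0 ≤ z)
    {E : Set ℝ} (hE : MeasurableSet E) (h1 : Set.Iio z ⊆ E) (h2 : E ⊆ Set.Iic z) :
    (1 + z) ^ p * |μ.real (WW X ⁻¹' E) - stdGaussianCDF z| ≤ 300000000 * CE * bb μ X p L := by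
  have hCE := CE_ge
  have hb0 := h.bb_pos hv
  have a := h.bulk hb hv hz hE h1 h2
  have hTU : ∀ ω, (∀ i, ω ∉ Ab X L i) → (∑ i, tr L (X i ω)) = WW X ω := fun ω hA =>
    WT_eq ω fun i => by rw [lg_ind]; simp [hA i]
  have b := comp1 (μ := μ) z h1 hTU
  have c := comp1 (μ := μ) z h1 (fun ω hω => (hTU ω hω).symm)
  have b' := h.near_all hb hv.le hz
  have c' := h.far_all hb hv.le hz
  set sN := ∑ i, μ.real (Ab X L i ∩ {ω | z ≤ |∑ i, tr L (X i ω)|}) with hsN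
  set sF := ∑ i, μ.real (Ab X L i ∩ {ω | z ≤ |WW X ω|})
  have n0 : 0 ≤ sN := Finset.sum_nonneg fun i _ => measureReal_nonneg
  have f0 : 0 ≤ sF := Finset.sum_nonneg fun i _ => measureReal_nonneg
  have d : |μ.real (WW X ⁻¹' E) - stdGaussianCDF z| ≤ |μ.real ((fun ω => ∑ i, tr L (X i ω)) ⁻¹' E) - stdGaussianCDF z| + sN + sF := by
    have t := abs_le.1 (le_refl |μ.real ((fun ω => ∑ i, tr L (X i ω)) ⁻¹' E) - stdGaussianCDF z|)
    rw [abs_le]; constructor <;> linarith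
  have hpos : 0 ≤ (1 + z) ^ p := by positivity
  have := mul_le_mul_of_nonneg_left d hpos
  nlinarith [mul_nonneg (sub_nonneg.2 hCE) hb0.le]

end PF
end
end BE

namespace BE
section
variable {Ω ι : Type*} [mΩ : MeasurableSpace Ω] {μ : Measure Ω} [IsProbabilityMeasure μ] [Fintype ι]
  {F : Set ι → MeasurableSpace Ω} {D : ι → ι → ℕ} {X : ι → Ω → ℝ} {p L : ℝ}

namespace PF
open BF (CE CE_ge)

lemma smul (h : PF μ F D X p L) (a : ℝ) : PF μ F D (fun i ω => a * X i ω) p L where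
  toFld := h.toFld
  meas i := (h.meas i).const_mul a
  mean i := by rw [integral_const_mul, h.mean i, mul_zero]
  mom i := by
    have e : (fun ω => |a * X i ω| ^ p) = fun ω => |a| ^ p * |X i ω| ^ p := by
      ext ω; rw [abs_mul, Real.mul_rpow (abs_nonneg _) (abs_nonneg _)]
    rw [e]; exact (h.mom i).const_mul _
  hp2 := h.hp2
  hp3 := h.hp3
  hL := h.hL
  card := h.card

lemma bb_smul (h : PF μ F D X p L) (a : ℝ) : bb μ (fun i ω => a * X i ω) p L = |a| ^ p * bb μ X p L := by
  have hL := h.hL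
  unfold bb
  rw [Finset.mul_sum]
  refine Finset.sum_congr rfl fun i _ => ?_
  rw [← integral_const_mul]
  congr 1; ext ω
  rw [← Real.mul_rpow (abs_nonneg _) (by positivity), abs_mul]; congr 1; ring

lemma WW_smul (a : ℝ) (ω : Ω) : WW (fun i ω => a * X i ω) ω = a * WW X ω := by
  unfold WW; rw [Finset.mul_sum]

lemma tail_large (h : PF μ F D X p L) (hb : 1/1536 ≤ bb μ X p L) (hv : ∫ ω, WW X ω ^ 2 ∂μ = 1) {z : ℝ} (hz : 0 < z) :
    z ^ p * μ.real {ω | z ≤ |WW X ω|} ≤ 2 * (1536 * CE + 1) * (1536 * bb μ X p L) := by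
  have hp := h.hp2
  have hb0 : 0 < bb μ X p L := by linarith
  set r := 1 / (1536 * bb μ X p L) with hr
  have hr0 : 0 < r := by positivity
  have hr1 : r ≤ 1 := by rw [hr, div_le_one (by positivity)]; linarith
  set a := r ^ (1 / p) with ha
  have ha0 : 0 < a := by positivity
  have ha1 : a ≤ 1 := Real.rpow_le_one hr0.le hr1 (by positivity)
  have hap : a ^ p = r := by rw [ha, ← Real.rpow_mul hr0.le]; rw [one_div_mul_cancel (by linarith), Real.rpow_one]
  have h' := h.smul a
  have hbb : bb μ (fun i ω => a * X i ω) p L ≤ 1/1536 := by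
    rw [h.bb_smul, abs_of_pos ha0, hap, hr]; apply le_of_eq; field_simp
  have hvv : ∫ ω, WW (fun i ω => a * X i ω) ω ^ 2 ∂μ ≤ 1 := by
    simp_rw [WW_smul, mul_pow]
    rw [integral_const_mul, hv]; nlinarith
  have t := h'.tailR hbb hvv (a * z) (by positivity)
  have e : {ω | a * z ≤ |WW (fun i ω => a * X i ω) ω|} = {ω | z ≤ |WW X ω|} := by
    ext ω; simp only [Set.mem_ofPred_eq]; rw [WW_smul, abs_mul, abs_of_pos ha0]
    exact mul_le_mul_iff_right₀ ha0
  rw [e, Real.mul_rpow ha0.le hz.le, hap, hr] at t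
  have hx : (0:ℝ) < 1536 * bb μ X p L := by positivity
  have t2 := mul_le_mul_of_nonneg_right t hx.le
  refine le_trans (le_of_eq ?_) t2
  field_simp

lemma main_large (h : PF μ F D X p L) (hb : 1/1536 ≤ bb μ X p L) (hv : ∫ ω, WW X ω ^ 2 ∂μ = 1) {z : ℝ} (hz : 0 ≤ z)
    {E : Set ℝ} (hE : MeasurableSet E) (h1 : Set.Iio z ⊆ E) (h2 : E ⊆ Set.Iic z) :
    (1 + z) ^ p * |μ.real (WW X ⁻¹' E) - stdGaussianCDF z| ≤ 300000000 * CE * bb μ X p L := by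
  have hCE := CE_ge
  have hb0 : 0 < bb μ X p L := by linarith
  have hc := cdf_bounds z
  have u0 : 0 ≤ μ.real (WW X ⁻¹' E) := measureReal_nonneg
  have u1 : μ.real (WW X ⁻¹' E) ≤ 1 := measureReal_le_one
  have key := mul_nonneg (sub_nonneg.2 hCE) hb0.le
  rcases le_total z 1 with hz1 | hz1
  · have a := pow8' h.hp2 h.hp3 hz hz1
    have b : |μ.real (WW X ⁻¹' E) - stdGaussianCDF z| ≤ 1 := by rw [abs_le]; constructor <;> linarith
    have := mul_le_mul a b (abs_nonneg _) (by norm_num)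
    nlinarith
  · have t := h.tail_large hb hv (by linarith : 0 < z)
    have q1 := Q_add z
    have q2 := Q_nonneg z
    have q3 := Q_le z (by linarith)
    have q4 : Real.exp (-z^2/2) ≤ Real.exp (-(z/4)) := Real.exp_le_exp.2 (by nlinarith)
    have s : 1 ≤ μ.real (WW X ⁻¹' E) + μ.real {ω | z ≤ |WW X ω|} := by
      refine le_trans ?_ (measureReal_union_le _ _)
      have : WW X ⁻¹' E ∪ {ω | z ≤ |WW X ω|} = Set.univ := by
        refine Set.eq_univ_of_forall fun ω => ?_
        by_cases hω : WW X ω < z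
        · exact Or.inl (h1 hω)
        · exact Or.inr ((not_lt.1 hω).trans (le_abs_self _))
      rw [this]; simp
    have d : |μ.real (WW X ⁻¹' E) - stdGaussianCDF z| ≤ μ.real {ω | z ≤ |WW X ω|} + 2 * Real.exp (-(z/4)) := by
      have t0 : 0 ≤ μ.real {ω | z ≤ |WW X ω|} := measureReal_nonneg
      have := Real.exp_pos (-(z/4))
      rw [abs_le]; constructor <;> linarith
    have a := mul_le_mul_of_nonneg_right (pow8 h.hp2 h.hp3 hz1) (measureReal_nonneg (μ := μ) (s := {ω | z ≤ |WW X ω|}))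
    have b := mul_le_mul_of_nonneg_right (rpow_exp h.hp2 h.hp3 hz) (Real.exp_pos (-(z/4))).le
    rw [mul_assoc, ← Real.exp_add, add_neg_cancel, Real.exp_zero] at b
    have := mul_le_mul_of_nonneg_left d (by positivity : 0 ≤ (1 + z) ^ p)
    nlinarith

lemma main_pos (h : PF μ F D X p L) (hv : ∫ ω, WW X ω ^ 2 ∂μ = 1) {z : ℝ} (hz : 0 ≤ z)
    {E : Set ℝ} (hE : MeasurableSet E) (h1 : Set.Iio z ⊆ E) (h2 : E ⊆ Set.Iic z) :
    (1 + z) ^ p * |μ.real (WW X ⁻¹' E) - stdGaussianCDF z| ≤ 300000000 * CE * bb μ X p L := by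
  rcases le_total (bb μ X p L) (1/1536) with hb | hb
  · exact h.main_small hb hv hz hE h1 h2
  · exact h.main_large hb hv hz hE h1 h2

lemma main (h : PF μ F D X p L) (hv : ∫ ω, WW X ω ^ 2 ∂μ = 1) (z : ℝ) :
    (1 + |z|) ^ p * |μ.real {ω | WW X ω ≤ z} - stdGaussianCDF z| ≤ 300000000 * CE * bb μ X p L := by
  rcases le_total 0 z with hz | hz
  · rw [abs_of_nonneg hz]
    exact h.main_pos hv hz measurableSet_Iic Set.Iio_subset_Iic_self subset_rfl
  · rw [abs_of_nonpos hz]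
    have h' := h.smul (-1)
    have hv' : ∫ ω, WW (fun i ω => (-1) * X i ω) ω ^ 2 ∂μ = 1 := by
      simp_rw [WW_smul, mul_pow]; norm_num; exact hv
    have m := h'.main_pos hv' (z := -z) (by linarith) measurableSet_Iio subset_rfl Set.Iio_subset_Iic_self
    rw [h.bb_smul, abs_neg, abs_one, Real.one_rpow, one_mul] at m
    have e : WW (fun i ω => (-1) * X i ω) ⁻¹' Set.Iio (-z) = {ω | WW X ω ≤ z}ᶜ := by
      ext ω; simp only [Set.mem_preimage, WW_smul, Set.mem_Iio, Set.mem_compl_iff, Set.mem_ofPred_eq, not_le]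
      constructor <;> intro _ <;> linarith
    have ms : MeasurableSet {ω | WW X ω ≤ z} := h.mW measurableSet_Iic
    rw [e, probReal_compl_eq_one_sub ms] at m
    have q := Q_add z
    have q' := cdf_neg z
    have : 1 - μ.real {ω | WW X ω ≤ z} - stdGaussianCDF (-z) = -(μ.real {ω | WW X ω ≤ z} - stdGaussianCDF z) := by linarith
    rwa [this, abs_neg] at m

lemma main' (h : PF μ F D X p L) (hv : ∫ ω, WW X ω ^ 2 ∂μ = 1) (z : ℝ) :
    |μ.real {ω | WW X ω ≤ z} - stdGaussianCDF z| ≤ 2400000000 * CE * (1 + |z|) ^ (-p) * (L ^ p * ∑ i, ∫ ω, |X i ω| ^ p ∂μ) := by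
  have hCE := CE_ge
  have m := h.main hv z
  have b := h.bb_le
  have hz : 0 < (1 + |z|) ^ p := by positivity
  rw [Real.rpow_neg (by positivity), mul_right_comm, ← div_eq_mul_inv, le_div_iff₀ hz]
  have := mul_le_mul_of_nonneg_left b (by positivity : 0 ≤ 300000000 * CE)
  linarith

end PF
end
end BE

namespace BE
section
open Classical in
/-- sites whose block lies in `S` -/
noncomputable def SiteSet {d : ℕ} (J : Finset (Fin d → ℤ)) (S : Set (Fin d → ℤ)) (q : (Fin d → ℤ) → (Fin d → ℤ)) :
    Finset (Fin d → ℤ) := J.filter (fun i => q i ∈ S)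

lemma mem_SiteSet {d : ℕ} {J : Finset (Fin d → ℤ)} {S : Set (Fin d → ℤ)} {q : (Fin d → ℤ) → (Fin d → ℤ)} {i : Fin d → ℤ} :
    i ∈ SiteSet J S q ↔ i ∈ J ∧ q i ∈ S := by
  classical
  unfold SiteSet; rw [Finset.mem_filter]

/-- block index -/
def blk {d : ℕ} (m : ℕ) (i : Fin d → ℤ) : Fin d → ℤ := fun l => i l / ((m : ℤ) + 1)

/-- sup distance -/
def dst {d : ℕ} (u v : Fin d → ℤ) : ℕ := Finset.univ.sup (fun l => (u l - v l).natAbs)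

variable {Ω : Type*} [mΩ : MeasurableSpace Ω] {d : ℕ}

lemma dst_le {u v : Fin d → ℤ} {n : ℕ} : dst u v ≤ n ↔ ∀ l, (u l - v l).natAbs ≤ n := by
  unfold dst; rw [Finset.sup_le_iff]; simp

lemma dst_tri (u v w : Fin d → ℤ) : dst u w ≤ dst u v + dst v w := by
  rw [dst_le]; intro l
  have h1 := dst_le.1 (le_refl (dst u v)) l
  have h2 := dst_le.1 (le_refl (dst v w)) l
  omega

lemma blk_sep (m : ℕ) {i j : Fin d → ℤ} (h : 1 < dst (blk m i) (blk m j)) : ∃ l, (m : ℤ) < |i l - j l| := by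
  by_contra hc
  push Not at hc
  refine absurd h (not_lt.2 (dst_le.2 fun l => ?_))
  have hl := abs_le.1 (hc l)
  unfold blk
  have hm : (0:ℤ) < (m:ℤ) + 1 := by positivity
  have a1 := Int.mul_ediv_add_emod (i l) ((m:ℤ) + 1)
  have a2 := Int.emod_nonneg (i l) hm.ne'
  have a3 := Int.emod_lt_of_pos (i l) hm
  have b1 := Int.mul_ediv_add_emod (j l) ((m:ℤ) + 1)
  have b2 := Int.emod_nonneg (j l) hm.ne'
  have b3 := Int.emod_lt_of_pos (j l) hm
  set qi := i l / ((m:ℤ) + 1)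
  set qj := j l / ((m:ℤ) + 1)
  have c1 : qi - qj < 2 := by
    by_contra hh; push Not at hh; nlinarith
  have c2 : qj - qi < 2 := by
    by_contra hh; push Not at hh; nlinarith
  omega

/-- generated sigma algebra -/
@[reducible]
noncomputable def Fs (X : (Fin d → ℤ) → Ω → ℝ) (J : Finset (Fin d → ℤ)) (m : ℕ) (S : Set (Fin d → ℤ)) : MeasurableSpace Ω :=
  MeasurableSpace.comap (fun ω => fun a : (SiteSet J S (blk m) : Finset (Fin d → ℤ)) => X a.1 ω) inferInstance

lemma Fs_meas (X : (Fin d → ℤ) → Ω → ℝ) (J : Finset (Fin d → ℤ)) (m : ℕ) (S : Set (Fin d → ℤ)) {i : Fin d → ℤ}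
    (hi : i ∈ J) (hS : blk m i ∈ S) : Measurable[Fs X J m S] (X i) := by
  have hm : i ∈ SiteSet J S (blk m) := mem_SiteSet.2 ⟨hi, hS⟩
  have := comap_measurable (m := inferInstance) (fun ω => fun a : (SiteSet J S (blk m) : Finset (Fin d → ℤ)) => X a.1 ω)
  exact (measurable_pi_apply (⟨i, hm⟩ : (SiteSet J S (blk m) : Finset (Fin d → ℤ)))).comp this

lemma Fs_le (X : (Fin d → ℤ) → Ω → ℝ) (J : Finset (Fin d → ℤ)) (m : ℕ) (S : Set (Fin d → ℤ)) (m' : MeasurableSpace Ω)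
    (h : ∀ i ∈ J, blk m i ∈ S → Measurable[m'] (X i)) : Fs X J m S ≤ m' := by
  refine Measurable.comap_le ?_
  refine measurable_pi_iff.2 fun a => ?_
  have ha := mem_SiteSet.1 a.2
  exact h a.1 ha.1 ha.2

lemma ball_card (J : Finset (Fin d → ℤ)) (u : {u // u ∈ J}) :
    ((Finset.univ.filter (fun v : {u // u ∈ J} => dst u.1 v.1 ≤ 9)).card : ℝ) ≤ (19:ℝ) ^ d := by
  have : (Finset.univ.filter (fun v : {u // u ∈ J} => dst u.1 v.1 ≤ 9)).card ≤ (Fintype.piFinset (fun l => Finset.Icc (u.1 l - 9) (u.1 l + 9))).card := by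
    refine Finset.card_le_card_of_injOn (fun v => v.1) (fun v hv => ?_) (fun a _ b _ hab => Subtype.ext hab)
    simp only [Finset.coe_filter, Finset.mem_univ, true_and, Set.mem_ofPred_eq] at hv
    simp only [Finset.mem_coe, Fintype.mem_piFinset, Finset.mem_Icc]
    intro l
    have := dst_le.1 hv l
    omega
  rw [Fintype.card_piFinset] at this
  have e : ∀ l, (Finset.Icc (u.1 l - 9) (u.1 l + 9)).card = 19 := fun l => by rw [Int.card_Icc]; omega
  simp only [e, Finset.prod_const, Finset.card_univ, Fintype.card_fin] at this
  exact_mod_cast this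

lemma blk_card (J : Finset (Fin d → ℤ)) (m : ℕ) (u : Fin d → ℤ) :
    ((J.filter (fun i => blk m i = u)).card : ℝ) ≤ ((m:ℝ) + 1) ^ d := by
  have : (J.filter (fun i => blk m i = u)).card ≤ (Fintype.piFinset (fun l => Finset.Icc (((m:ℤ) + 1) * u l) (((m:ℤ) + 1) * u l + m))).card := by
    refine Finset.card_le_card fun i hi => ?_
    rw [Finset.mem_filter] at hi
    simp only [Fintype.mem_piFinset, Finset.mem_Icc]
    intro l
    have hm : (0:ℤ) < (m:ℤ) + 1 := by positivity
    have e : i l / ((m:ℤ) + 1) = u l := congrFun hi.2 l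
    have a1 := Int.mul_ediv_add_emod (i l) ((m:ℤ) + 1)
    have a2 := Int.emod_nonneg (i l) hm.ne'
    have a3 := Int.emod_lt_of_pos (i l) hm
    rw [e] at a1
    constructor <;> linarith
  rw [Fintype.card_piFinset] at this
  have e : ∀ l, (Finset.Icc (((m:ℤ) + 1) * u l) (((m:ℤ) + 1) * u l + m)).card = m + 1 := fun l => by rw [Int.card_Icc]; omega
  simp only [e, Finset.prod_const, Finset.card_univ, Fintype.card_fin] at this
  exact_mod_cast this

lemma field_PF (μ : Measure Ω) [IsProbabilityMeasure μ] (J : Finset (Fin d → ℤ)) (m : ℕ) (p : ℝ) (hp : 2 < p) (hp3 : p ≤ 3)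
    (X : (Fin d → ℤ) → Ω → ℝ)
    (hX : ∀ i ∈ J, Measurable (X i)) (h0 : ∀ i ∈ J, ∫ ω, X i ω ∂μ = 0)
    (hm : ∀ i ∈ J, Integrable (fun ω => |X i ω| ^ p) μ)
    (hI : ∀ A B : Finset (Fin d → ℤ), A ⊆ J → B ⊆ J →
        (∀ i ∈ A, ∀ j ∈ B, ∃ l, (m : ℤ) < |i l - j l|) →
        IndepFun (fun ω => fun a : (A : Finset (Fin d → ℤ)) => X a.1 ω)
          (fun ω => fun b : (B : Finset (Fin d → ℤ)) => X b.1 ω) μ) :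
    PF μ (fun S : Set {u // u ∈ J.image (blk m)} => Fs X J m (Subtype.val '' S)) (fun u v => dst u.1 v.1)
      (fun u ω => ∑ i ∈ J with blk m i = u.1, X i ω) p ((19:ℝ) ^ d) := by
  have hL : ∀ i ∈ J, MemLp (X i) (ENNReal.ofReal p) μ := fun i hi => by
    rw [← integrable_norm_rpow_iff (hX i hi).aestronglyMeasurable (by simp; linarith) (by simp), ENNReal.toReal_ofReal (by linarith)]
    exact hm i hi
  refine { le := ?_, mono := ?_, self := ?_, symm := ?_, tri := ?_, indep := ?_, meas := ?_, mean := ?_, mom := ?_, hp2 := hp, hp3 := hp3, hL := ?_, card := ?_ }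
  · intro S
    exact Fs_le _ _ _ _ _ fun i hi _ => hX i hi
  · intro S T hST
    exact Fs_le _ _ _ _ _ fun i hi hS => Fs_meas X J m _ hi (Set.image_mono hST hS)
  · intro i
    have : dst i.1 i.1 ≤ 0 := dst_le.2 fun l => by simp
    omega
  · intro i j
    unfold dst
    congr 1; ext l; omega
  · intro i j k; exact dst_tri _ _ _
  · intro S T hST
    have := hI (SiteSet J (Subtype.val '' S) (blk m)) (SiteSet J (Subtype.val '' T) (blk m))
      (fun i hi => (mem_SiteSet.1 hi).1) (fun i hi => (mem_SiteSet.1 hi).1) (by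
        intro i hi j hj
        rw [mem_SiteSet] at hi hj
        obtain ⟨u, hu, hu'⟩ := hi.2
        obtain ⟨v, hv, hv'⟩ := hj.2
        apply blk_sep
        rw [← hu', ← hv']
        exact hST u hu v hv)
    rw [IndepFun_iff_Indep] at this
    exact this
  · intro u
    refine Finset.measurable_sum _ fun i hi => ?_
    rw [Finset.mem_filter] at hi
    exact Fs_meas X J m _ hi.1 ⟨u, rfl, hi.2.symm⟩
  · intro u
    rw [integral_finsetSum]
    · exact Finset.sum_eq_zero fun i hi => h0 i (Finset.mem_filter.1 hi).1
    · exact fun i hi => (hL i (Finset.mem_filter.1 hi).1).integrable (by simp; linarith)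
  · intro u
    have : MemLp (fun ω => ∑ i ∈ J with blk m i = u.1, X i ω) (ENNReal.ofReal p) μ :=
      memLp_finsetSum _ fun i hi => hL i (Finset.mem_filter.1 hi).1
    have := this.integrable_norm_rpow (by simp; linarith) (by simp)
    rwa [ENNReal.toReal_ofReal (by linarith)] at this
  · exact one_le_pow₀ (by norm_num)
  · intro u; exact ball_card _ u

end
end BE

open BE

theorem stmt_6 :
    ∃ C : ℝ, 0 < C ∧
    ∀ (Ω : Type) [MeasurableSpace Ω] (μ : Measure Ω) [IsProbabilityMeasure μ]
      (d : ℕ), 0 < d →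
    ∀ (J : Finset (Fin d → ℤ)) (m : ℕ) (p : ℝ), 2 < p → p ≤ 3 →
    ∀ (X : (Fin d → ℤ) → Ω → ℝ),
      (∀ i ∈ J, Measurable (X i)) →
      (∀ i ∈ J, ∫ ω, X i ω ∂μ = 0) →
      (∀ i ∈ J, Integrable (fun ω => |X i ω| ^ p) μ) →
      (∀ A B : Finset (Fin d → ℤ), A ⊆ J → B ⊆ J →
        (∀ i ∈ A, ∀ j ∈ B, ∃ l, (m : ℤ) < |i l - j l|) →
        IndepFun (fun ω => fun a : (A : Finset (Fin d → ℤ)) => X a.1 ω)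
          (fun ω => fun b : (B : Finset (Fin d → ℤ)) => X b.1 ω) μ) →
    ∀ (W : Ω → ℝ), (∀ ω, W ω = ∑ i ∈ J, X i ω) →
      (∫ ω, (W ω) ^ 2 ∂μ) = 1 →
    ∀ z : ℝ, |(μ {ω | W ω ≤ z}).toReal - stdGaussianCDF z| ≤
      C * (1 + |z|) ^ (-p) * (19 : ℝ) ^ (p * d) * ((m : ℝ) + 1) ^ ((p - 1) * d) *
        ∑ i ∈ J, ∫ ω, |X i ω| ^ p ∂μ := by
  have hCE := BF.CE_ge
  refine ⟨2400000000 * BF.CE, by positivity, ?_⟩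
  intro Ω _ μ _ d hd J m p hp hp3 X hX h0 hm hI W hW hv z
  have h := field_PF μ J m p hp hp3 X hX h0 hm hI
  set Y : {u // u ∈ J.image (blk m)} → Ω → ℝ := fun u ω => ∑ i ∈ J with blk m i = u.1, X i ω with hY
  have fib : ∀ f : (Fin d → ℤ) → ℝ, ∑ u : {u // u ∈ J.image (blk m)}, ∑ i ∈ J with blk m i = u.1, f i = ∑ i ∈ J, f i := fun f => by
    rw [Finset.sum_coe_sort (J.image (blk m)) (fun u => ∑ i ∈ J with blk m i = u, f i)]
    exact Finset.sum_fiberwise_of_maps_to (fun i hi => Finset.mem_image_of_mem _ hi) _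
  have hWW : WW Y = W := by
    ext ω; rw [hW ω]; exact fib fun i => X i ω
  have m1 := h.main' (by rw [hWW]; exact hv) z
  rw [hWW] at m1
  have s1 : ∀ u, ∫ ω, |Y u ω| ^ p ∂μ ≤ (((m:ℝ) + 1) ^ d) ^ (p - 1) * ∑ i ∈ J with blk m i = u.1, ∫ ω, |X i ω| ^ p ∂μ := fun u => by
    rw [← integral_finsetSum _ (fun i hi => hm i (Finset.mem_filter.1 hi).1), ← integral_const_mul]
    refine integral_mono (h.mom u) ((integrable_finsetSum _ fun i hi => hm i (Finset.mem_filter.1 hi).1).const_mul _) fun ω => ?_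
    exact psum _ (by linarith) (blk_card J m u.1) _
  have s2 : ∑ u, ∫ ω, |Y u ω| ^ p ∂μ ≤ (((m:ℝ) + 1) ^ d) ^ (p - 1) * ∑ i ∈ J, ∫ ω, |X i ω| ^ p ∂μ := by
    refine (Finset.sum_le_sum fun u _ => s1 u).trans ?_
    rw [← Finset.mul_sum, fib]
  have e1 : ((19:ℝ) ^ d) ^ p = (19:ℝ) ^ (p * d) := by
    rw [← Real.rpow_natCast, ← Real.rpow_mul (by norm_num), mul_comm]
  have e2 : (((m:ℝ) + 1) ^ d) ^ (p - 1) = ((m:ℝ) + 1) ^ ((p - 1) * d) := by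
    rw [← Real.rpow_natCast, ← Real.rpow_mul (by positivity), mul_comm]
  rw [e1] at m1
  rw [e2] at s2
  refine m1.trans ?_
  have hc : 0 ≤ 2400000000 * BF.CE * (1 + |z|) ^ (-p) * (19:ℝ) ^ (p * d) := by positivity
  have := mul_le_mul_of_nonneg_left s2 hc
  refine le_trans (le_of_eq ?_) (this.trans (le_of_eq ?_)) <;> ring
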